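/- Let M be a closed oriented manifold of dimension n ≥ 3 such that H²(M; ℚ) contains an atoroidal class. Then TC(M) ≥ 6 if n is odd, and TC(M) ≥ 7 if n is even. -/

import Mathlib

/-!
Common definitions: rational singular (co)homology, homotopy groups and asphericity,
classifying maps, closed oriented manifolds, connected sums, wedges, topological
complexity, sectional category weights, and (a)toroidal classes.
-/

open CategoryTheory unitInterval Topology

noncomputable section

/-- The singular chain complex with rational coefficients. -/
def singularChainComplex : TopCat.{0} ⥤ ChainComplex (ModuleCat.{0} ℚ) ℕ :=
  TopCat.toSSet ⋙ ((SimplicialObject.whiskering _ _).obj (ModuleCat.free ℚ)) ⋙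
    AlgebraicTopology.alternatingFaceMapComplex (ModuleCat ℚ)

/-- The `k`-th singular homology functor with rational coefficients. -/
def singularHomologyFunctor (k : ℕ) : TopCat.{0} ⥤ ModuleCat.{0} ℚ :=
  singularChainComplex ⋙ HomologicalComplex.homologyFunctor (ModuleCat ℚ) (ComplexShape.down ℕ) k

/-- `H k X` is the `k`-th rational singular homology group `H_k(X; ℚ)`. -/
abbrev H (k : ℕ) (X : Type) [TopologicalSpace X] : Type :=
  (singularHomologyFunctor k).obj (TopCat.of X)

/-- The map `H_k(f; ℚ)` induced on rational singular homology by a continuous map `f`. -/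
def Hmap (k : ℕ) {X Y : Type} [TopologicalSpace X] [TopologicalSpace Y] (f : C(X, Y)) :
    H k X →ₗ[ℚ] H k Y :=
  ((singularHomologyFunctor k).map (TopCat.ofHom f : TopCat.of X ⟶ TopCat.of Y)).hom

/-- `Hco k X` is the `k`-th rational singular cohomology group `H^k(X; ℚ)`; over the
field `ℚ`, universal coefficients identify it naturally with the dual of homology. -/
abbrev Hco (k : ℕ) (X : Type) [TopologicalSpace X] : Type :=
  Module.Dual ℚ (H k X)

/-- The map `H^k(f; ℚ)` induced on rational singular cohomology (the Kronecker-dual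
of the map induced on homology). -/
def Hcomap (k : ℕ) {X Y : Type} [TopologicalSpace X] [TopologicalSpace Y] (f : C(X, Y)) :
    Hco k Y →ₗ[ℚ] Hco k X :=
  (Hmap k f).dualMap

/-- Transport of a cohomology class along an equality of degrees. -/
def coCast {X : Type} [TopologicalSpace X] {p q : ℕ} (h : p = q) :
    Hco p X →ₗ[ℚ] Hco q X := by
  subst h; exact LinearMap.id

/-- A non-zero element spanning a rational vector space (necessarily one-dimensional);
this characterises fundamental classes in the top (co)homology of closed connected
oriented manifolds with rational coefficients. -/
def IsGenerator {W : Type} [AddCommGroup W] [Module ℚ W] (w : W) : Prop :=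
  w ≠ 0 ∧ ∀ v : W, ∃ c : ℚ, v = c • w

/-- `π₂(X) = 0`. -/
def Pi2Trivial (X : Type) [TopologicalSpace X] : Prop :=
  ∀ x : X, Subsingleton (HomotopyGroup (Fin 2) X x)

/-- A space is aspherical iff all its homotopy groups in degrees `≥ 2` vanish
(for manifolds this is equivalent to contractibility of the universal cover). -/
def Aspherical (X : Type) [TopologicalSpace X] : Prop :=
  ∀ k : ℕ, 2 ≤ k → ∀ x : X, Subsingleton (HomotopyGroup (Fin k) X x)

/-- A continuous map, regarded as a morphism in `TopCat`. -/
def toTopHom {X Y : Type} [TopologicalSpace X] [TopologicalSpace Y] (f : C(X, Y)) :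
    TopCat.of X ⟶ TopCat.of Y := TopCat.ofHom f

/-- The homomorphism induced by a continuous map on fundamental groups. -/
def π₁map {X Y : Type} [TopologicalSpace X] [TopologicalSpace Y] (f : C(X, Y)) (x : X) :
    FundamentalGroup X x →* FundamentalGroup Y (f x) :=
  Functor.mapEnd (X := FundamentalGroupoid.mk x)
    (show FundamentalGroupoid X ⥤ FundamentalGroupoid Y from
      FundamentalGroupoid.fundamentalGroupoidFunctor.map (toTopHom f))

/-- `B` is a model for an Eilenberg–MacLane space `K(G, 1)`:  it is path-connected and
all its higher homotopy groups vanish. -/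
def IsAsphericalSpace (B : Type) [TopologicalSpace B] : Prop :=
  PathConnectedSpace B ∧ Aspherical B

/-- `c : M → B` is a classifying map for `M`, i.e. `B` is a model for `Bπ₁(M)`
(path-connected with vanishing higher homotopy groups) and `c` induces an isomorphism
on fundamental groups. -/
def IsClassifyingMap {M B : Type} [TopologicalSpace M] [TopologicalSpace B]
    (c : C(M, B)) : Prop :=
  IsAsphericalSpace B ∧ ∀ x : M, Function.Bijective (π₁map c x)

/-- Every point has a neighbourhood homeomorphic to `ℝⁿ`. -/
def IsLocallyEuclidean (n : ℕ) (M : Type) [TopologicalSpace M] : Prop :=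
  ∀ x : M, ∃ U : Set M, x ∈ U ∧ IsOpen U ∧ Nonempty (U ≃ₜ EuclideanSpace ℝ (Fin n))

/-- A closed connected oriented topological `n`-manifold.  (For a closed connected
`n`-manifold, orientability is equivalent to `H_n(M; ℚ) ≠ 0`.) -/
def IsClosedOrientedManifold (n : ℕ) (M : Type) [TopologicalSpace M] : Prop :=
  CompactSpace M ∧ T2Space M ∧ SecondCountableTopology M ∧ ConnectedSpace M ∧
    IsLocallyEuclidean n M ∧ Nontrivial (H n M)

/-- Data exhibiting `N` as a connected sum `M₁ # M₂` of `n`-manifolds:  `N` is covered by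
two closed pieces `C₁`, `C₂`, homeomorphic to `M₁` resp. `M₂` with an embedded open ball
removed, which overlap exactly along the boundary spheres.  (Gluing along any
homeomorphism of the sphere yields a space homeomorphic to the connected sum.) -/
structure ConnectedSumData (n : ℕ) (N M₁ M₂ : Type) [TopologicalSpace N]
    [TopologicalSpace M₁] [TopologicalSpace M₂] where
  φ₁ : EuclideanSpace ℝ (Fin n) → M₁
  φ₂ : EuclideanSpace ℝ (Fin n) → M₂
  emb₁ : IsOpenEmbedding φ₁
  emb₂ : IsOpenEmbedding φ₂
  C₁ : Set N
  C₂ : Set N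
  closed₁ : IsClosed C₁
  closed₂ : IsClosed C₂
  cover : C₁ ∪ C₂ = Set.univ
  h₁ : C₁ ≃ₜ ((φ₁ '' Metric.ball 0 1)ᶜ : Set M₁)
  h₂ : C₂ ≃ₜ ((φ₂ '' Metric.ball 0 1)ᶜ : Set M₂)
  inter₁ : ∀ x : C₁, (x : N) ∈ C₂ ↔ ((h₁ x : M₁) ∈ φ₁ '' Metric.sphere 0 1)
  inter₂ : ∀ x : C₂, (x : N) ∈ C₁ ↔ ((h₂ x : M₂) ∈ φ₂ '' Metric.sphere 0 1)

/-- `N` is a connected sum of `M₁` and `M₂` (as `n`-manifolds). -/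
def IsConnectedSum (n : ℕ) (N M₁ M₂ : Type) [TopologicalSpace N]
    [TopologicalSpace M₁] [TopologicalSpace M₂] : Prop :=
  Nonempty (ConnectedSumData n N M₁ M₂)

/-- The degree-one pinch map `N = M₁ # M₂ → M₁`:  it restricts to the canonical
identification on the `M₁`-piece and sends the `M₂`-piece into the closed ball. -/
def ConnectedSumData.IsPinchFst {n : ℕ} {N M₁ M₂ : Type} [TopologicalSpace N]
    [TopologicalSpace M₁] [TopologicalSpace M₂] (D : ConnectedSumData n N M₁ M₂)
    (p : C(N, M₁)) : Prop :=
  (∀ x : D.C₁, p (x : N) = (D.h₁ x : M₁)) ∧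
    ∀ x : D.C₂, p (x : N) ∈ D.φ₁ '' Metric.closedBall 0 1

/-- The degree-one pinch map `N = M₁ # M₂ → M₂`. -/
def ConnectedSumData.IsPinchSnd {n : ℕ} {N M₁ M₂ : Type} [TopologicalSpace N]
    [TopologicalSpace M₁] [TopologicalSpace M₂] (D : ConnectedSumData n N M₁ M₂)
    (p : C(N, M₂)) : Prop :=
  (∀ x : D.C₂, p (x : N) = (D.h₂ x : M₂)) ∧
    ∀ x : D.C₁, p (x : N) ∈ D.φ₂ '' Metric.closedBall 0 1

/-- `N` is an iterated connected sum `M 0 # M 1 # ⋯ # M (m-1)` of `n`-manifolds. -/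
def IsIteratedConnectedSum (n : ℕ) (N : Type) [TopologicalSpace N] :
    (m : ℕ) → (Fin m → TopCat.{0}) → Prop
  | 0, _ => False
  | 1, M => Nonempty (N ≃ₜ (M 0))
  | (m + 2), M =>
      ∃ P : TopCat.{0}, IsIteratedConnectedSum n P (m + 1) (fun i => M i.castSucc) ∧
        IsConnectedSum n N P (M (Fin.last (m + 1)))

/-- `W` is the wedge (one-point union) of the pointed spaces `(M₁, x₁)` and `(M₂, x₂)`. -/
def IsWedge (W M₁ M₂ : Type) [TopologicalSpace W] [TopologicalSpace M₁]
    [TopologicalSpace M₂] (x₁ : M₁) (x₂ : M₂) : Prop :=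
  ∃ (j₁ : C(M₁, W)) (j₂ : C(M₂, W)), IsClosedEmbedding j₁ ∧ IsClosedEmbedding j₂ ∧
    Set.range j₁ ∪ Set.range j₂ = Set.univ ∧
    Set.range j₁ ∩ Set.range j₂ = {j₁ x₁} ∧ j₁ x₁ = j₂ x₂

/-- `X × X` admits a cover by `m` open sets over each of which there is a continuous
motion planning rule (a continuous local section of the free path fibration). -/
def TCCoverable (X : Type) [TopologicalSpace X] (m : ℕ) : Prop :=
  ∃ U : Fin m → Set (X × X), (∀ i, IsOpen (U i)) ∧ (⋃ i, U i) = Set.univ ∧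
    ∀ i, ∃ s : C(U i, C(I, X)),
      ∀ p : U i, (s p) 0 = (p : X × X).1 ∧ (s p) 1 = (p : X × X).2

/-- The (unreduced) topological complexity of `X`:  the smallest number of open sets in a
cover of `X × X` admitting continuous motion planning rules (`⊤` if there is none). -/
def topologicalComplexity (X : Type) [TopologicalSpace X] : ℕ∞ :=
  sInf {c : ℕ∞ | ∃ m : ℕ, c = m ∧ TCCoverable X m}

/-- The free path fibration `X^{[0,1]} → X × X`, `γ ↦ (γ(0), γ(1))`. -/
def pathFibration (X : Type) [TopologicalSpace X] : C(C(I, X), X × X) :=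
  ⟨fun γ => (γ 0, γ 1), (continuous_eval_const 0).prodMk (continuous_eval_const 1)⟩

/-- The Schwarz genus (sectional category) of the pullback of `p` along `f` is at most
`k`:  `Y` is covered by `k` open sets over each of which `f` lifts continuously
through `p`. -/
def GenusPullbackLE {E B : Type} [TopologicalSpace E] [TopologicalSpace B] (p : C(E, B))
    {Y : Type} [TopologicalSpace Y] (f : C(Y, B)) (k : ℕ) : Prop :=
  ∃ U : Fin k → Set Y, (∀ i, IsOpen (U i)) ∧ (⋃ i, U i) = Set.univ ∧
    ∀ i, ∃ s : C(U i, E), ∀ y : U i, p (s y) = f (y : Y)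

/-- The sectional category weight of a cohomology class `u` on the base of `p`:  the
supremum of those `m` such that `u` pulls back to zero along every map `f` for which
the pullback of `p` along `f` has Schwarz genus at most `m`. -/
def secatWeight {E B : Type} [TopologicalSpace E] [TopologicalSpace B] (p : C(E, B))
    {k : ℕ} (u : Hco k B) : ℕ∞ :=
  sSup {w : ℕ∞ | ∃ m : ℕ, w = m ∧ ∀ (Y : Type) [TopologicalSpace Y] (f : C(Y, B)),
    GenusPullbackLE p f m → Hcomap k f u = 0}

/-- The topological complexity weight:  sectional category weight with respect to the
free path fibration. -/
def tcWeight {X : Type} [TopologicalSpace X] {k : ℕ} (u : Hco k (X × X)) : ℕ∞ :=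
  secatWeight (pathFibration X) u

/-- The `n`-dimensional sphere. -/
abbrev unitSphere (n : ℕ) : Type :=
  ↥(Metric.sphere (0 : EuclideanSpace ℝ (Fin (n + 1))) 1)

/-- The 2-torus `T² = S¹ × S¹`. -/
abbrev Torus2 : Type := unitSphere 1 × unitSphere 1

/-- A degree-two rational homology class `v` is toroidal (relative to a fundamental class
`ωT` of the torus) if some map from the torus realises a non-zero multiple of `v`. -/
def IsToroidal {X : Type} [TopologicalSpace X] (ωT : H 2 Torus2) (v : H 2 X) : Prop :=
  ∃ (f : C(Torus2, X)) (α : ℚ), α ≠ 0 ∧ Hmap 2 f ωT = α • v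

/-- A non-zero degree-two rational homology class is atoroidal if it is not toroidal. -/
def IsAtoroidal {X : Type} [TopologicalSpace X] (ωT : H 2 Torus2) (v : H 2 X) : Prop :=
  v ≠ 0 ∧ ¬ IsToroidal ωT v

/-- A degree-two rational cohomology class `u` is toroidal if it pulls back non-trivially
under some map from the torus. -/
def IsCoToroidal {X : Type} [TopologicalSpace X] (u : Hco 2 X) : Prop :=
  ∃ f : C(Torus2, X), Hcomap 2 f u ≠ 0

/-- A non-zero degree-two rational cohomology class is atoroidal if it pulls back to zero
under every map from the torus. -/
def IsCoAtoroidal {X : Type} [TopologicalSpace X] (u : Hco 2 X) : Prop :=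
  u ≠ 0 ∧ ∀ f : C(Torus2, X), Hcomap 2 f u = 0

namespace SingChain

/-! ### Chains on ordered vertex lists -/

section Lists

variable {V W : Type}

/-- The basis vector of an element. -/
def bas {α : Type*} (l : α) : α →₀ ℚ := Finsupp.single l 1

/-- The linear map with prescribed values on the basis. -/
def lin {α : Type*} {N : Type*} [AddCommGroup N] [Module ℚ N] (f : α → N) :
    (α →₀ ℚ) →ₗ[ℚ] N := Finsupp.linearCombination ℚ f

theorem lin_bas {α : Type*} {N : Type*} [AddCommGroup N] [Module ℚ N] (f : α → N) (a : α) :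
    lin f (bas a) = f a := by simp [lin, bas]

/-- Two linear maps out of a finitely supported function space agree if they agree on
basis vectors. -/
theorem lin_ext {α : Type*} {N : Type*} [AddCommGroup N] [Module ℚ N]
    {f g : (α →₀ ℚ) →ₗ[ℚ] N} (h : ∀ a, f (bas a) = g (bas a)) : f = g :=
  Finsupp.lhom_ext' fun a => LinearMap.ext_ring (h a)

/-- Formal rational combinations of vertex lists. -/
abbrev LCh (V : Type) : Type := List V →₀ ℚ

/-- Adjoin a new first vertex. -/
def cons (v : V) : LCh V →ₗ[ℚ] LCh V := lin fun l => bas (v :: l)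

@[simp] theorem cons_bas (v : V) (l : List V) : cons v (bas l) = bas (v :: l) := lin_bas _ _

/-- The augmented boundary of a list. -/
def bdL : List V → LCh V
  | [] => 0
  | v :: l => bas l - cons v (bdL l)

/-- The augmented boundary. -/
def bd : LCh V →ₗ[ℚ] LCh V := lin bdL

@[simp] theorem bd_nil : bd (bas ([] : List V)) = 0 := by simp [bd, bdL, lin_bas]

theorem bd_cons_bas (v : V) (l : List V) :
    bd (bas (v :: l)) = bas l - cons v (bd (bas l)) := by simp [bd, bdL, lin_bas]

@[simp] theorem bd_cons (v : V) (x : LCh V) : bd (cons v x) = x - cons v (bd x) := by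
  have : bd ∘ₗ cons v = LinearMap.id - cons v ∘ₗ bd := lin_ext fun l => by
    simp [bd_cons_bas]
  exact LinearMap.congr_fun this x

theorem bas_cons (v : V) (l : List V) : bas (v :: l) = cons v (bas l) := by simp

@[simp] theorem bd_bd (x : LCh V) : bd (bd x) = 0 := by
  have : bd ∘ₗ bd = (0 : LCh V →ₗ[ℚ] LCh V) := lin_ext fun l => by
    induction l with
    | nil => simp
    | cons v l ih =>
      simp only [LinearMap.comp_apply, LinearMap.zero_apply] at ih ⊢
      rw [bas_cons, bd_cons, map_sub, bd_cons, ih]; simp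
  exact LinearMap.congr_fun this x

/-- The map induced by a map of vertices. -/
def lmap (f : V → W) : LCh V →ₗ[ℚ] LCh W := lin fun l => bas (l.map f)

@[simp] theorem lmap_bas (f : V → W) (l : List V) : lmap f (bas l) = bas (l.map f) :=
  lin_bas _ _

@[simp] theorem lmap_cons (f : V → W) (v : V) (x : LCh V) :
    lmap f (cons v x) = cons (f v) (lmap f x) := by
  have : lmap f ∘ₗ cons v = cons (f v) ∘ₗ lmap f := lin_ext fun l => by simp
  exact LinearMap.congr_fun this x

@[simp] theorem lmap_bd (f : V → W) (x : LCh V) : lmap f (bd x) = bd (lmap f x) := by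
  have : lmap f ∘ₗ bd = bd ∘ₗ lmap f := lin_ext fun l => by
    induction l with
    | nil => simp
    | cons v l ih =>
      simp only [LinearMap.comp_apply] at ih ⊢
      rw [bas_cons, bd_cons, map_sub, lmap_cons, ih]; simp [bd_cons_bas]
  exact LinearMap.congr_fun this x

/-- The sign involution, multiplication by `-1` to the number of vertices. -/
def sg : LCh V →ₗ[ℚ] LCh V := lin fun l => (-1 : ℚ) ^ l.length • bas l

theorem sg_bas (l : List V) : sg (bas l) = (-1 : ℚ) ^ l.length • bas l := lin_bas _ _

@[simp] theorem sg_nil : sg (bas ([] : List V)) = bas [] := by rw [sg_bas]; simp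

@[simp] theorem sg_cons (v : V) (x : LCh V) : sg (cons v x) = - cons v (sg x) := by
  have : sg ∘ₗ cons v = - cons v ∘ₗ sg := lin_ext fun l => by
    simp only [LinearMap.comp_apply, cons_bas, LinearMap.neg_apply, sg_bas, map_smul,
      List.length_cons, pow_succ]
    simp
  exact LinearMap.congr_fun this x

@[simp] theorem sg_sg (x : LCh V) : sg (sg x) = x := by
  have : sg ∘ₗ sg = (LinearMap.id : LCh V →ₗ[ℚ] LCh V) := lin_ext fun l => by
    simp only [LinearMap.comp_apply, sg_bas, map_smul, smul_smul, ← mul_pow]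
    simp
  exact LinearMap.congr_fun this x

@[simp] theorem sg_bd (x : LCh V) : sg (bd x) = - bd (sg x) := by
  have : sg ∘ₗ bd = - (bd ∘ₗ sg : LCh V →ₗ[ℚ] LCh V) := lin_ext fun l => by
    induction l with
    | nil => simp
    | cons v l ih =>
      simp only [LinearMap.comp_apply, LinearMap.neg_apply] at ih ⊢
      rw [bas_cons, bd_cons, map_sub, sg_cons, ih, sg_cons]; simp
  exact LinearMap.congr_fun this x

@[simp] theorem lmap_sg (f : V → W) (x : LCh V) : lmap f (sg x) = sg (lmap f x) := by
  have : lmap f ∘ₗ sg = sg ∘ₗ lmap f := lin_ext fun l => by simp [sg_bas]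
  exact LinearMap.congr_fun this x

/-- Chains of lists with `m` vertices. -/
def ldeg (V : Type) (m : ℕ) : Submodule ℚ (LCh V) := Finsupp.supported ℚ ℚ {l | l.length = m}

theorem bas_mem_ldeg (l : List V) : bas l ∈ ldeg V l.length :=
  Finsupp.single_mem_supported _ _ rfl

/-- To check membership on a homogeneous part it suffices to check basis vectors. -/
theorem supported_le_comap {α : Type*} {N : Type*} [AddCommGroup N] [Module ℚ N]
    {S : Set α} {f : (α →₀ ℚ) →ₗ[ℚ] N} {Q : Submodule ℚ N} (h : ∀ a ∈ S, f (bas a) ∈ Q) :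
    ∀ x ∈ Finsupp.supported ℚ ℚ S, f x ∈ Q := by
  intro x hx
  rw [Finsupp.supported_eq_span_single] at hx
  have : Submodule.span ℚ ((fun i => Finsupp.single i (1 : ℚ)) '' S) ≤ Q.comap f := by
    rw [Submodule.span_le]
    rintro _ ⟨a, ha, rfl⟩
    exact h a ha
  exact this hx

theorem cons_mem_ldeg (v : V) {m : ℕ} {x : LCh V} (hx : x ∈ ldeg V m) :
    cons v x ∈ ldeg V (m + 1) := by
  refine supported_le_comap (f := cons v) (Q := ldeg V (m + 1)) ?_ x hx
  rintro l rfl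
  rw [cons_bas]; exact bas_mem_ldeg (v :: l)

theorem bdL_mem_ldeg (l : List V) : bd (bas l) ∈ ldeg V (l.length - 1) := by
  induction l with
  | nil => simp
  | cons v l ih =>
    rw [bd_cons_bas]
    refine Submodule.sub_mem _ (bas_mem_ldeg l) ?_
    cases l with
    | nil => simp
    | cons w l => exact cons_mem_ldeg v ih

end Lists

/-! ### Affine combinations -/

/-- The simplex with `m` vertices (empty for `m = 0`). -/
abbrev Sx (m : ℕ) : Type := stdSimplex ℝ (Fin m)

/-- Affine combinations inside a simplex. -/
def comb {m k : ℕ} (t : Fin k → Sx m) (x : Sx k) : Sx m :=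
  ⟨fun j => ∑ i, x i * t i j, fun j => Finset.sum_nonneg fun i _ => mul_nonneg (x.2.1 i) ((t i).2.1 j), by
    rw [Finset.sum_comm]
    simp only [← Finset.mul_sum]
    have : ∀ i, ∑ j, t i j = 1 := fun i => (t i).2.2
    simp only [this, mul_one]; exact x.2.2⟩

theorem comb_apply {m k : ℕ} (t : Fin k → Sx m) (x : Sx k) (j : Fin m) :
    comb t x j = ∑ i, x i * t i j := rfl

theorem continuous_coord {m : ℕ} (i : Fin m) : Continuous fun x : Sx m => x i :=
  (continuous_apply i).comp continuous_subtype_val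

/-- Spaces with continuous affine combinations. -/
class Cvx (K : Type) [TopologicalSpace K] where
  aff : ∀ {m : ℕ}, (Fin m → K) → C(Sx m, K)
  aff_vertex : ∀ {m : ℕ} (s : Fin m → K) (i : Fin m), aff s (stdSimplex.vertex i) = s i
  aff_comb : ∀ {m k : ℕ} (s : Fin m → K) (t : Fin k → Sx m) (x : Sx k),
    aff s (comb t x) = aff (fun i => aff s (t i)) x

open Cvx

instance (p : ℕ) : Cvx (Sx p) where
  aff s := ⟨comb s, by
    refine Continuous.subtype_mk (continuous_pi fun j => ?_) _
    exact continuous_finsetSum _ fun i _ => (continuous_coord i).mul continuous_const⟩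
  aff_vertex s i := by
    refine stdSimplex.ext (funext fun j => ?_)
    change ∑ k, (stdSimplex.vertex i : Sx _) k * s k j = s i j
    simp [Pi.single_apply]
  aff_comb s t x := by
    refine stdSimplex.ext (funext fun j => ?_)
    change ∑ i, (∑ k, x k * t k i) * s i j = ∑ k, x k * ∑ i, t k i * s i j
    simp only [Finset.sum_mul, Finset.mul_sum]
    rw [Finset.sum_comm]
    simp only [mul_assoc]

theorem aff_apply_simplex {p m : ℕ} (s : Fin m → Sx p) (x : Sx m) (j : Fin p) :
    aff s x j = ∑ i, x i * s i j := rfl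

instance {K L : Type} [TopologicalSpace K] [TopologicalSpace L] [Cvx K] [Cvx L] :
    Cvx (K × L) where
  aff s := (aff fun i => (s i).1).prodMk (aff fun i => (s i).2)
  aff_vertex s i := Prod.ext (aff_vertex (fun i => (s i).1) i) (aff_vertex (fun i => (s i).2) i)
  aff_comb s t x := Prod.ext (aff_comb (fun i => (s i).1) t x) (aff_comb (fun i => (s i).2) t x)

/-- A normed space, viewed with its affine combinations. -/
instance {E : Type} [NormedAddCommGroup E] [NormedSpace ℝ E] : Cvx E where
  aff s := ⟨fun x => ∑ i, x i • s i,
    continuous_finsetSum _ fun i _ => (continuous_coord i).smul continuous_const⟩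
  aff_vertex s i := by simp [Pi.single_apply]
  aff_comb s t x := by
    simp only [ContinuousMap.coe_mk, comb_apply, Finset.sum_smul, Finset.smul_sum, smul_smul]
    rw [Finset.sum_comm]

/-- Continuous maps preserving affine combinations. -/
def IsAff {K L : Type} [TopologicalSpace K] [TopologicalSpace L] [Cvx K] [Cvx L]
    (g : K → L) : Prop := ∀ (m : ℕ) (s : Fin m → K) (x : Sx m), g (aff s x) = aff (g ∘ s) x

theorem isAff_aff {K : Type} [TopologicalSpace K] [Cvx K] {m : ℕ} (s : Fin m → K) :
    IsAff (aff s : Sx m → K) := fun _ t x => aff_comb s t x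

theorem isAff_fst {K L : Type} [TopologicalSpace K] [TopologicalSpace L] [Cvx K] [Cvx L] :
    IsAff (Prod.fst : K × L → K) := fun _ _ _ => rfl

theorem isAff_snd {K L : Type} [TopologicalSpace K] [TopologicalSpace L] [Cvx K] [Cvx L] :
    IsAff (Prod.snd : K × L → L) := fun _ _ _ => rfl

theorem IsAff.prodMap {K L K' L' : Type} [TopologicalSpace K] [TopologicalSpace L] [Cvx K] [Cvx L]
    [TopologicalSpace K'] [TopologicalSpace L'] [Cvx K'] [Cvx L'] {f : K → K'} {g : L → L'}
    (hf : IsAff f) (hg : IsAff g) : IsAff (Prod.map f g) := fun m s x =>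
  Prod.ext (hf m (fun i => (s i).1) x) (hg m (fun i => (s i).2) x)

theorem aff_vertices {p : ℕ} (x : Sx p) : aff (fun i : Fin p => (stdSimplex.vertex i : Sx p)) x = x := by
  ext j
  simp [aff_apply_simplex, Pi.single_apply]

/-! ### Total augmented singular chains -/

/-- Singular simplices with any number of vertices. -/
abbrev Simp (X : Type) [TopologicalSpace X] : Type := Σ m, C(Sx m, X)

/-- Total augmented rational singular chains. -/
abbrev Ch (X : Type) [TopologicalSpace X] : Type := Simp X →₀ ℚ

section Realize

variable {X Y : Type} [TopologicalSpace X] [TopologicalSpace Y]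
variable {K L : Type} [TopologicalSpace K] [TopologicalSpace L] [Cvx K] [Cvx L]

/-- The affine simplex spanned by a list of points, pushed forward along `s`. -/
def simp (s : C(K, X)) (l : List K) : Simp X := ⟨l.length, s.comp (aff l.get)⟩

theorem simp_ext {m m' : ℕ} {s : C(Sx m, X)} {s' : C(Sx m', X)} (h : m = m')
    (hs : ∀ x : Sx m, s x = s' (h ▸ x)) : (⟨m, s⟩ : Simp X) = ⟨m', s'⟩ := by
  subst h
  congr 1
  ext x; exact hs x

theorem mk_aff_eq (s : C(K, X)) {m : ℕ} (t : Fin m → K) :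
    (⟨m, s.comp (aff t)⟩ : Simp X) = simp s (List.ofFn t) := by
  have key : ∀ (m' : ℕ) (t' : Fin m' → K) (h : m = m') (_ : ∀ i, t i = t' (Fin.cast h i)),
      (⟨m, s.comp (aff t)⟩ : Simp X) = ⟨m', s.comp (aff t')⟩ := by
    rintro m' t' rfl h
    have : t = t' := funext h
    rw [this]
  exact key _ _ (List.length_ofFn).symm fun i => by simp

/-- Realization of list chains as singular chains. -/
def rz (s : C(K, X)) : LCh K →ₗ[ℚ] Ch X := lin fun l => bas (simp s l)

theorem rz_bas (s : C(K, X)) (l : List K) : rz s (bas l) = bas (simp s l) := lin_bas _ _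

theorem simp_comp (s : C(L, X)) (g : C(K, L)) (hg : IsAff g) (l : List K) :
    simp (s.comp g) l = simp s (l.map g) := by
  have : (s.comp g).comp (aff l.get) = s.comp (aff (g ∘ l.get)) := by
    ext x; simp [hg _ l.get x]
  rw [simp, this, mk_aff_eq]
  congr 1
  simp [← List.map_ofFn]

theorem rz_comp (s : C(L, X)) (g : C(K, L)) (hg : IsAff g) (x : LCh K) :
    rz (s.comp g) x = rz s (lmap g x) := by
  have : rz (s.comp g) = rz s ∘ₗ lmap g := lin_ext fun l => by
    simp only [LinearMap.comp_apply, lmap_bas, rz_bas, simp_comp s g hg]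
  exact LinearMap.congr_fun this x

/-- The list of vertices of a simplex. -/
def verts (m : ℕ) : List (Sx m) := List.ofFn fun i => stdSimplex.vertex i

theorem map_aff_verts (l : List K) : (verts l.length).map (aff l.get) = l := by
  rw [verts, List.map_ofFn]
  have : (aff l.get : Sx l.length → K) ∘ (fun i => (stdSimplex.vertex i : Sx l.length)) = l.get :=
    funext fun i => aff_vertex _ i
  rw [this, List.ofFn_get]

theorem simp_verts {m : ℕ} (s : C(Sx m, X)) : simp s (verts m) = ⟨m, s⟩ := by
  rw [verts, ← mk_aff_eq]
  congr 1
  ext x; simp [aff_vertices]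

theorem rz_verts (a : Simp X) : rz a.2 (bas (verts a.1)) = bas a := by
  rw [rz_bas, simp_verts]

theorem length_verts (m : ℕ) : (verts m).length = m := by simp [verts]

/-- A natural operation on list chains induces an operation on singular chains. -/
def op (w : ∀ m, LCh (Sx m)) : Ch X →ₗ[ℚ] Ch X := lin fun a => rz a.2 (w a.1)

theorem op_bas (w : ∀ m, LCh (Sx m)) (a : Simp X) : op w (bas a) = rz a.2 (w a.1) := lin_bas _ _

/-- Pushforward of singular chains. -/
def push (f : C(X, Y)) : Ch X →ₗ[ℚ] Ch Y := lin fun a => bas ⟨a.1, f.comp a.2⟩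

theorem push_bas (f : C(X, Y)) (a : Simp X) : push f (bas a) = bas ⟨a.1, f.comp a.2⟩ := lin_bas _ _

theorem push_rz (f : C(X, Y)) (s : C(K, X)) (x : LCh K) : push f (rz s x) = rz (f.comp s) x := by
  have : push f ∘ₗ rz s = rz (f.comp s) := lin_ext fun l => by
    simp only [LinearMap.comp_apply, rz_bas, push_bas]; rfl
  exact LinearMap.congr_fun this x

theorem push_op (w : ∀ m, LCh (Sx m)) (f : C(X, Y)) (x : Ch X) :
    push f (op w x) = op w (push f x) := by
  have : push f ∘ₗ op w = op w ∘ₗ push f := lin_ext fun a => by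
    simp only [LinearMap.comp_apply, op_bas, push_bas, push_rz]
  exact LinearMap.congr_fun this x

theorem push_id (x : Ch X) : push (ContinuousMap.id X) x = x := by
  have : push (ContinuousMap.id X) = LinearMap.id := lin_ext fun a => by
    simp only [push_bas, ContinuousMap.id_comp]; rfl
  exact LinearMap.congr_fun this x

theorem push_comp {Z : Type} [TopologicalSpace Z] (g : C(Y, Z)) (f : C(X, Y)) (x : Ch X) :
    push (g.comp f) x = push g (push f x) := by
  have : push (g.comp f) = push g ∘ₗ push f := lin_ext fun a => by
    simp only [LinearMap.comp_apply, push_bas]; rfl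
  exact LinearMap.congr_fun this x

/-- Compatibility of an induced operation with realization. -/
theorem op_rz (w : ∀ m, LCh (Sx m)) (F : LCh K →ₗ[ℚ] LCh K)
    (h : ∀ l : List K, lmap (aff l.get) (w l.length) = F (bas l)) (s : C(K, X)) (x : LCh K) :
    op w (rz s x) = rz s (F x) := by
  have : op w ∘ₗ rz s = rz s ∘ₗ F := lin_ext fun l => by
    simp only [LinearMap.comp_apply, rz_bas, op_bas, ← h]
    exact rz_comp s _ (isAff_aff _) _
  exact LinearMap.congr_fun this x

/-- Statements about singular chains can be checked on realized lists of vertices. -/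
theorem op_ext {N : Type*} [AddCommGroup N] [Module ℚ N] {F G : Ch X →ₗ[ℚ] N}
    (h : ∀ (m : ℕ) (s : C(Sx m, X)), F (rz s (bas (verts m))) = G (rz s (bas (verts m)))) :
    F = G := lin_ext fun a => by simpa only [rz_verts] using h a.1 a.2

/-- The singular boundary. -/
def dd : Ch X →ₗ[ℚ] Ch X := op fun m => bd (bas (verts m))

@[simp] theorem dd_rz (s : C(K, X)) (x : LCh K) : dd (rz s x) = rz s (bd x) :=
  op_rz _ bd (fun l => by rw [lmap_bd, lmap_bas, map_aff_verts]) s x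

@[simp] theorem dd_dd (x : Ch X) : dd (dd x) = 0 := by
  have : dd ∘ₗ dd = (0 : Ch X →ₗ[ℚ] Ch X) := op_ext fun m s => by simp
  exact LinearMap.congr_fun this x

theorem push_dd (f : C(X, Y)) (x : Ch X) : push f (dd x) = dd (push f x) := push_op _ f x

/-- The singular sign involution. -/
def sgn : Ch X →ₗ[ℚ] Ch X := op fun m => sg (bas (verts m))

@[simp] theorem sgn_rz (s : C(K, X)) (x : LCh K) : sgn (rz s x) = rz s (sg x) :=
  op_rz _ sg (fun l => by rw [lmap_sg, lmap_bas, map_aff_verts]) s x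

theorem sgn_bas (a : Simp X) : sgn (bas a) = (-1 : ℚ) ^ a.1 • bas a := by
  rw [← rz_verts a, sgn_rz, sg_bas, map_smul, length_verts]

@[simp] theorem sgn_sgn (x : Ch X) : sgn (sgn x) = x := by
  have : sgn ∘ₗ sgn = (LinearMap.id : Ch X →ₗ[ℚ] Ch X) := op_ext fun m s => by simp
  exact LinearMap.congr_fun this x

theorem sgn_dd (x : Ch X) : sgn (dd x) = - dd (sgn x) := by
  have : sgn ∘ₗ dd = -(dd ∘ₗ sgn : Ch X →ₗ[ℚ] Ch X) := op_ext fun m s => by simp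
  exact LinearMap.congr_fun this x

theorem push_sgn (f : C(X, Y)) (x : Ch X) : push f (sgn x) = sgn (push f x) := push_op _ f x

/-! ### Supports and degrees -/

/-- Chains of simplices with image in `P`. -/
def chIn (P : Set X) : Submodule ℚ (Ch X) := Finsupp.supported ℚ ℚ {a | ∀ x, a.2 x ∈ P}

/-- Chains of simplices with `m` vertices. -/
def deg (X : Type) [TopologicalSpace X] (m : ℕ) : Submodule ℚ (Ch X) :=
  Finsupp.supported ℚ ℚ {a | a.1 = m}

theorem bas_mem_chIn {P : Set X} {a : Simp X} (h : ∀ x, a.2 x ∈ P) : bas a ∈ chIn P :=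
  Finsupp.single_mem_supported _ _ h

theorem bas_mem_deg (a : Simp X) : bas a ∈ deg X a.1 := Finsupp.single_mem_supported _ _ rfl

theorem chIn_mono {P Q : Set X} (h : P ⊆ Q) : chIn P ≤ chIn Q :=
  Finsupp.supported_mono fun _ ha x => h (ha x)

theorem chIn_inf (P Q : Set X) : chIn P ⊓ chIn Q = chIn (P ∩ Q) := by
  rw [chIn, chIn, ← Finsupp.supported_inter]
  congr 1
  ext a
  exact ⟨fun h x => ⟨h.1 x, h.2 x⟩, fun h => ⟨fun x => (h x).1, fun x => (h x).2⟩⟩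

theorem mem_chIn_inter {P Q : Set X} {x : Ch X} (h : x ∈ chIn P) (h' : x ∈ chIn Q) :
    x ∈ chIn (P ∩ Q) := by rw [← chIn_inf]; exact ⟨h, h'⟩

@[simp] theorem chIn_univ : chIn (Set.univ : Set X) = ⊤ := by
  rw [eq_top_iff, ← Finsupp.supported_univ]
  exact Finsupp.supported_mono fun _ _ _ => trivial

theorem rz_mem_chIn {P : Set X} (s : C(K, X)) (h : ∀ x, s x ∈ P) (y : LCh K) : rz s y ∈ chIn P := by
  refine supported_le_comap (S := Set.univ) (fun l _ => ?_) y (by simp)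
  rw [rz_bas]; exact bas_mem_chIn fun x => h _

theorem op_mem_chIn (w : ∀ m, LCh (Sx m)) {P : Set X} {x : Ch X} (hx : x ∈ chIn P) :
    op w x ∈ chIn P :=
  supported_le_comap (fun a ha => by rw [op_bas]; exact rz_mem_chIn _ ha _) x hx

theorem dd_mem_chIn {P : Set X} {x : Ch X} (hx : x ∈ chIn P) : dd x ∈ chIn P := op_mem_chIn _ hx

theorem sgn_mem_chIn {P : Set X} {x : Ch X} (hx : x ∈ chIn P) : sgn x ∈ chIn P := op_mem_chIn _ hx

theorem push_mem_chIn {P : Set X} {Q : Set Y} (f : C(X, Y)) (h : ∀ x ∈ P, f x ∈ Q) {x : Ch X}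
    (hx : x ∈ chIn P) : push f x ∈ chIn Q :=
  supported_le_comap (fun a ha => by
    rw [push_bas]; exact bas_mem_chIn fun y => h _ (ha y)) x hx

theorem push_mem_deg {m : ℕ} (f : C(X, Y)) {x : Ch X} (hx : x ∈ deg X m) : push f x ∈ deg Y m :=
  supported_le_comap (fun a ha => by
    rw [push_bas]; rw [← show a.1 = m from ha]; exact bas_mem_deg (⟨a.1, f.comp a.2⟩ : Simp Y)) x hx

theorem rz_mem_deg {m : ℕ} (s : C(K, X)) {y : LCh K} (hy : y ∈ ldeg K m) : rz s y ∈ deg X m :=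
  supported_le_comap (fun l hl => by
    rw [rz_bas]; rw [← show l.length = m from hl]; exact bas_mem_deg (simp s l)) y hy

theorem op_mem_deg (w : ∀ m, LCh (Sx m)) {m k : ℕ} (hw : w m ∈ ldeg (Sx m) k) {x : Ch X}
    (hx : x ∈ deg X m) : op w x ∈ deg X k :=
  supported_le_comap (S := {a : Simp X | a.1 = m}) (fun a ha => by
    rw [op_bas]; obtain ⟨p, s⟩ := a; obtain rfl : p = m := ha; exact rz_mem_deg _ hw) x hx

theorem dd_mem_deg {m : ℕ} {x : Ch X} (hx : x ∈ deg X m) : dd x ∈ deg X (m - 1) :=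
  op_mem_deg _ (by simpa only [length_verts] using bdL_mem_ldeg (verts m)) hx

theorem sgn_of_mem_deg {m : ℕ} {x : Ch X} (hx : x ∈ deg X m) : sgn x = (-1 : ℚ) ^ m • x := by
  have := supported_le_comap (f := (sgn - (-1 : ℚ) ^ m • LinearMap.id : Ch X →ₗ[ℚ] Ch X)) (Q := ⊥)
    (S := {a : Simp X | a.1 = m}) (fun a ha => by
      have : a.1 = m := ha
      simp [sgn_bas, this]) x hx
  rw [Submodule.mem_bot] at this
  simpa [sub_eq_zero] using this

/-- Projection to the part of degree `m`. -/
def proj (m : ℕ) : Ch X →ₗ[ℚ] Ch X := lin fun a => if a.1 = m then bas a else 0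

theorem proj_bas (m : ℕ) (a : Simp X) : proj m (bas a) = if a.1 = m then bas a else 0 := lin_bas _ _

theorem proj_mem_deg (m : ℕ) (x : Ch X) : proj m x ∈ deg X m := by
  refine supported_le_comap (S := Set.univ) (fun a _ => ?_) x (by simp)
  rw [proj_bas]; split_ifs with h
  · rw [← h]; exact bas_mem_deg a
  · exact Submodule.zero_mem _

theorem proj_of_mem_deg {m : ℕ} {x : Ch X} (hx : x ∈ deg X m) : proj m x = x := by
  have := supported_le_comap (f := (proj m - LinearMap.id : Ch X →ₗ[ℚ] Ch X)) (Q := ⊥)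
    (S := {a : Simp X | a.1 = m}) (fun a ha => by
      have : a.1 = m := ha
      simp [proj_bas, this]) x hx
  rw [Submodule.mem_bot] at this
  simpa [sub_eq_zero] using this

theorem proj_of_mem_deg_ne {m k : ℕ} (h : k ≠ m) {x : Ch X} (hx : x ∈ deg X k) : proj m x = 0 := by
  have := supported_le_comap (f := (proj m : Ch X →ₗ[ℚ] Ch X)) (Q := ⊥)
    (S := {a : Simp X | a.1 = k}) (fun a ha => by
      have : a.1 ≠ m := fun h' => h (ha.symm.trans h')
      simp [proj_bas, this]) x hx
  simpa using this

theorem proj_mem_chIn (m : ℕ) {P : Set X} {x : Ch X} (hx : x ∈ chIn P) : proj m x ∈ chIn P :=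
  supported_le_comap (fun a ha => by
    rw [proj_bas]; split_ifs
    · exact bas_mem_chIn ha
    · exact Submodule.zero_mem _) x hx

theorem proj_dd (m : ℕ) (x : Ch X) : proj m (dd x) = dd (proj (m + 1) x) := by
  have : proj m ∘ₗ dd = (dd ∘ₗ proj (m + 1) : Ch X →ₗ[ℚ] Ch X) := lin_ext fun a => by
    simp only [LinearMap.comp_apply, proj_bas]
    have h := dd_mem_deg (bas_mem_deg a)
    split_ifs with ha
    · rw [ha] at h; exact proj_of_mem_deg h
    · rw [map_zero]
      by_cases h0 : a.1 = 0
      · have : dd (bas a) = 0 := by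
          rw [← rz_verts a, dd_rz]
          have : verts a.1 = [] := List.eq_nil_of_length_eq_zero (by rw [length_verts, h0])
          rw [this]; simp
        rw [this, map_zero]
      · exact proj_of_mem_deg_ne (by omega) h
  exact LinearMap.congr_fun this x

theorem proj_push (m : ℕ) (f : C(X, Y)) (x : Ch X) : proj m (push f x) = push f (proj m x) := by
  have : proj m ∘ₗ push f = push f ∘ₗ proj m := lin_ext fun a => by
    simp only [LinearMap.comp_apply, proj_bas, push_bas]
    split_ifs <;> simp [push_bas]
  exact LinearMap.congr_fun this x

end Realize

end SingChain

namespace SingChain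
open Cvx

/-! ### Degenerate lists and recursive operations -/

section Lists

variable {V : Type} {N : Type*} [AddCommGroup N] [Module ℚ N]

theorem bd_bas_mem (l : List V) :
    bd (bas l) ∈ Finsupp.supported ℚ ℚ {l' : List V | l'.Sublist l ∧ l'.length + 1 = l.length} := by
  induction l with
  | nil => simp
  | cons v l ih =>
    rw [bd_cons_bas]
    refine Submodule.sub_mem _ (Finsupp.single_mem_supported _ _ ⟨List.sublist_cons_self v l, rfl⟩) ?_
    refine supported_le_comap (f := cons v) (fun l' hl' => ?_) _ ih
    rw [cons_bas]
    exact Finsupp.single_mem_supported _ _ ⟨hl'.1.cons_cons v, by simp [hl'.2]⟩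

theorem bas_mem_supported {α : Type*} {S : Set α} {a : α} (h : a ∈ S) :
    bas a ∈ Finsupp.supported ℚ ℚ S := Finsupp.single_mem_supported _ _ h

theorem eq_on_supported {α : Type*} {S : Set α} {f g : (α →₀ ℚ) →ₗ[ℚ] N}
    (h : ∀ a ∈ S, f (bas a) = g (bas a)) {x : α →₀ ℚ} (hx : x ∈ Finsupp.supported ℚ ℚ S) :
    f x = g x := by
  have := supported_le_comap (f := f - g) (Q := ⊥) (S := S)
    (fun a ha => by simp [h a ha]) x hx
  simpa [sub_eq_zero] using this

/-- Induction over the boundary. -/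
theorem bd_induction {F G : LCh V →ₗ[ℚ] N} (h0 : F (bas []) = G (bas []))
    (h : ∀ v l, F (bd (bas (v :: l))) = G (bd (bas (v :: l))) → F (bas (v :: l)) = G (bas (v :: l))) :
    F = G := by
  have key : ∀ m (l : List V), l.length = m → F (bas l) = G (bas l) := by
    intro m
    induction m with
    | zero => intro l hl; rw [List.eq_nil_of_length_eq_zero hl]; exact h0
    | succ m ih =>
      intro l hl
      cases l with
      | nil => exact h0
      | cons v l =>
        refine h v l (eq_on_supported (fun l' hl' => ih l' ?_) (bd_bas_mem (v :: l)))
        have := hl'.2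
        omega
  exact lin_ext fun l => key _ l rfl

/-- Values of an operation defined by recursion over the boundary. -/
def recN (b : N) (G : List V → N → N) : ℕ → List V → N
  | 0, _ => b
  | m + 1, l => G l (lin (recN b G m) (bd (bas l)))

/-- The operation defined by recursion over the boundary. -/
def recOp (b : N) (G : List V → N → N) : LCh V →ₗ[ℚ] N := lin fun l => recN b G l.length l

theorem recOp_nil (b : N) (G : List V → N → N) : recOp b G (bas []) = b := lin_bas _ _

theorem recOp_cons (b : N) (G : List V → N → N) (v : V) (l : List V) :
    recOp b G (bas (v :: l)) = G (v :: l) (recOp b G (bd (bas (v :: l)))) := by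
  rw [recOp, lin_bas]
  change G (v :: l) _ = _
  congr 1
  refine eq_on_supported (fun l' hl' => ?_) (bd_bas_mem (v :: l))
  have : l'.length = l.length := by simpa using hl'.2
  rw [lin_bas, lin_bas, this]

/-- Lists with two equal adjacent entries. -/
inductive Dup : List V → Prop
  | here (a : V) (l : List V) : Dup (a :: a :: l)
  | there (v : V) (l : List V) : Dup l → Dup (v :: l)

theorem bd_dup {l : List V} (h : Dup l) :
    bd (bas l) ∈ Finsupp.supported ℚ ℚ {l' : List V | Dup l'} := by
  induction h with
  | here a l =>
    rw [bas_cons, bd_cons, bas_cons, bd_cons, map_sub, sub_sub_cancel]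
    refine supported_le_comap (S := Set.univ) (f := cons a ∘ₗ cons a) (fun l' _ => ?_) _ (by simp)
    simp only [LinearMap.comp_apply, cons_bas]
    exact bas_mem_supported (Dup.here a l')
  | there v l h ih =>
    rw [bas_cons, bd_cons]
    refine Submodule.sub_mem _ (bas_mem_supported h) ?_
    refine supported_le_comap (f := cons v) (fun l' hl' => ?_) _ ih
    rw [cons_bas]; exact bas_mem_supported (Dup.there v l' hl')

end Lists

/-! ### Barycentric subdivision -/

section Subdivision

variable {K L : Type} [TopologicalSpace K] [Cvx K] [TopologicalSpace L] [Cvx L]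

/-- The barycenter of a nonempty list. -/
def bary (v : K) (l : List K) : K := aff (v :: l).get stdSimplex.barycenter

theorem aff_barycenter_congr {m m' : ℕ} (h : m = m') (s : Fin (m + 1) → K) (s' : Fin (m' + 1) → K)
    (hs : ∀ i : Fin (m + 1), s i = s' (Fin.cast (by rw [h]) i)) :
    aff s stdSimplex.barycenter = aff s' stdSimplex.barycenter := by
  subst h
  have : s = s' := funext hs
  rw [this]

theorem map_bary {g : K → L} (hg : IsAff g) (v : K) (l : List K) :
    g (bary v l) = bary (g v) (l.map g) := by
  rw [bary, hg]
  refine aff_barycenter_congr (by simp) (g ∘ (v :: l).get) ((g v :: l.map g).get) fun i => ?_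
  refine Fin.cases ?_ (fun i => ?_) i
  · rfl
  · simp

/-- Adjoin the barycenter of a nonempty list as new first vertex. -/
def consBary : List K → LCh K →ₗ[ℚ] LCh K
  | [] => LinearMap.id
  | v :: l => cons (bary v l)

/-- Barycentric subdivision of list chains. -/
def sd : LCh K →ₗ[ℚ] LCh K := recOp (bas []) fun l y => consBary l y

/-- The homotopy from the identity to barycentric subdivision. -/
def st : LCh K →ₗ[ℚ] LCh K := recOp 0 fun l y => consBary l (bas l - y)

@[simp] theorem sd_nil : sd (bas ([] : List K)) = bas [] := recOp_nil _ _

@[simp] theorem st_nil : st (bas ([] : List K)) = 0 := recOp_nil _ _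

theorem sd_cons (v : K) (l : List K) :
    sd (bas (v :: l)) = cons (bary v l) (sd (bd (bas (v :: l)))) := recOp_cons _ _ v l

theorem st_cons (v : K) (l : List K) :
    st (bas (v :: l)) = cons (bary v l) (bas (v :: l) - st (bd (bas (v :: l)))) :=
  recOp_cons _ _ v l

theorem bd_sd (x : LCh K) : bd (sd x) = sd (bd x) := by
  have : bd ∘ₗ sd = (sd ∘ₗ bd : LCh K →ₗ[ℚ] LCh K) := by
    refine bd_induction (by simp) fun v l h => ?_
    simp only [LinearMap.comp_apply, bd_bd, map_zero] at h ⊢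
    rw [sd_cons, bd_cons, h]; simp
  exact LinearMap.congr_fun this x

theorem bd_st (x : LCh K) : bd (st x) = x - sd x - st (bd x) := by
  have : bd ∘ₗ st = (LinearMap.id - sd - st ∘ₗ bd : LCh K →ₗ[ℚ] LCh K) := by
    refine bd_induction (by simp) fun v l h => ?_
    simp only [LinearMap.comp_apply, bd_bd, map_zero, LinearMap.sub_apply, LinearMap.id_apply,
      sub_zero] at h ⊢
    rw [st_cons, bd_cons, map_sub, h, sub_sub_cancel, sd_cons]
    abel
  exact LinearMap.congr_fun this x

theorem lmap_sd {g : K → L} (hg : IsAff g) (x : LCh K) : lmap g (sd x) = sd (lmap g x) := by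
  have : lmap g ∘ₗ sd = sd ∘ₗ lmap g := by
    refine bd_induction (by simp) fun v l h => ?_
    simp only [LinearMap.comp_apply] at h ⊢
    rw [sd_cons, lmap_cons, h, map_bary hg, lmap_bas, List.map_cons, sd_cons, lmap_bd, lmap_bas,
      List.map_cons]
  exact LinearMap.congr_fun this x

theorem lmap_st {g : K → L} (hg : IsAff g) (x : LCh K) : lmap g (st x) = st (lmap g x) := by
  have : lmap g ∘ₗ st = st ∘ₗ lmap g := by
    refine bd_induction (by simp) fun v l h => ?_
    simp only [LinearMap.comp_apply] at h ⊢
    rw [st_cons, lmap_cons, map_sub, h, map_bary hg, lmap_bas, List.map_cons, st_cons, lmap_bd,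
      lmap_bas, List.map_cons]
  exact LinearMap.congr_fun this x

theorem sd_dup {l : List K} (h : Dup l) : sd (bas l) = 0 := by
  have key : ∀ m (l : List K), l.length = m → Dup l → sd (bas l) = 0 := by
    intro m
    induction m with
    | zero => intro l hl h; rw [List.eq_nil_of_length_eq_zero hl] at h; cases h
    | succ m ih =>
      intro l hl h
      cases l with
      | nil => cases h
      | cons v l =>
        rw [sd_cons]
        have hm : bd (bas (v :: l)) ∈ Finsupp.supported ℚ ℚ
            ({l' : List K | Dup l'} ∩ {l' | l'.Sublist (v :: l) ∧ l'.length + 1 = (v :: l).length}) := by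
          rw [Finsupp.supported_inter]; exact ⟨bd_dup h, bd_bas_mem _⟩
        have : sd (bd (bas (v :: l))) = (0 : LCh K →ₗ[ℚ] LCh K) (bd (bas (v :: l))) := by
          refine eq_on_supported (fun l' hl' => ?_) hm
          have := hl'.2.2
          simp [ih l' (by omega) hl'.1]
        rw [this]; simp
  exact key _ l rfl h

theorem sd_mem_ldeg (m : ℕ) {x : LCh K} (hx : x ∈ ldeg K m) : sd x ∈ ldeg K m := by
  induction m generalizing x with
  | zero =>
    refine supported_le_comap (fun l hl => ?_) x hx
    rw [List.eq_nil_of_length_eq_zero hl, sd_nil]; exact bas_mem_ldeg []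
  | succ m ih =>
    refine supported_le_comap (fun l hl => ?_) x hx
    cases l with
    | nil => simp at hl
    | cons v l =>
      rw [sd_cons]
      refine cons_mem_ldeg _ (ih ?_)
      have h1 : l.length = m := by simpa using hl
      have := bdL_mem_ldeg (v :: l)
      simpa [h1] using this

end Subdivision

/-! ### Mesh of the subdivision -/

section Mesh

variable {p : ℕ}

theorem dist_simplex_le {x y : Sx p} {R : ℝ} (hR : 0 ≤ R) :
    dist x y ≤ R ↔ ∀ j, |x j - y j| ≤ R := by
  rw [Subtype.dist_eq, dist_pi_le_iff hR]; rfl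

/-- A point of the affine simplex lies in every ball containing the vertices. -/
theorem dist_aff_le {m : ℕ} (s : Fin m → Sx p) (x : Sx m) (z : Sx p) {R : ℝ}
    (h : ∀ i, dist z (s i) ≤ R) : dist z (aff s x) ≤ R := by
  have hm : ∃ i : Fin m, True := by
    by_contra hc
    push Not at hc
    have h1 : ∑ i, x i = 1 := x.2.2
    have : IsEmpty (Fin m) := ⟨fun i => hc i⟩
    simp at h1
  obtain ⟨i0, -⟩ := hm
  have hR : 0 ≤ R := dist_nonneg.trans (h i0)
  rw [dist_simplex_le hR]
  intro j
  have h1 : ∑ i, x i = 1 := x.2.2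
  have : z j - aff s x j = ∑ i, x i * (z j - s i j) := by
    simp only [mul_sub, Finset.sum_sub_distrib, ← Finset.sum_mul, h1, one_mul, aff_apply_simplex]
  rw [this]
  calc |∑ i, x i * (z j - s i j)| ≤ ∑ i, |x i * (z j - s i j)| := Finset.abs_sum_le_sum_abs _ _
    _ ≤ ∑ i, x i * R := Finset.sum_le_sum fun i _ => by
        rw [abs_mul, abs_of_nonneg (show 0 ≤ x i from x.2.1 i)]
        exact mul_le_mul_of_nonneg_left ((dist_simplex_le hR).1 (h i) j) (x.2.1 i)
    _ = R := by rw [← Finset.sum_mul, h1, one_mul]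

/-- Barycenters are closer to the vertices by a definite factor. -/
theorem dist_barycenter_le {m : ℕ} (s : Fin (m + 1) → Sx p) {d : ℝ}
    (h : ∀ i i', dist (s i) (s i') ≤ d) (k : Fin (m + 1)) :
    dist (s k) (aff s stdSimplex.barycenter) ≤ m / (m + 1) * d := by
  have hd : 0 ≤ d := dist_nonneg.trans (h k k)
  rw [dist_simplex_le (by positivity)]
  intro j
  have hm : ((m : ℝ) + 1) ≠ 0 := by positivity
  have : s k j - aff s stdSimplex.barycenter j = ((m : ℝ) + 1)⁻¹ * ∑ i, (s k j - s i j) := by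
    rw [aff_apply_simplex]
    have : ∀ i, (stdSimplex.barycenter : Sx (m + 1)) i = ((m : ℝ) + 1)⁻¹ := fun i => by
      change ((Fintype.card (Fin (m + 1)) : ℕ) : ℝ)⁻¹ = _
      simp
    simp only [this, ← Finset.mul_sum, Finset.sum_sub_distrib, Finset.sum_const, Finset.card_univ,
      Fintype.card_fin, nsmul_eq_mul, mul_sub]
    push_cast
    field_simp
  rw [this, abs_mul, abs_of_nonneg (by positivity), div_mul_eq_mul_div, inv_mul_eq_div]
  refine div_le_div_of_nonneg_right ?_ (by positivity)
  rw [← Finset.add_sum_erase _ _ (Finset.mem_univ k), sub_self, zero_add]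
  calc |∑ i ∈ Finset.univ.erase k, (s k j - s i j)|
      ≤ ∑ i ∈ Finset.univ.erase k, |s k j - s i j| := Finset.abs_sum_le_sum_abs _ _
    _ ≤ ∑ i ∈ Finset.univ.erase k, d :=
        Finset.sum_le_sum fun i _ => (dist_simplex_le hd).1 (h k i) j
    _ = m * d := by simp

/-- Every ball containing `l` contains `l'`. -/
def BallHull (l l' : List (Sx p)) : Prop :=
  ∀ z R, (∀ x ∈ l, dist z x ≤ R) → ∀ y ∈ l', dist z y ≤ R

/-- All entries have distance at most `d`. -/
def Mesh (d : ℝ) (l : List (Sx p)) : Prop := ∀ x ∈ l, ∀ y ∈ l, dist x y ≤ d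

theorem dist_bary_le (v : Sx p) (l : List (Sx p)) (z : Sx p) {R : ℝ}
    (h : ∀ x ∈ v :: l, dist z x ≤ R) : dist z (bary v l) ≤ R :=
  dist_aff_le _ _ _ fun i => h _ (List.get_mem _ _)

theorem dist_vertex_bary_le (v : Sx p) (l : List (Sx p)) {d : ℝ} (h : Mesh d (v :: l))
    {x : Sx p} (hx : x ∈ v :: l) : dist x (bary v l) ≤ l.length / (l.length + 1) * d := by
  obtain ⟨i, rfl⟩ := List.get_of_mem hx
  exact dist_barycenter_le (m := l.length) (v :: l).get (fun i i' =>
    h _ (List.get_mem _ _) _ (List.get_mem _ _)) i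

theorem sd_mesh (n m : ℕ) (hm : m ≤ n + 1) {d : ℝ} (l : List (Sx p)) (hl : l.length = m)
    (h : Mesh d l) : sd (bas l) ∈ Finsupp.supported ℚ ℚ
      {l' : List (Sx p) | l'.length = m ∧ BallHull l l' ∧ Mesh (n / (n + 1) * d) l'} := by
  induction m generalizing l with
  | zero =>
    rw [List.eq_nil_of_length_eq_zero hl, sd_nil]
    exact bas_mem_supported ⟨rfl, fun _ _ _ => by simp, fun x hx => by simp at hx⟩
  | succ m ih =>
    cases l with
    | nil => simp at hl
    | cons v l =>
      have hl' : l.length = m := by simpa using hl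
      have hd : 0 ≤ d := dist_nonneg.trans (h v (by simp) v (by simp))
      rw [sd_cons]
      have h1 : sd (bd (bas (v :: l))) ∈ Finsupp.supported ℚ ℚ
          {l' : List (Sx p) | l'.length = m ∧ BallHull (v :: l) l' ∧ Mesh (n / (n + 1) * d) l'} := by
        refine supported_le_comap (fun l' hl' => ?_) _ (bd_bas_mem (v :: l))
        obtain ⟨hs, hlen⟩ := hl'
        refine Finsupp.supported_mono ?_ (ih (by omega) l' (by omega)
          fun x hx y hy => h x (hs.subset hx) y (hs.subset hy))
        rintro l'' ⟨ha, hb, hc⟩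
        exact ⟨ha, fun z R hR => hb z R fun x hx => hR x (hs.subset hx), hc⟩
      refine supported_le_comap (f := cons (bary v l)) (fun l' hl' => ?_) _ h1
      obtain ⟨ha, hb, hc⟩ := hl'
      rw [cons_bas]
      have hbv : ∀ x ∈ v :: l, dist (bary v l) x ≤ n / (n + 1) * d := fun x hx => by
        rw [dist_comm]
        refine (dist_vertex_bary_le v l h hx).trans (mul_le_mul_of_nonneg_right ?_ hd)
        rw [hl', div_le_div_iff₀ (by positivity) (by positivity)]
        have : (m : ℝ) ≤ n := by exact_mod_cast (by omega : m ≤ n)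
        nlinarith
      refine bas_mem_supported ⟨by simp [ha], ?_, ?_⟩
      · intro z R hR y hy
        rcases List.mem_cons.1 hy with rfl | hy
        · exact dist_bary_le v l z hR
        · exact hb z R hR y hy
      · intro x hx y hy
        rcases List.mem_cons.1 hx with rfl | hx <;> rcases List.mem_cons.1 hy with rfl | hy
        · simp only [dist_self]; positivity
        · exact hb _ _ hbv y hy
        · rw [dist_comm]; exact hb _ _ hbv x hx
        · exact hc x hx y hy

theorem sd_iterate_mesh (m : ℕ) {d : ℝ} (l : List (Sx p)) (hl : l.length = m)
    (h : Mesh d l) (k : ℕ) : (sd ^ k) (bas l) ∈ Finsupp.supported ℚ ℚ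
      {l' : List (Sx p) | l'.length = m ∧ Mesh (((m : ℝ) / (m + 1)) ^ k * d) l'} := by
  induction k with
  | zero => exact bas_mem_supported ⟨hl, by simpa using h⟩
  | succ k ih =>
    rw [pow_succ' sd, Module.End.mul_apply]
    refine supported_le_comap (fun l' hl' => ?_) _ ih
    refine Finsupp.supported_mono ?_ (sd_mesh m m (by omega) l' hl'.1 hl'.2)
    rintro l'' ⟨ha, -, hc⟩
    refine ⟨ha, ?_⟩
    rwa [pow_succ', mul_assoc]

end Mesh

/-! ### Small simplices -/

section Small

variable {X Y : Type} [TopologicalSpace X] [TopologicalSpace Y]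
variable {K : Type} [TopologicalSpace K] [Cvx K]

/-- Barycentric subdivision of singular chains. -/
def sub : Ch X →ₗ[ℚ] Ch X := op fun m => sd (bas (verts m))

/-- The homotopy from the identity to barycentric subdivision. -/
def subT : Ch X →ₗ[ℚ] Ch X := op fun m => st (bas (verts m))

@[simp] theorem sub_rz (s : C(K, X)) (x : LCh K) : sub (rz s x) = rz s (sd x) :=
  op_rz _ sd (fun l => by rw [lmap_sd (isAff_aff _), lmap_bas, map_aff_verts]) s x

@[simp] theorem subT_rz (s : C(K, X)) (x : LCh K) : subT (rz s x) = rz s (st x) :=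
  op_rz _ st (fun l => by rw [lmap_st (isAff_aff _), lmap_bas, map_aff_verts]) s x

theorem dd_sub (x : Ch X) : dd (sub x) = sub (dd x) := by
  have : dd ∘ₗ sub = (sub ∘ₗ dd : Ch X →ₗ[ℚ] Ch X) := op_ext fun m s => by simp [bd_sd]
  exact LinearMap.congr_fun this x

theorem dd_subT (x : Ch X) : dd (subT x) = x - sub x - subT (dd x) := by
  have : dd ∘ₗ subT = (LinearMap.id - sub - subT ∘ₗ dd : Ch X →ₗ[ℚ] Ch X) :=
    op_ext fun m s => by simp [bd_st]
  exact LinearMap.congr_fun this x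

theorem sub_mem_chIn {P : Set X} {x : Ch X} (hx : x ∈ chIn P) : sub x ∈ chIn P := op_mem_chIn _ hx

theorem subT_mem_chIn {P : Set X} {x : Ch X} (hx : x ∈ chIn P) : subT x ∈ chIn P :=
  op_mem_chIn _ hx

theorem verts_mem_ldeg (m : ℕ) : bas (verts m) ∈ ldeg (Sx m) m := by
  simpa only [length_verts] using bas_mem_ldeg (verts m)

theorem sub_mem_deg {m : ℕ} {x : Ch X} (hx : x ∈ deg X m) : sub x ∈ deg X m :=
  op_mem_deg _ (sd_mem_ldeg m (verts_mem_ldeg m)) hx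

/-- Sufficiently often subdivided simplices are small. -/
theorem exists_sub_mem_bas {P Q : Set X} (hP : IsOpen P) (hQ : IsOpen Q) (a : Simp X)
    (ha : ∀ x, a.2 x ∈ P ∪ Q) : ∃ k, (sub ^ k) (bas a) ∈ chIn P ⊔ chIn Q := by
  obtain ⟨p, s⟩ := a
  have : CompactSpace (Sx p) := isCompact_iff_compactSpace.1 (isCompact_stdSimplex ℝ (Fin p))
  obtain ⟨δ, hδ, hL⟩ := lebesgue_number_lemma_of_metric (s := (Set.univ : Set (Sx p)))
    (c := fun b : Bool => if b then s ⁻¹' P else s ⁻¹' Q) isCompact_univ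
    (fun b => by cases b <;> simp [hP.preimage s.continuous, hQ.preimage s.continuous])
    (fun x _ => by
      rcases ha x with h | h
      · exact Set.mem_iUnion.2 ⟨true, by simpa using h⟩
      · exact Set.mem_iUnion.2 ⟨false, by simpa using h⟩)
  have hmesh : Mesh 1 (verts p) := fun x _ y _ => by
    rw [dist_simplex_le zero_le_one]
    intro j
    have h1 := stdSimplex.le_one x j
    have h2 := stdSimplex.le_one y j
    have h3 : 0 ≤ x j := x.2.1 j
    have h4 : 0 ≤ y j := y.2.1 j
    rw [abs_le]; constructor <;> linarith
  obtain ⟨k, hk⟩ := exists_pow_lt_of_lt_one hδ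
    (show (p : ℝ) / (p + 1) < 1 by rw [div_lt_one (by positivity)]; linarith)
  refine ⟨k, ?_⟩
  have hrz : ∀ (k : ℕ) (x : LCh (Sx p)), (sub ^ k) (rz s x) = rz s ((sd ^ k) x) := by
    intro k
    induction k with
    | zero => intro x; rfl
    | succ k ih => intro x; simp only [pow_succ', Module.End.mul_apply, ih, sub_rz]
  rw [← rz_verts ⟨p, s⟩, hrz]
  refine supported_le_comap (fun l hl => ?_) _ (sd_iterate_mesh p (verts p) (length_verts p) hmesh k)
  rw [rz_bas]
  obtain ⟨-, hl⟩ := hl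
  cases l with
  | nil => exact Submodule.mem_sup_left (bas_mem_chIn fun x => (by
      have h1 : ∑ i, x i = 1 := x.2.2
      have : IsEmpty (Fin (simp s ([] : List (Sx p))).1) := Fin.isEmpty
      rw [Finset.univ_eq_empty] at h1
      simp at h1))
  | cons v l =>
    obtain ⟨b, hb⟩ := hL v trivial
    have hx : ∀ x, aff (v :: l).get x ∈ Metric.ball v δ := fun x => by
      rw [Metric.mem_ball, dist_comm]
      refine (dist_aff_le _ x v fun i => hl v (by simp) _ (List.get_mem _ _)).trans_lt ?_
      simpa using hk
    cases b with
    | true => exact Submodule.mem_sup_left (bas_mem_chIn fun x => hb (hx x))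
    | false => exact Submodule.mem_sup_right (bas_mem_chIn fun x => hb (hx x))

theorem sub_mem_sup {P Q : Set X} {x : Ch X} (hx : x ∈ chIn P ⊔ chIn Q) :
    sub x ∈ chIn P ⊔ chIn Q := by
  obtain ⟨y, hy, z, hz, rfl⟩ := Submodule.mem_sup.1 hx
  rw [map_add]
  exact Submodule.add_mem_sup (sub_mem_chIn hy) (sub_mem_chIn hz)

theorem sub_pow_mem {S : Submodule ℚ (Ch X)} (hS : ∀ x ∈ S, sub x ∈ S) (k : ℕ) {x : Ch X}
    (hx : x ∈ S) : (sub ^ k) x ∈ S := by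
  induction k with
  | zero => exact hx
  | succ k ih => rw [pow_succ', Module.End.mul_apply]; exact hS _ ih

theorem exists_sub_mem {P Q : Set X} (hP : IsOpen P) (hQ : IsOpen Q) {x : Ch X}
    (hx : x ∈ chIn (P ∪ Q)) : ∃ k, (sub ^ k) x ∈ chIn P ⊔ chIn Q := by
  rw [chIn, Finsupp.supported_eq_span_single] at hx
  induction hx using Submodule.span_induction with
  | mem x h => obtain ⟨a, ha, rfl⟩ := h; exact exists_sub_mem_bas hP hQ a ha
  | zero => exact ⟨0, by simp⟩
  | add x y _ _ hx hy =>
    obtain ⟨k, hk⟩ := hx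
    obtain ⟨k', hk'⟩ := hy
    refine ⟨k + k', ?_⟩
    rw [map_add]
    refine Submodule.add_mem _ ?_ ?_
    · rw [add_comm, pow_add, Module.End.mul_apply]; exact sub_pow_mem (fun _ => sub_mem_sup) _ hk
    · rw [pow_add, Module.End.mul_apply]; exact sub_pow_mem (fun _ => sub_mem_sup) _ hk'
  | smul c x _ hx =>
    obtain ⟨k, hk⟩ := hx
    exact ⟨k, by rw [map_smul]; exact Submodule.smul_mem _ _ hk⟩

/-- The homotopy from the identity to an iterated subdivision. -/
def subTk (k : ℕ) : Ch X →ₗ[ℚ] Ch X := ∑ i ∈ Finset.range k, subT ∘ₗ sub ^ i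

theorem dd_sub_pow (k : ℕ) (x : Ch X) : dd ((sub ^ k) x) = (sub ^ k) (dd x) := by
  induction k with
  | zero => rfl
  | succ k ih => simp only [pow_succ', Module.End.mul_apply, dd_sub, ih]

theorem dd_subTk (k : ℕ) (x : Ch X) : dd (subTk k x) = x - (sub ^ k) x - subTk k (dd x) := by
  induction k with
  | zero => simp [subTk]
  | succ k ih =>
    rw [show (subTk (k + 1) : Ch X →ₗ[ℚ] Ch X) = subTk k + subT ∘ₗ sub ^ k from
      Finset.sum_range_succ _ k, LinearMap.add_apply, map_add, ih]
    simp only [LinearMap.add_apply, LinearMap.comp_apply, dd_subT, dd_sub_pow, pow_succ', Module.End.mul_apply]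
    abel

theorem subTk_mem_chIn (k : ℕ) {P : Set X} {x : Ch X} (hx : x ∈ chIn P) : subTk k x ∈ chIn P := by
  rw [subTk, LinearMap.sum_apply]
  exact Submodule.sum_mem _ fun i _ => subT_mem_chIn (sub_pow_mem (fun _ => sub_mem_chIn) i hx)

theorem sub_pow_mem_chIn (k : ℕ) {P : Set X} {x : Ch X} (hx : x ∈ chIn P) : (sub ^ k) x ∈ chIn P :=
  sub_pow_mem (fun _ => sub_mem_chIn) k hx

theorem sub_pow_mem_deg (k m : ℕ) {x : Ch X} (hx : x ∈ deg X m) : (sub ^ k) x ∈ deg X m :=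
  sub_pow_mem (fun _ => sub_mem_deg) k hx

end Small

end SingChain

namespace SingChain
open Cvx

/-! ### Cross products and cap products of list chains -/

section Lists

variable {V W V' W' : Type}

/-- The coefficient of the empty list. -/
def nilc : LCh V →ₗ[ℚ] ℚ := lin fun l => if l.length = 0 then 1 else 0

@[simp] theorem nilc_nil : nilc (bas ([] : List V)) = 1 := by simp [nilc, lin_bas]

@[simp] theorem nilc_cons (v : V) (x : LCh V) : nilc (cons v x) = 0 := by
  have : nilc ∘ₗ cons v = 0 := lin_ext fun l => by
    rw [LinearMap.comp_apply, cons_bas, nilc, lin_bas]; simp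
  exact LinearMap.congr_fun this x

@[simp] theorem nilc_bas_cons (v : V) (l : List V) : nilc (bas (v :: l)) = 0 := by
  rw [bas_cons, nilc_cons]

theorem nilc_bd_bas_cons (v : V) (l : List V) : nilc (bd (bas (v :: l))) = nilc (bas l) := by
  rw [bas_cons, bd_cons, map_sub, nilc_cons, sub_zero]

theorem sg_point (v : V) : sg (bas [v]) = - bas [v] := by simp [sg_bas]

/-- The cross product of two lists (shuffle sum with the full prism decomposition). -/
def crossL : List V → List W → LCh (V × W)
  | [], _ => 0
  | _ :: _, [] => 0
  | a :: as, b :: bs => cons (a, b) (crossL as (b :: bs) + (-1 : ℚ) ^ as.length • crossL (a :: as) bs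
      + (nilc (bas as) * nilc (bas bs)) • bas [])
termination_by l l' => l.length + l'.length

/-- The cross product of list chains. -/
def cr : LCh V →ₗ[ℚ] LCh W →ₗ[ℚ] LCh (V × W) := lin fun l => lin fun l' => crossL l l'

theorem cr_bas (l : List V) (l' : List W) : cr (bas l) (bas l') = crossL l l' := by
  rw [cr, lin_bas, lin_bas]

theorem lin_ext₂ {α β : Type*} {N : Type*} [AddCommGroup N] [Module ℚ N]
    {f g : (α →₀ ℚ) →ₗ[ℚ] (β →₀ ℚ) →ₗ[ℚ] N}
    (h : ∀ a b, f (bas a) (bas b) = g (bas a) (bas b)) : f = g :=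
  lin_ext fun a => lin_ext fun b => h a b

@[simp] theorem cr_nil_left (y : LCh W) : cr (bas ([] : List V)) y = 0 := by
  have : cr (bas ([] : List V)) = (0 : LCh W →ₗ[ℚ] LCh (V × W)) := lin_ext fun l => by
    rw [cr_bas, crossL]; rfl
  rw [this]; rfl

@[simp] theorem cr_nil_right (x : LCh V) : cr x (bas ([] : List W)) = 0 := by
  have : cr.flip (bas ([] : List W)) = (0 : LCh V →ₗ[ℚ] LCh (V × W)) := lin_ext fun l => by
    rw [LinearMap.flip_apply, cr_bas]
    cases l <;> simp [crossL]
  exact LinearMap.congr_fun this x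

theorem cr_cons_cons (a : V) (b : W) (x : LCh V) (y : LCh W) :
    cr (cons a x) (cons b y) = cons (a, b)
      (cr x (cons b y) + cr (cons a (sg x)) y + (nilc x * nilc y) • bas []) := by
  have : (cr.compl₁₂ (cons a) (cons b) : LCh V →ₗ[ℚ] LCh W →ₗ[ℚ] LCh (V × W)) =
      (cr.compl₁₂ LinearMap.id (cons b) + cr.compl₁₂ (cons a ∘ₗ sg) LinearMap.id +
        ((LinearMap.mul ℚ ℚ).compl₁₂ nilc nilc).compr₂
          (LinearMap.toSpanSingleton ℚ _ (bas []))).compr₂ (cons (a, b)) := by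
    refine lin_ext₂ fun l l' => ?_
    simp only [LinearMap.compl₁₂_apply, LinearMap.compr₂_apply, LinearMap.add_apply, cons_bas,
      LinearMap.comp_apply, LinearMap.id_apply, sg_bas, map_smul, LinearMap.smul_apply, cr_bas,
      LinearMap.toSpanSingleton_apply, LinearMap.mul_apply']
    rw [crossL]
  have h := LinearMap.congr_fun (LinearMap.congr_fun this x) y
  simpa only [LinearMap.compl₁₂_apply, LinearMap.compr₂_apply, LinearMap.add_apply,
      LinearMap.comp_apply, LinearMap.id_apply,
      LinearMap.toSpanSingleton_apply, LinearMap.mul_apply'] using h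

/-- Induction for statements on pairs of lists. -/
theorem cr_induction {N : Type*} [AddCommGroup N] [Module ℚ N]
    {F G : LCh V →ₗ[ℚ] LCh W →ₗ[ℚ] N}
    (h1 : ∀ l', F (bas []) (bas l') = G (bas []) (bas l'))
    (h2 : ∀ l, F (bas l) (bas []) = G (bas l) (bas []))
    (h3 : ∀ a as b bs, F (bas as) (cons b (bas bs)) = G (bas as) (cons b (bas bs)) →
      F (cons a (bas as)) (bas bs) = G (cons a (bas as)) (bas bs) →
      F (cons a (bas as)) (cons b (bas bs)) = G (cons a (bas as)) (cons b (bas bs))) : F = G := by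
  refine lin_ext₂ fun l => ?_
  induction l with
  | nil => exact h1
  | cons a as ih =>
    intro l'
    induction l' with
    | nil => exact h2 _
    | cons b bs ih' =>
      have := h3 a as b bs (by simpa using ih (b :: bs)) (by simpa using ih')
      simpa using this

theorem bd_cr (x : LCh V) (y : LCh W) :
    bd (cr x y) = cr (bd x) y - cr (sg x) (bd y) + (nilc (bd x) * nilc (bd y)) • bas [] := by
  have : (cr.compr₂ bd : LCh V →ₗ[ℚ] LCh W →ₗ[ℚ] LCh (V × W)) =
      cr.compl₁₂ bd LinearMap.id - cr.compl₁₂ sg bd +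
        ((LinearMap.mul ℚ ℚ).compl₁₂ (nilc ∘ₗ bd) (nilc ∘ₗ bd)).compr₂
          (LinearMap.toSpanSingleton ℚ _ (bas [])) := by
    refine cr_induction (fun l' => by simp) (fun l => by simp) fun a as b bs h1 h2 => ?_
    simp only [LinearMap.compl₁₂_apply, LinearMap.compr₂_apply, LinearMap.add_apply,
      LinearMap.sub_apply, LinearMap.comp_apply, LinearMap.id_apply, bd_cons, sg_cons,
      LinearMap.toSpanSingleton_apply, LinearMap.mul_apply', map_sub, nilc_cons, sub_zero,
      map_neg, LinearMap.neg_apply] at h1 h2 ⊢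
    rw [cr_cons_cons, bd_cons, map_add bd, map_add bd, h1, map_smul bd, bd_nil, smul_zero, add_zero]
    have h3 : bd (cr (cons a (sg (bas as))) (bas bs)) = cr (sg (bas as)) (bas bs)
        - cr (cons a (bd (sg (bas as)))) (bas bs) + cr (cons a (bas as)) (bd (bas bs)) +
        (nilc (sg (bas as)) * nilc (bd (bas bs))) • bas [] := by
      rw [sg_bas, map_smul, map_smul, LinearMap.smul_apply, map_smul, h2]
      simp only [map_smul, LinearMap.smul_apply, sg_bas, smul_sub, smul_add, smul_eq_mul,
        smul_neg, smul_smul, ← mul_pow, mul_assoc]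
      simp
    rw [h3, cr_cons_cons, cr_cons_cons]
    simp only [map_add, map_sub, map_smul, cons_bas, sg_bd, map_neg, LinearMap.neg_apply, sg_sg]
    rw [show nilc (sg (bas as)) = nilc (bas as) by
      cases as with
      | nil => simp
      | cons v l => rw [bas_cons, sg_cons, map_neg, nilc_cons, nilc_cons, neg_zero]]
    abel
  have h := LinearMap.congr_fun (LinearMap.congr_fun this x) y
  simpa only [LinearMap.compl₁₂_apply, LinearMap.compr₂_apply, LinearMap.add_apply,
      LinearMap.sub_apply, LinearMap.comp_apply, LinearMap.id_apply,
      LinearMap.toSpanSingleton_apply, LinearMap.mul_apply'] using h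

@[simp] theorem nilc_lmap (f : V → W) (x : LCh V) : nilc (lmap f x) = nilc x := by
  have : nilc ∘ₗ lmap f = nilc := lin_ext fun l => by
    rw [LinearMap.comp_apply, lmap_bas, nilc, nilc, lin_bas, lin_bas]; simp
  exact LinearMap.congr_fun this x

theorem lmap_cr (f : V → V') (g : W → W') (x : LCh V) (y : LCh W) :
    lmap (Prod.map f g) (cr x y) = cr (lmap f x) (lmap g y) := by
  have : cr.compr₂ (lmap (Prod.map f g)) = cr.compl₁₂ (lmap f) (lmap g) := by
    refine cr_induction (fun l' => by simp) (fun l => by simp) fun a as b bs h1 h2 => ?_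
    simp only [LinearMap.compl₁₂_apply, LinearMap.compr₂_apply, lmap_cons] at h1 h2 ⊢
    have h3 : lmap (Prod.map f g) (cr (cons a (sg (bas as))) (bas bs)) =
        cr (cons (f a) (sg (lmap f (bas as)))) (lmap g (bas bs)) := by
      rw [← lmap_sg, sg_bas]
      simp only [map_smul, LinearMap.smul_apply, h2]
    rw [cr_cons_cons, lmap_cons, cr_cons_cons]
    simp only [map_add, h1, h3, map_smul, nilc_lmap]
    simp
  exact LinearMap.congr_fun (LinearMap.congr_fun this x) y

theorem crossL_mem_ldeg (l : List V) (l' : List W) :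
    crossL l l' ∈ ldeg (V × W) (l.length + l'.length - 1) := by
  induction l generalizing l' with
  | nil => rw [crossL]; exact Submodule.zero_mem _
  | cons a as ih =>
    induction l' with
    | nil => rw [crossL]; exact Submodule.zero_mem _
    | cons b bs ih' =>
      rw [crossL]
      have h1 := ih (b :: bs)
      simp only [List.length_cons] at h1 ih' ⊢
      rw [show as.length + 1 + (bs.length + 1) - 1 = (as.length + bs.length) + 1 by omega]
      refine cons_mem_ldeg _ (Submodule.add_mem _ (Submodule.add_mem _ ?_ (Submodule.smul_mem _ _ ?_)) ?_)
      · simpa [← add_assoc] using h1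
      · rwa [show as.length + bs.length = as.length + 1 + bs.length - 1 by omega]
      · by_cases h : as.length = 0 ∧ bs.length = 0
        · rw [h.1, h.2]; exact Submodule.smul_mem _ _ (bas_mem_ldeg [])
        · have : nilc (bas as) * nilc (bas bs) = 0 := by
            rw [nilc, nilc, lin_bas, lin_bas]
            by_cases h0 : as.length = 0
            · have : bs.length ≠ 0 := fun h1 => h ⟨h0, h1⟩
              simp [this]
            · simp [h0]
          rw [this, zero_smul]; exact Submodule.zero_mem _

theorem cr_point (x : LCh V) (b : W) :
    cr x (bas [b]) = lmap (fun a => (a, b)) x - nilc x • bas [] := by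
  have : cr.flip (bas [b]) = lmap (fun a => (a, b)) -
      (LinearMap.toSpanSingleton ℚ _ (bas ([] : List (V × W)))) ∘ₗ nilc := lin_ext fun l => by
    induction l with
    | nil => simp
    | cons a as ih =>
      simp only [LinearMap.flip_apply, LinearMap.sub_apply, LinearMap.comp_apply,
        LinearMap.toSpanSingleton_apply] at ih ⊢
      rw [bas_cons, bas_cons b, cr_cons_cons, ← bas_cons b, ih]
      simp
  have := LinearMap.congr_fun this x
  simpa using this

theorem point_cr (a : V) (y : LCh W) :
    cr (bas [a]) y = lmap (fun b => (a, b)) y - nilc y • bas [] := by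
  have : cr (bas [a]) = lmap (fun b => (a, b)) -
      (LinearMap.toSpanSingleton ℚ _ (bas ([] : List (V × W)))) ∘ₗ nilc := lin_ext fun l => by
    induction l with
    | nil => simp
    | cons b bs ih =>
      simp only [LinearMap.sub_apply, LinearMap.comp_apply,
        LinearMap.toSpanSingleton_apply] at ih ⊢
      rw [bas_cons, bas_cons b, cr_cons_cons, sg_nil, ← bas_cons a, ih]
      simp
  have := LinearMap.congr_fun this y
  simpa using this

/-- A chain of lists with equal adjacent entries stays such after adjoining a vertex. -/
theorem cons_mem_dup (v : V) {x : LCh V} (hx : x ∈ Finsupp.supported ℚ ℚ {l : List V | Dup l}) :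
    cons v x ∈ Finsupp.supported ℚ ℚ {l : List V | Dup l} :=
  supported_le_comap (f := cons v) (fun l hl => by
    rw [cons_bas]; exact bas_mem_supported (Dup.there v l hl)) x hx

theorem cons_cons_mem_dup (v : V) (x : LCh V) :
    cons v (cons v x) ∈ Finsupp.supported ℚ ℚ {l : List V | Dup l} :=
  supported_le_comap (S := Set.univ) (f := cons v ∘ₗ cons v) (fun l _ => by
    rw [LinearMap.comp_apply, cons_bas, cons_bas]
    exact bas_mem_supported (Dup.here v l)) x (by simp)

theorem fst_crossL_mem_dup (l : List V) (b b' : W) (bs : List W) :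
    lmap Prod.fst (crossL l (b :: b' :: bs)) ∈ Finsupp.supported ℚ ℚ {l : List V | Dup l} := by
  induction l with
  | nil => rw [crossL, map_zero]; exact Submodule.zero_mem _
  | cons a as ih =>
    rw [crossL, bas_cons b', nilc_cons, mul_zero, zero_smul, add_zero, lmap_cons, map_add, map_add]
    refine Submodule.add_mem _ (cons_mem_dup _ ih) ?_
    rw [map_smul, map_smul]
    refine Submodule.smul_mem _ _ ?_
    rw [crossL, lmap_cons]
    exact cons_cons_mem_dup _ _

theorem snd_crossL_mem_dup (a a' : V) (as : List V) (l : List W) :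
    lmap Prod.snd (crossL (a :: a' :: as) l) ∈ Finsupp.supported ℚ ℚ {l : List W | Dup l} := by
  induction l with
  | nil => rw [crossL, map_zero]; exact Submodule.zero_mem _
  | cons b bs ih =>
    rw [crossL, bas_cons a', nilc_cons, zero_mul, zero_smul, add_zero, lmap_cons, map_add, map_add]
    refine Submodule.add_mem _ ?_ ?_
    · rw [crossL, lmap_cons]
      exact cons_cons_mem_dup _ _
    · rw [map_smul, map_smul]
      exact Submodule.smul_mem _ _ (cons_mem_dup _ ih)

theorem lmap_lmap {U : Type} (f : V → W) (g : W → U) (x : LCh V) :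
    lmap g (lmap f x) = lmap (g ∘ f) x := by
  have : lmap g ∘ₗ lmap f = lmap (g ∘ f) := lin_ext fun l => by simp
  exact LinearMap.congr_fun this x

theorem apply_eq_zero_of_dup {φ : LCh V →ₗ[ℚ] ℚ} (h : ∀ l, Dup l → φ (bas l) = 0) {x : LCh V}
    (hx : x ∈ Finsupp.supported ℚ ℚ {l : List V | Dup l}) : φ x = 0 :=
  eq_on_supported (g := 0) (fun l hl => h l hl) hx

theorem apply_fst_cr {φ : LCh V →ₗ[ℚ] ℚ} (h : ∀ l, Dup l → φ (bas l) = 0) (h0 : φ (bas []) = 0)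
    (x : LCh V) (y : LCh W) : φ (lmap Prod.fst (cr x y)) = φ x * nilc (bd y) := by
  have : cr.compr₂ (φ ∘ₗ lmap (Prod.fst : V × W → V)) =
      (LinearMap.mul ℚ ℚ).compl₁₂ φ (nilc ∘ₗ bd) := by
    refine lin_ext₂ fun l l' => ?_
    simp only [LinearMap.compr₂_apply, LinearMap.comp_apply, LinearMap.compl₁₂_apply,
      LinearMap.mul_apply']
    rcases l' with _ | ⟨b, _ | ⟨b', bs⟩⟩
    · simp
    · rw [cr_point, map_sub, lmap_lmap, nilc_bd_bas_cons]
      simp [Function.comp_def, h0]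
    · rw [cr_bas, apply_eq_zero_of_dup h (fst_crossL_mem_dup l b b' bs), nilc_bd_bas_cons]
      simp
  exact LinearMap.congr_fun (LinearMap.congr_fun this x) y

theorem apply_snd_cr {φ : LCh W →ₗ[ℚ] ℚ} (h : ∀ l, Dup l → φ (bas l) = 0) (h0 : φ (bas []) = 0)
    (x : LCh V) (y : LCh W) : φ (lmap Prod.snd (cr x y)) = nilc (bd x) * φ y := by
  have : cr.compr₂ (φ ∘ₗ lmap (Prod.snd : V × W → W)) =
      (LinearMap.mul ℚ ℚ).compl₁₂ (nilc ∘ₗ bd) φ := by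
    refine lin_ext₂ fun l l' => ?_
    simp only [LinearMap.compr₂_apply, LinearMap.comp_apply, LinearMap.compl₁₂_apply,
      LinearMap.mul_apply']
    rcases l with _ | ⟨b, _ | ⟨b', bs⟩⟩
    · simp
    · rw [point_cr, map_sub, lmap_lmap, nilc_bd_bas_cons]
      simp [Function.comp_def, h0]
    · rw [cr_bas, apply_eq_zero_of_dup h (snd_crossL_mem_dup b b' bs l'), nilc_bd_bas_cons]
      simp
  exact LinearMap.congr_fun (LinearMap.congr_fun this x) y

/-- Cap product of a list with a functional evaluated on back faces. -/
def capL (φ : LCh V →ₗ[ℚ] ℚ) : List V → LCh V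
  | [] => 0
  | v :: l => cons v (capL φ l) + φ (bas (v :: l)) • bas [v]

/-- Cap product of list chains with a functional evaluated on back faces. -/
def cap (φ : LCh V →ₗ[ℚ] ℚ) : LCh V →ₗ[ℚ] LCh V := lin (capL φ)

@[simp] theorem cap_nil (φ : LCh V →ₗ[ℚ] ℚ) : cap φ (bas []) = 0 := by rw [cap, lin_bas]; rfl

theorem cap_cons (φ : LCh V →ₗ[ℚ] ℚ) (v : V) (x : LCh V) :
    cap φ (cons v x) = cons v (cap φ x) + φ (cons v x) • bas [v] := by
  have : cap φ ∘ₗ cons v = cons v ∘ₗ cap φ +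
      LinearMap.toSpanSingleton ℚ _ (bas [v]) ∘ₗ φ ∘ₗ cons v := lin_ext fun l => by
    simp only [LinearMap.comp_apply, LinearMap.add_apply, cons_bas,
      LinearMap.toSpanSingleton_apply]
    rw [cap, lin_bas, lin_bas]; rfl
  exact LinearMap.congr_fun this x

theorem bd_point (v : V) : bd (bas [v]) = bas [] := by simp [bd_cons_bas]

theorem bd_cap {φ : LCh V →ₗ[ℚ] ℚ} (h0 : φ (bas []) = 0) (x : LCh V) :
    bd (cap φ x) = cap φ (bd x) + φ x • bas [] + sg (cap (φ ∘ₗ bd) x) := by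
  have : bd ∘ₗ cap φ = cap φ ∘ₗ bd + LinearMap.toSpanSingleton ℚ _ (bas []) ∘ₗ φ +
      sg ∘ₗ cap (φ ∘ₗ bd) := lin_ext fun l => by
    induction l with
    | nil => simp [h0]
    | cons v l ih =>
      simp only [LinearMap.comp_apply, LinearMap.add_apply,
        LinearMap.toSpanSingleton_apply] at ih ⊢
      rw [bas_cons, cap_cons, map_add, map_smul, bd_cons, bd_point, ih, bd_cons, map_sub, cap_cons,
        cap_cons, map_add sg, sg_cons, map_smul sg, sg_point]
      simp only [LinearMap.comp_apply, bd_cons, bd_cons_bas, map_sub, map_add, map_smul, cons_bas, sub_smul,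
        smul_neg, neg_smul, one_smul]
      abel
  exact LinearMap.congr_fun this x

theorem lmap_cap (f : V → W) (φ : LCh W →ₗ[ℚ] ℚ) (x : LCh V) :
    lmap f (cap (φ ∘ₗ lmap f) x) = cap φ (lmap f x) := by
  have : lmap f ∘ₗ cap (φ ∘ₗ lmap f) = cap φ ∘ₗ lmap f := lin_ext fun l => by
    induction l with
    | nil => simp
    | cons v l ih =>
      simp only [LinearMap.comp_apply] at ih ⊢
      rw [bas_cons, cap_cons, map_add, lmap_cons, ih, lmap_cons, cap_cons]
      simp
  exact LinearMap.congr_fun this x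

theorem nilc_cap (φ : LCh V →ₗ[ℚ] ℚ) (x : LCh V) : nilc (cap φ x) = 0 := by
  have : nilc ∘ₗ cap φ = 0 := lin_ext fun l => by
    cases l with
    | nil => simp
    | cons v l =>
      rw [bas_cons, LinearMap.comp_apply, cap_cons, map_add, nilc_cons, map_smul, bas_cons, nilc_cons]
      simp
  exact LinearMap.congr_fun this x

theorem sg_cap {φ : LCh V →ₗ[ℚ] ℚ} (h : ∀ x, φ (sg x) = - φ x) (x : LCh V) :
    sg (cap φ x) = cap φ (sg x) := by
  have : sg ∘ₗ cap φ = cap φ ∘ₗ sg := lin_ext fun l => by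
    induction l with
    | nil => simp
    | cons v l ih =>
      simp only [LinearMap.comp_apply] at ih ⊢
      have h1 : φ (cons v (sg (bas l))) = φ (cons v (bas l)) := by
        rw [← neg_neg (cons v (sg (bas l))), ← sg_cons, map_neg, h, neg_neg]
      rw [bas_cons, cap_cons, map_add, sg_cons, sg_cons, map_neg, cap_cons, ih, h1, map_smul, sg_point]
      simp [add_comm]
  exact LinearMap.congr_fun this x

theorem cap_cr_fst {φ : LCh V →ₗ[ℚ] ℚ} (h : ∀ l, Dup l → φ (bas l) = 0)
    (hs : ∀ x, φ (sg x) = - φ x) (x : LCh V) (y : LCh W) :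
    cap (φ ∘ₗ lmap Prod.fst) (cr x y) = cr (cap φ x) y := by
  have h0 : φ (bas []) = 0 := by have := hs (bas []); rw [sg_nil] at this; linarith
  have : cr.compr₂ (cap (φ ∘ₗ lmap (Prod.fst : V × W → V))) = cr.compl₁₂ (cap φ) LinearMap.id := by
    refine cr_induction (fun l' => by simp) (fun l => by simp) fun a as b bs h1 h2 => ?_
    simp only [LinearMap.compl₁₂_apply, LinearMap.compr₂_apply, LinearMap.id_apply] at h1 h2 ⊢
    have h3 : cap (φ ∘ₗ lmap Prod.fst) (cr (cons a (sg (bas as))) (bas bs)) =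
        cr (cap φ (cons a (sg (bas as)))) (bas bs) := by
      rw [sg_bas]; simp only [map_smul, LinearMap.smul_apply, h2]
    have h4 : φ (cons a (sg (bas as))) = φ (cons a (bas as)) := by
      rw [← neg_neg (cons a (sg (bas as))), ← sg_cons, map_neg, hs, neg_neg]
    have h5 := apply_fst_cr h h0 (cons a (bas as)) (cons b (bas bs))
    rw [cr_cons_cons] at h5
    rw [cr_cons_cons, cap_cons, map_add (cap _), map_add (cap _), h1, h3, map_smul (cap _), cap_nil,
      LinearMap.comp_apply, h5, cap_cons φ a (bas as), map_add cr, LinearMap.add_apply, map_smul cr,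
      LinearMap.smul_apply, cr_cons_cons, nilc_cap, bas_cons a [], cr_cons_cons,
      cap_cons φ a (sg _), sg_cap hs, h4]
    simp only [nilc_bd_bas_cons, map_add, map_smul, cr_nil_left, nilc_nil, one_mul,
      LinearMap.add_apply, LinearMap.smul_apply, sg_nil, cons_bas, smul_add, smul_smul]
    simp [add_assoc]
  exact LinearMap.congr_fun (LinearMap.congr_fun this x) y

theorem cap_cr_snd {φ : LCh W →ₗ[ℚ] ℚ} (h : ∀ l, Dup l → φ (bas l) = 0)
    (h0 : φ (bas []) = 0) (x : LCh V) (y : LCh W) :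
    cap (φ ∘ₗ lmap Prod.snd) (cr x y) = cr x (cap φ y) := by
  have : cr.compr₂ (cap (φ ∘ₗ lmap (Prod.snd : V × W → W))) = cr.compl₁₂ LinearMap.id (cap φ) := by
    refine cr_induction (fun l' => by simp) (fun l => by simp) fun a as b bs h1 h2 => ?_
    simp only [LinearMap.compl₁₂_apply, LinearMap.compr₂_apply, LinearMap.id_apply] at h1 h2 ⊢
    have h3 : cap (φ ∘ₗ lmap Prod.snd) (cr (cons a (sg (bas as))) (bas bs)) =
        cr (cons a (sg (bas as))) (cap φ (bas bs)) := by
      rw [sg_bas]; simp only [map_smul, LinearMap.smul_apply, h2]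
    have h5 := apply_snd_cr h h0 (cons a (bas as)) (cons b (bas bs))
    rw [cr_cons_cons] at h5
    rw [cr_cons_cons, cap_cons, map_add (cap _), map_add (cap _), h1, h3, map_smul (cap _), cap_nil,
      LinearMap.comp_apply, h5, cap_cons φ b (bas bs), map_add (cr _), map_smul (cr _),
      map_add (cr _), map_smul (cr _), cr_cons_cons, nilc_cap, bas_cons b [], cr_cons_cons]
    simp only [nilc_bd_bas_cons, map_add, map_smul, cr_nil_right, nilc_nil, mul_one,
      cons_bas, smul_add, smul_smul]
    simp only [mul_zero, zero_smul, smul_zero, map_zero, add_zero]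
    rw [mul_comm (nilc (bas as))]
    abel
  exact LinearMap.congr_fun (LinearMap.congr_fun this x) y

end Lists
end SingChain

namespace SingChain
open Cvx

/-! ### Cross products, homotopies and cap products of singular chains -/

section Singular

variable {X Y X' Y' : Type} [TopologicalSpace X] [TopologicalSpace Y] [TopologicalSpace X']
  [TopologicalSpace Y']
variable {K L : Type} [TopologicalSpace K] [TopologicalSpace L] [Cvx K] [Cvx L]

instance isEmpty_simplex_zero : IsEmpty (Sx 0) := ⟨fun x => by
  have := x.2.2
  simp at this⟩

theorem simp_zero_eq (a : Simp X) (b : Simp X) (h : a.1 = 0) (h' : b.1 = 0) : a = b := by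
  obtain ⟨m, s⟩ := a
  obtain ⟨m', s'⟩ := b
  obtain rfl : m = 0 := h
  obtain rfl : m' = 0 := h'
  congr 1
  ext x; exact isEmptyElim x

/-- The empty simplex. -/
def nl : Ch X := bas ⟨0, ⟨fun x => isEmptyElim x, continuous_of_const fun x => isEmptyElim x⟩⟩

theorem bas_eq_nl (a : Simp X) (h : a.1 = 0) : bas a = nl := by
  rw [nl]; congr 1; exact simp_zero_eq _ _ h rfl

/-- The coefficient of the empty simplex. -/
def nlc : Ch X →ₗ[ℚ] ℚ := lin fun a => if a.1 = 0 then 1 else 0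

@[simp] theorem nlc_rz (s : C(K, X)) (x : LCh K) : nlc (rz s x) = nilc x := by
  have : nlc ∘ₗ rz s = nilc := lin_ext fun l => by
    rw [LinearMap.comp_apply, rz_bas, nlc, lin_bas, nilc, lin_bas]; rfl
  exact LinearMap.congr_fun this x

@[simp] theorem rz_nil (s : C(K, X)) : rz s (bas []) = nl := by
  rw [rz_bas]; exact bas_eq_nl _ rfl

@[simp] theorem nlc_nl : nlc (nl : Ch X) = 1 := by rw [nl, nlc, lin_bas]; simp

theorem nlc_bas (a : Simp X) : nlc (bas a) = if a.1 = 0 then 1 else 0 := lin_bas _ _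

@[simp] theorem dd_nl : dd (nl : Ch X) = 0 := by
  rw [nl, ← rz_verts, dd_rz]
  have : verts 0 = [] := List.eq_nil_of_length_eq_zero (length_verts 0)
  rw [this, bd_nil, map_zero]

@[simp] theorem push_nl (f : C(X, Y)) : push f nl = nl := by
  rw [nl, push_bas]; exact bas_eq_nl _ rfl

theorem nl_mem_chIn (P : Set X) : nl ∈ chIn P := bas_mem_chIn fun x => isEmptyElim x

theorem nl_mem_deg : (nl : Ch X) ∈ deg X 0 := bas_mem_deg _

theorem nlc_of_mem_deg {m : ℕ} (hm : m ≠ 0) {x : Ch X} (hx : x ∈ deg X m) : nlc x = 0 :=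
  eq_on_supported (g := 0) (fun a ha => by
    rw [nlc_bas]; simp only [Set.mem_ofPred_eq] at ha; simp [ha, hm]) hx

/-- The vertex at a point. -/
def pt (x : X) : Ch X := bas ⟨1, ContinuousMap.const _ x⟩

@[simp] theorem rz_point (s : C(K, X)) (v : K) : rz s (bas [v]) = pt (s v) := by
  rw [rz_bas, pt]
  congr 1
  refine simp_ext rfl fun x => ?_
  change s (aff [v].get x) = s v
  have : x = stdSimplex.vertex (0 : Fin 1) := by
    have h := x.2.2
    refine stdSimplex.ext (funext fun i => ?_)
    fin_cases i
    simp
  rw [this]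
  congr 1
  exact aff_vertex _ _

@[simp] theorem push_pt (f : C(X, Y)) (x : X) : push f (pt x) = pt (f x) := push_bas _ _

theorem pt_eq_rz (x : X) : pt x = rz (ContinuousMap.const (Sx 1) x) (bas [stdSimplex.vertex 0]) := by
  simp

@[simp] theorem dd_pt (x : X) : dd (pt x) = nl := by
  rw [pt_eq_rz, dd_rz, bd_point, rz_nil]

@[simp] theorem nlc_pt (x : X) : nlc (pt x) = 0 := by
  rw [pt, nlc_bas]; simp

/-- The cross product. -/
def xr : Ch X →ₗ[ℚ] Ch Y →ₗ[ℚ] Ch (X × Y) :=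
  lin fun a => lin fun b => rz (a.2.prodMap b.2) (cr (bas (verts a.1)) (bas (verts b.1)))

theorem xr_bas (a : Simp X) (b : Simp Y) : xr (bas a) (bas b) =
    rz (a.2.prodMap b.2) (cr (bas (verts a.1)) (bas (verts b.1))) := by
  rw [xr, lin_bas, lin_bas]

@[simp] theorem xr_rz (s : C(K, X)) (t : C(L, Y)) (x : LCh K) (y : LCh L) :
    xr (rz s x) (rz t y) = rz (s.prodMap t) (cr x y) := by
  have : xr.compl₁₂ (rz s) (rz t) = cr.compr₂ (rz (s.prodMap t)) := lin_ext₂ fun l l' => by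
    simp only [LinearMap.compl₁₂_apply, LinearMap.compr₂_apply, rz_bas, xr_bas]
    change rz ((s.prodMap t).comp ((aff l.get).prodMap (aff l'.get)))
      (cr (bas (verts l.length)) (bas (verts l'.length))) = _
    rw [rz_comp _ _ (by
      exact (isAff_aff l.get).prodMap (isAff_aff l'.get))]
    have h2 := lmap_cr (aff l.get) (aff l'.get) (bas (verts l.length)) (bas (verts l'.length))
    rw [lmap_bas, lmap_bas, map_aff_verts, map_aff_verts] at h2
    rw [← h2]; rfl
  exact LinearMap.congr_fun (LinearMap.congr_fun this x) y

theorem op_ext₂ {N : Type*} [AddCommGroup N] [Module ℚ N] {F G : Ch X →ₗ[ℚ] Ch Y →ₗ[ℚ] N}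
    (h : ∀ (m k : ℕ) (s : C(Sx m, X)) (t : C(Sx k, Y)),
      F (rz s (bas (verts m))) (rz t (bas (verts k))) =
        G (rz s (bas (verts m))) (rz t (bas (verts k)))) : F = G :=
  op_ext fun m s => op_ext fun k t => h m k s t

theorem dd_xr (a : Ch X) (b : Ch Y) :
    dd (xr a b) = xr (dd a) b - xr (sgn a) (dd b) + (nlc (dd a) * nlc (dd b)) • nl := by
  have : (xr.compr₂ dd : Ch X →ₗ[ℚ] Ch Y →ₗ[ℚ] Ch (X × Y)) =
      xr.compl₁₂ dd LinearMap.id - xr.compl₁₂ sgn dd +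
        ((LinearMap.mul ℚ ℚ).compl₁₂ (nlc ∘ₗ dd) (nlc ∘ₗ dd)).compr₂
          (LinearMap.toSpanSingleton ℚ _ nl) := op_ext₂ fun m k s t => by
    simp [bd_cr]
  exact LinearMap.congr_fun (LinearMap.congr_fun this a) b

theorem push_xr (f : C(X, X')) (g : C(Y, Y')) (a : Ch X) (b : Ch Y) :
    push (f.prodMap g) (xr a b) = xr (push f a) (push g b) := by
  have : xr.compr₂ (push (f.prodMap g)) = xr.compl₁₂ (push f) (push g) :=
    op_ext₂ fun m k s t => by
      simp only [LinearMap.compr₂_apply, LinearMap.compl₁₂_apply, xr_rz, push_rz]; rfl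
  exact LinearMap.congr_fun (LinearMap.congr_fun this a) b

theorem xr_mem {P : Set (Simp X)} {Q : Set (Simp Y)} {S : Submodule ℚ (Ch (X × Y))}
    (h : ∀ a ∈ P, ∀ b ∈ Q, xr (bas a) (bas b) ∈ S) {x : Ch X} {y : Ch Y}
    (hx : x ∈ Finsupp.supported ℚ ℚ P) (hy : y ∈ Finsupp.supported ℚ ℚ Q) : xr x y ∈ S := by
  have h1 : ∀ a ∈ P, xr (bas a) y ∈ S := fun a ha =>
    supported_le_comap (f := xr (bas a)) (fun b hb => h a ha b hb) y hy
  exact supported_le_comap (f := xr.flip y) (fun a ha => h1 a ha) x hx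

theorem xr_mem_chIn {P : Set X} {Q : Set Y} {x : Ch X} {y : Ch Y} (hx : x ∈ chIn P)
    (hy : y ∈ chIn Q) : xr x y ∈ chIn (P ×ˢ Q) := by
  refine xr_mem (fun a ha b hb => ?_) hx hy
  rw [xr_bas]
  exact rz_mem_chIn _ (fun z => Set.mk_mem_prod (ha _) (hb _)) _

theorem xr_mem_deg {m k : ℕ} {x : Ch X} {y : Ch Y} (hx : x ∈ deg X m)
    (hy : y ∈ deg Y k) : xr x y ∈ deg (X × Y) (m + k - 1) := by
  refine xr_mem (fun a ha b hb => ?_) hx hy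
  rw [xr_bas, cr_bas]
  refine rz_mem_deg _ ?_
  have := crossL_mem_ldeg (verts a.1) (verts b.1)
  simp only [length_verts, Set.mem_ofPred_eq] at this ha hb
  rwa [← ha, ← hb]

theorem xr_pt (c : Ch X) (y : Y) :
    xr c (pt y) = push ((ContinuousMap.id X).prodMk (ContinuousMap.const X y)) c - nlc c • nl := by
  have : xr.flip (pt y) = push ((ContinuousMap.id X).prodMk (ContinuousMap.const X y)) -
      LinearMap.toSpanSingleton ℚ _ nl ∘ₗ nlc := op_ext fun m s => by
    simp only [LinearMap.flip_apply, pt_eq_rz, xr_rz, LinearMap.sub_apply, LinearMap.comp_apply,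
      LinearMap.toSpanSingleton_apply, cr_point, map_sub, map_smul, rz_nil, nlc_rz, push_rz]
    congr 1
    have := rz_comp (s.prodMap (ContinuousMap.const (Sx 1) y))
      ((ContinuousMap.id (Sx m)).prodMk (ContinuousMap.const _ (stdSimplex.vertex 0)))
      (fun k t x => Prod.ext rfl (by
        exact Subsingleton.elim _ _))
      (bas (verts m))
    exact this.symm
  exact LinearMap.congr_fun this c

theorem pt_xr (x : X) (c : Ch Y) :
    xr (pt x) c = push ((ContinuousMap.const Y x).prodMk (ContinuousMap.id Y)) c - nlc c • nl := by
  have : xr (pt x) = push ((ContinuousMap.const Y x).prodMk (ContinuousMap.id Y)) -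
      LinearMap.toSpanSingleton ℚ _ nl ∘ₗ nlc := op_ext fun m s => by
    simp only [pt_eq_rz, xr_rz, LinearMap.sub_apply, LinearMap.comp_apply,
      LinearMap.toSpanSingleton_apply, point_cr, map_sub, map_smul, rz_nil, nlc_rz, push_rz]
    congr 1
    have := rz_comp ((ContinuousMap.const (Sx 1) x).prodMap s)
      ((ContinuousMap.const _ (stdSimplex.vertex 0)).prodMk (ContinuousMap.id (Sx m)))
      (fun k t x => Prod.ext (by
        exact Subsingleton.elim _ _) rfl)
      (bas (verts m))
    exact this.symm
  exact LinearMap.congr_fun this c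

/-! #### Homotopies -/

/-- The identity path as a simplex. -/
def pathS : C(Sx 2, I) := ⟨fun x => ⟨x 1, x.2.1 1, by
    have h := x.2.2; have h0 := x.2.1 0
    rw [Fin.sum_univ_two] at h
    have h' : x 0 + x 1 = 1 := h
    have h0' : (0:ℝ) ≤ x 0 := h0
    linarith⟩, by
  refine Continuous.subtype_mk (continuous_coord 1) _⟩

/-- The edge from `0` to `1`. -/
def edge : Ch I := bas ⟨2, pathS⟩

theorem edge_mem_deg : edge ∈ deg I 2 := bas_mem_deg _

theorem dd_edge : dd edge = pt 1 - pt 0 := by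
  have h : edge = rz pathS (bas [stdSimplex.vertex 0, stdSimplex.vertex 1]) := by
    rw [edge, rz_bas]
    congr 1
    have := simp_verts pathS
    rw [← this]; congr 1
  rw [h, dd_rz, bd_cons_bas, bd_point, cons_bas, map_sub, rz_point, rz_point]
  congr 2

/-- The prism operator of a homotopy. -/
def hmt (h : C(X × I, Y)) : Ch X →ₗ[ℚ] Ch Y := -(push h ∘ₗ xr.flip edge ∘ₗ sgn)

/-- The time `t` map of a homotopy. -/
def atT (h : C(X × I, Y)) (t : I) : C(X, Y) :=
  h.comp ((ContinuousMap.id X).prodMk (ContinuousMap.const X t))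

@[simp] theorem atT_apply (h : C(X × I, Y)) (t : I) (x : X) : atT h t x = h (x, t) := rfl

theorem hmt_apply (h : C(X × I, Y)) (c : Ch X) : hmt h c = - push h (xr (sgn c) edge) := rfl

theorem dd_hmt (h : C(X × I, Y)) (c : Ch X) :
    dd (hmt h c) = push (atT h 1) c - push (atT h 0) c - hmt h (dd c) := by
  rw [hmt_apply, hmt_apply, map_neg, ← push_dd, dd_xr, dd_edge, sgn_sgn, map_sub, xr_pt, xr_pt,
    sgn_dd]
  simp only [map_sub, map_neg, map_smul, LinearMap.neg_apply, nlc_pt, sub_self, mul_zero,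
    zero_smul, add_zero, push_nl, ← push_comp, atT]
  abel

theorem hmt_mem_chIn {P : Set X} {Q : Set Y} (h : C(X × I, Y)) (hPQ : ∀ x ∈ P, ∀ t, h (x, t) ∈ Q)
    {c : Ch X} (hc : c ∈ chIn P) : hmt h c ∈ chIn Q := by
  rw [hmt_apply]
  refine Submodule.neg_mem _ (push_mem_chIn (P := P ×ˢ Set.univ) _ (fun x hx => hPQ _ hx.1 _) ?_)
  exact xr_mem_chIn (sgn_mem_chIn hc) (by rw [chIn_univ]; trivial)

theorem sgn_mem_deg {m : ℕ} {x : Ch X} (hx : x ∈ deg X m) : sgn x ∈ deg X m := by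
  rw [sgn_of_mem_deg hx]; exact Submodule.smul_mem _ _ hx

theorem hmt_mem_deg (h : C(X × I, Y)) {m : ℕ} {c : Ch X} (hc : c ∈ deg X m) :
    hmt h c ∈ deg Y (m + 1) := by
  rw [hmt_apply]
  exact Submodule.neg_mem _ (push_mem_deg _ (xr_mem_deg (sgn_mem_deg hc) edge_mem_deg))

/-- The inclusion of a subset. -/
def incl (P : Set X) : C(P, X) := ⟨Subtype.val, continuous_subtype_val⟩

@[simp] theorem incl_apply {P : Set X} (x : P) : incl P x = x := rfl

/-- Chains with image in a subset lift to the subset. -/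
theorem exists_lift {P : Set X} {c : Ch X} (hc : c ∈ chIn P) : ∃ c' : Ch P, push (incl P) c' = c := by
  have h : chIn P ≤ LinearMap.range (push (incl P)) := by
    intro x hx
    refine supported_le_comap (f := LinearMap.id) (Q := LinearMap.range (push (incl P)))
      (fun a ha => ?_) x hx
    refine ⟨bas ⟨a.1, ⟨fun z => ⟨a.2 z, ha z⟩, by fun_prop⟩⟩, ?_⟩
    rw [push_bas]; rfl
  exact h hc

theorem push_incl_injective (P : Set X) : Function.Injective (push (incl P)) := by
  have h : (push (incl P) : Ch P → Ch X) = Finsupp.mapDomain fun a => ⟨a.1, (incl P).comp a.2⟩ := by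
    funext x
    have : push (incl P) = Finsupp.lmapDomain ℚ ℚ fun a : Simp P => (⟨a.1, (incl P).comp a.2⟩ : Simp X) :=
      lin_ext fun a => by rw [push_bas]; simp [bas]
    rw [this]; rfl
  rw [h]
  refine Finsupp.mapDomain_injective fun a b hab => ?_
  obtain ⟨m, s⟩ := a
  obtain ⟨m', s'⟩ := b
  simp only [Sigma.mk.injEq] at hab
  obtain ⟨rfl, hab⟩ := hab
  congr 1
  ext x
  exact congrArg (fun g : C(Sx m, X) => g x) (eq_of_heq hab)

/-! #### Cap products -/

theorem cap_add {V : Type} (φ ψ : LCh V →ₗ[ℚ] ℚ) (x : LCh V) :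
    cap (φ + ψ) x = cap φ x + cap ψ x := by
  have : cap (φ + ψ) = cap φ + cap ψ := lin_ext fun l => by
    induction l with
    | nil => simp
    | cons v l ih =>
      rw [bas_cons, LinearMap.add_apply, cap_cons, ih, cap_cons, cap_cons]
      simp only [LinearMap.add_apply, map_add, add_smul]
      abel
  exact LinearMap.congr_fun this x

theorem cap_smul {V : Type} (r : ℚ) (φ : LCh V →ₗ[ℚ] ℚ) (x : LCh V) :
    cap (r • φ) x = r • cap φ x := by
  have : cap (r • φ) = r • cap φ := lin_ext fun l => by
    induction l with
    | nil => simp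
    | cons v l ih =>
      rw [bas_cons, LinearMap.smul_apply, cap_cons, ih, cap_cons]
      simp only [LinearMap.smul_apply, map_smul, smul_add, smul_smul, smul_eq_mul]
  exact LinearMap.congr_fun this x

/-- The cap product of singular chains with a cochain evaluated on back faces. -/
def cp (u : Ch X →ₗ[ℚ] ℚ) : Ch X →ₗ[ℚ] Ch X :=
  lin fun a => rz a.2 (cap (u ∘ₗ rz a.2) (bas (verts a.1)))

@[simp] theorem cp_rz (u : Ch X →ₗ[ℚ] ℚ) (s : C(K, X)) (x : LCh K) :
    cp u (rz s x) = rz s (cap (u ∘ₗ rz s) x) := by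
  have : cp u ∘ₗ rz s = rz s ∘ₗ cap (u ∘ₗ rz s) := lin_ext fun l => by
    simp only [LinearMap.comp_apply, rz_bas, cp, lin_bas]
    change rz (s.comp (aff l.get)) (cap (u ∘ₗ rz (s.comp (aff l.get))) (bas (verts l.length))) = _
    rw [rz_comp _ _ (isAff_aff _)]
    have h : u ∘ₗ rz (s.comp (aff l.get)) = (u ∘ₗ rz s) ∘ₗ lmap (aff l.get) := by
      refine LinearMap.ext fun y => ?_
      simp only [LinearMap.comp_apply]
      rw [← rz_comp _ _ (isAff_aff _)]
    rw [h, lmap_cap, lmap_bas, map_aff_verts]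
  exact LinearMap.congr_fun this x

theorem cp_add (u v : Ch X →ₗ[ℚ] ℚ) (x : Ch X) : cp (u + v) x = cp u x + cp v x := by
  have : cp (u + v) = cp u + cp v := op_ext fun m s => by
    simp only [LinearMap.add_apply, cp_rz, LinearMap.add_comp, cap_add, map_add]
  exact LinearMap.congr_fun this x

theorem cp_smul (r : ℚ) (u : Ch X →ₗ[ℚ] ℚ) (x : Ch X) : cp (r • u) x = r • cp u x := by
  have : cp (r • u) = r • cp u := op_ext fun m s => by
    simp only [LinearMap.smul_apply, cp_rz, LinearMap.smul_comp, cap_smul, map_smul]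
  exact LinearMap.congr_fun this x

theorem cp_sub (u v : Ch X →ₗ[ℚ] ℚ) (x : Ch X) : cp (u - v) x = cp u x - cp v x := by
  rw [sub_eq_add_neg, cp_add, ← neg_one_smul ℚ v, cp_smul, neg_one_smul, sub_eq_add_neg]

@[simp] theorem cp_zero (x : Ch X) : cp 0 x = 0 := by
  rw [← zero_smul ℚ (0 : Ch X →ₗ[ℚ] ℚ), cp_smul, zero_smul]

theorem dd_cp {u : Ch X →ₗ[ℚ] ℚ} (h0 : u nl = 0) (x : Ch X) :
    dd (cp u x) = cp u (dd x) + u x • nl + sgn (cp (u ∘ₗ dd) x) := by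
  have : dd ∘ₗ cp u = cp u ∘ₗ dd + LinearMap.toSpanSingleton ℚ _ nl ∘ₗ u +
      sgn ∘ₗ cp (u ∘ₗ dd) := op_ext fun m s => by
    have h : (u ∘ₗ dd) ∘ₗ rz s = (u ∘ₗ rz s) ∘ₗ bd := LinearMap.ext fun y => by simp
    simp only [LinearMap.comp_apply, LinearMap.add_apply, cp_rz, dd_rz, sgn_rz,
      LinearMap.toSpanSingleton_apply]
    rw [h, bd_cap (by simpa using h0)]
    simp
  exact LinearMap.congr_fun this x

@[simp] theorem cp_nl (u : Ch X →ₗ[ℚ] ℚ) : cp u nl = 0 := by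
  rw [nl, ← rz_verts, cp_rz]
  have : verts 0 = [] := List.eq_nil_of_length_eq_zero (length_verts 0)
  rw [this, cap_nil, map_zero]

theorem cp_mem_chIn (u : Ch X →ₗ[ℚ] ℚ) {P : Set X} {x : Ch X} (hx : x ∈ chIn P) :
    cp u x ∈ chIn P :=
  supported_le_comap (f := cp u) (fun a ha => by
    rw [cp, lin_bas]; exact rz_mem_chIn _ ha _) x hx

theorem cap_mem_ldeg {V : Type} {φ : LCh V →ₗ[ℚ] ℚ} {k : ℕ} (hφ : ∀ l, l.length ≠ k → φ (bas l) = 0)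
    (l : List V) : cap φ (bas l) ∈ ldeg V (l.length + 1 - k) := by
  induction l with
  | nil => rw [cap_nil]; exact Submodule.zero_mem _
  | cons v l ih =>
    rw [bas_cons, cap_cons, cons_bas]
    by_cases hk : (v :: l).length = k
    · have h0 : cap φ (bas l) = 0 := by
        have : ∀ l : List V, l.length < k → cap φ (bas l) = 0 := by
          intro l hl
          induction l with
          | nil => simp
          | cons v l ih =>
            rw [bas_cons, cap_cons, cons_bas, hφ _ hl.ne, ih (by simp at hl; omega)]; simp
        exact this l (by simp at hk; omega)
      rw [h0, map_zero, zero_add]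
      refine Submodule.smul_mem _ _ ?_
      rw [show (v :: l).length + 1 - k = [v].length by simp at hk ⊢; omega]
      exact bas_mem_ldeg _
    · rw [hφ _ hk, zero_smul, add_zero]
      by_cases h : l.length + 1 < k
      · have : ∀ l : List V, l.length < k → cap φ (bas l) = 0 := by
          intro l hl
          induction l with
          | nil => simp
          | cons v l ih =>
            rw [bas_cons, cap_cons, cons_bas, hφ _ hl.ne, ih (by simp at hl; omega)]; simp
        rw [this l (by omega), map_zero]; exact Submodule.zero_mem _
      · have := cons_mem_ldeg v ih
        simp only [List.length_cons] at hk ⊢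
        rwa [show l.length + 1 + 1 - k = l.length + 1 - k + 1 by omega]

/-- Cochains concentrated on simplices with `k` vertices. -/
def HomF (k : ℕ) (u : Ch X →ₗ[ℚ] ℚ) : Prop := ∀ a : Simp X, a.1 ≠ k → u (bas a) = 0

theorem HomF.apply {k m : ℕ} {u : Ch X →ₗ[ℚ] ℚ} (h : HomF k u) (hm : m ≠ k) {x : Ch X}
    (hx : x ∈ deg X m) : u x = 0 :=
  eq_on_supported (g := 0) (fun a ha => h a (fun h' => hm (by rw [← h']; exact ha.symm))) hx

theorem HomF.nl {k : ℕ} {u : Ch X →ₗ[ℚ] ℚ} (h : HomF k u) (hk : k ≠ 0) : u nl = 0 :=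
  h _ (Ne.symm hk)

theorem HomF.push {k : ℕ} {u : Ch Y →ₗ[ℚ] ℚ} (h : HomF k u) (f : C(X, Y)) :
    HomF k (u ∘ₗ push f) := fun a ha => by rw [LinearMap.comp_apply, push_bas]; exact h _ ha

theorem HomF.sub {k : ℕ} {u v : Ch Y →ₗ[ℚ] ℚ} (h : HomF k u) (h' : HomF k v) :
    HomF k (u - v) := fun a ha => by rw [LinearMap.sub_apply, h a ha, h' a ha, sub_zero]

theorem HomF.comp_proj {k : ℕ} (u : Ch Y →ₗ[ℚ] ℚ) : HomF k (u ∘ₗ proj k) := fun a ha => by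
  rw [LinearMap.comp_apply, proj_bas, if_neg ha, map_zero]

theorem HomF.sgn {k : ℕ} {u : Ch X →ₗ[ℚ] ℚ} (h : HomF k u) (x : Ch X) :
    u (sgn x) = (-1) ^ k * u x := by
  have : u ∘ₗ SingChain.sgn = (-1 : ℚ) ^ k • u := lin_ext fun a => by
    rw [LinearMap.comp_apply, sgn_bas, map_smul, LinearMap.smul_apply]
    by_cases ha : a.1 = k
    · rw [ha]
    · rw [h a ha]; simp
  exact LinearMap.congr_fun this x

theorem cp_mem_deg {k m : ℕ} {u : Ch X →ₗ[ℚ] ℚ} (h : HomF k u) {x : Ch X} (hx : x ∈ deg X m) :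
    cp u x ∈ deg X (m + 1 - k) :=
  supported_le_comap (f := cp u) (fun a ha => by
    rw [cp, lin_bas]
    refine rz_mem_deg _ ?_
    have := cap_mem_ldeg (φ := u ∘ₗ rz a.2) (k := k) (fun l hl => by
      rw [LinearMap.comp_apply, rz_bas]; exact h _ hl) (verts a.1)
    rw [length_verts] at this
    rw [← show a.1 = m from ha]; exact this) x hx

/-- Cochains vanishing on the degenerate affine simplices. -/
def Nrm (u : Ch X →ₗ[ℚ] ℚ) : Prop :=
  ∀ (p : ℕ) (s : C(Sx p, X)) (l : List (Sx p)), Dup l → u (rz s (bas l)) = 0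

theorem nrm_comp_sub (u : Ch X →ₗ[ℚ] ℚ) : Nrm (u ∘ₗ sub) := fun p s l hl => by
  rw [LinearMap.comp_apply, sub_rz, sd_dup hl, map_zero, map_zero]

theorem homF_comp_sub {k : ℕ} {u : Ch X →ₗ[ℚ] ℚ} (h : HomF k u) : HomF k (u ∘ₗ sub) :=
  fun a ha => by
    rw [LinearMap.comp_apply]; exact h.apply ha (sub_mem_deg (bas_mem_deg a))

theorem ev_fst {u : Ch X →ₗ[ℚ] ℚ} (h : Nrm u) (h0 : u nl = 0) (a : Ch X) (b : Ch Y) :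
    u (push ContinuousMap.fst (xr a b)) = u a * nlc (dd b) := by
  have : xr.compr₂ (u ∘ₗ push (ContinuousMap.fst : C(X × Y, X))) =
      (LinearMap.mul ℚ ℚ).compl₁₂ u (nlc ∘ₗ dd) := op_ext₂ fun m k s t => by
    have h1 := apply_fst_cr (φ := u ∘ₗ rz s) (h m s) (by simpa using h0) (bas (verts m))
      (bas (verts k))
    have h2 : (ContinuousMap.fst : C(X × Y, X)).comp (s.prodMap t) =
      s.comp (ContinuousMap.fst : C(Sx m × Sx k, Sx m)) := rfl
    simp only [LinearMap.compr₂_apply, LinearMap.comp_apply, xr_rz, push_rz,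
      LinearMap.compl₁₂_apply, LinearMap.mul_apply', dd_rz, nlc_rz, h2] at h1 ⊢
    rw [rz_comp _ _ (by exact isAff_fst)]
    exact h1
  exact LinearMap.congr_fun (LinearMap.congr_fun this a) b

theorem ev_snd {u : Ch Y →ₗ[ℚ] ℚ} (h : Nrm u) (h0 : u nl = 0) (a : Ch X) (b : Ch Y) :
    u (push ContinuousMap.snd (xr a b)) = nlc (dd a) * u b := by
  have : xr.compr₂ (u ∘ₗ push (ContinuousMap.snd : C(X × Y, Y))) =
      (LinearMap.mul ℚ ℚ).compl₁₂ (nlc ∘ₗ dd) u := op_ext₂ fun m k s t => by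
    have h1 := apply_snd_cr (φ := u ∘ₗ rz t) (h k t) (by simpa using h0) (bas (verts m))
      (bas (verts k))
    have h2 : (ContinuousMap.snd : C(X × Y, Y)).comp (s.prodMap t) =
      t.comp (ContinuousMap.snd : C(Sx m × Sx k, Sx k)) := rfl
    simp only [LinearMap.compr₂_apply, LinearMap.comp_apply, xr_rz, push_rz,
      LinearMap.compl₁₂_apply, LinearMap.mul_apply', dd_rz, nlc_rz, h2] at h1 ⊢
    rw [rz_comp _ _ (by exact isAff_snd)]
    exact h1
  exact LinearMap.congr_fun (LinearMap.congr_fun this a) b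

theorem cp_fst {u : Ch X →ₗ[ℚ] ℚ} (h : Nrm u) (hs : ∀ x, u (sgn x) = - u x) (a : Ch X)
    (b : Ch Y) : cp (u ∘ₗ push ContinuousMap.fst) (xr a b) = xr (cp u a) b := by
  have : xr.compr₂ (cp (u ∘ₗ push (ContinuousMap.fst : C(X × Y, X)))) =
      xr.compl₁₂ (cp u) LinearMap.id := op_ext₂ fun m k s t => by
    have h1 := cap_cr_fst (φ := u ∘ₗ rz s) (h m s)
      (fun x => by simpa using hs (rz s x)) (bas (verts m)) (bas (verts k))
    have h2 : (u ∘ₗ push (ContinuousMap.fst : C(X × Y, X))) ∘ₗ rz (s.prodMap t) =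
        (u ∘ₗ rz s) ∘ₗ lmap Prod.fst := LinearMap.ext fun y => by
      simp only [LinearMap.comp_apply, push_rz]
      rw [show (ContinuousMap.fst : C(X × Y, X)).comp (s.prodMap t) =
        s.comp (ContinuousMap.fst : C(Sx m × Sx k, Sx m)) from rfl, rz_comp _ _ (by exact isAff_fst)]
      rfl
    simp only [LinearMap.compr₂_apply, xr_rz, LinearMap.compl₁₂_apply, LinearMap.id_apply, cp_rz,
      h2, h1]
  exact LinearMap.congr_fun (LinearMap.congr_fun this a) b

theorem cp_snd {u : Ch Y →ₗ[ℚ] ℚ} (h : Nrm u) (h0 : u nl = 0) (a : Ch X)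
    (b : Ch Y) : cp (u ∘ₗ push ContinuousMap.snd) (xr a b) = xr a (cp u b) := by
  have : xr.compr₂ (cp (u ∘ₗ push (ContinuousMap.snd : C(X × Y, Y)))) =
      xr.compl₁₂ LinearMap.id (cp u) := op_ext₂ fun m k s t => by
    have h1 := cap_cr_snd (φ := u ∘ₗ rz t) (h k t) (by simpa using h0) (bas (verts m))
      (bas (verts k))
    have h2 : (u ∘ₗ push (ContinuousMap.snd : C(X × Y, Y))) ∘ₗ rz (s.prodMap t) =
        (u ∘ₗ rz t) ∘ₗ lmap Prod.snd := LinearMap.ext fun y => by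
      simp only [LinearMap.comp_apply, push_rz]
      rw [show (ContinuousMap.snd : C(X × Y, Y)).comp (s.prodMap t) =
        t.comp (ContinuousMap.snd : C(Sx m × Sx k, Sx k)) from rfl, rz_comp _ _ (by exact isAff_snd)]
      rfl
    simp only [LinearMap.compr₂_apply, xr_rz, LinearMap.compl₁₂_apply, LinearMap.id_apply, cp_rz,
      h2, h1]
  exact LinearMap.congr_fun (LinearMap.congr_fun this a) b

end Singular
end SingChain

namespace SingChain
open Cvx

/-! ### Vanishing of cup products, relative cycles and excision -/

section Relative

variable {X Y : Type} [TopologicalSpace X] [TopologicalSpace Y]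

theorem exists_factor {V V' : Type*} [AddCommGroup V] [Module ℚ V] [AddCommGroup V'] [Module ℚ V']
    (S : Submodule ℚ V) (d : V →ₗ[ℚ] V') (φ : V →ₗ[ℚ] ℚ) (h : ∀ x ∈ S, d x = 0 → φ x = 0) :
    ∃ f : V' →ₗ[ℚ] ℚ, ∀ x ∈ S, φ x = f (d x) := by
  have h1 : (φ ∘ₗ S.subtype : Module.Dual ℚ S) ∈ (LinearMap.ker (d ∘ₗ S.subtype)).dualAnnihilator := by
    rw [Submodule.mem_dualAnnihilator]
    intro x hx
    exact h x x.2 hx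
  rw [← LinearMap.range_dualMap_eq_dualAnnihilator_ker] at h1
  obtain ⟨f, hf⟩ := h1
  exact ⟨f, fun x hx => (LinearMap.congr_fun hf ⟨x, hx⟩).symm⟩

/-- The functional vanishes on cycles in `W`. -/
def Van (u : Ch X →ₗ[ℚ] ℚ) (W : Set X) : Prop := ∀ c ∈ chIn W, dd c = 0 → u c = 0

/-- Homogeneous cocycles. -/
structure Coc (k : ℕ) (u : Ch X →ₗ[ℚ] ℚ) : Prop where
  hom : HomF k u
  apply_dd : ∀ x, u (dd x) = 0

theorem Coc.push {k : ℕ} {u : Ch Y →ₗ[ℚ] ℚ} (h : Coc k u) (f : C(X, Y)) : Coc k (u ∘ₗ push f) :=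
  ⟨h.hom.push f, fun x => by rw [LinearMap.comp_apply, push_dd, h.apply_dd]⟩

theorem Coc.sub {k : ℕ} {u v : Ch Y →ₗ[ℚ] ℚ} (h : Coc k u) (h' : Coc k v) : Coc k (u - v) :=
  ⟨h.hom.sub h'.hom, fun x => by rw [LinearMap.sub_apply, h.apply_dd, h'.apply_dd, sub_zero]⟩

theorem Coc.comp_sub {k : ℕ} {u : Ch Y →ₗ[ℚ] ℚ} (h : Coc k u) : Coc k (u ∘ₗ SingChain.sub) :=
  ⟨homF_comp_sub h.hom, fun x => by rw [LinearMap.comp_apply, ← dd_sub, h.apply_dd]⟩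

theorem Coc.apply_sub {k : ℕ} {u : Ch Y →ₗ[ℚ] ℚ} (h : Coc k u) {z : Ch Y} (hz : dd z = 0) :
    u (SingChain.sub z) = u z := by
  have h1 := h.apply_dd (subT z)
  rw [dd_subT, hz, map_zero, sub_zero, map_sub] at h1
  linarith

theorem exists_primitive {k : ℕ} {u : Ch X →ₗ[ℚ] ℚ} (h : HomF (k + 1) u) {W : Set X}
    (hW : Van u W) : ∃ f : Ch X →ₗ[ℚ] ℚ, HomF k f ∧ ∀ x ∈ chIn W, u x = f (dd x) := by
  obtain ⟨f, hf⟩ := exists_factor (chIn W) dd u hW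
  refine ⟨f ∘ₗ proj k, HomF.comp_proj f, fun x hx => ?_⟩
  have h1 : u x = u (proj (k + 1) x) := by
    have : u = u ∘ₗ proj (k + 1) := lin_ext fun a => by
      rw [LinearMap.comp_apply, proj_bas]
      split_ifs with ha
      · rfl
      · rw [h a ha, map_zero]
    exact LinearMap.congr_fun this x
  rw [h1, hf _ (proj_mem_chIn _ hx), LinearMap.comp_apply, proj_dd]

theorem cp_eq_zero {u : Ch X →ₗ[ℚ] ℚ} {A : Set X} (h : ∀ x ∈ chIn A, u x = 0) {x : Ch X}
    (hx : x ∈ chIn A) : cp u x = 0 :=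
  eq_on_supported (f := cp u) (g := 0) (fun a ha => by
    have : u ∘ₗ rz a.2 = 0 := LinearMap.ext fun y => h _ (rz_mem_chIn _ ha y)
    rw [cp, lin_bas, this]
    have h0 : cap (0 : LCh (Sx a.1) →ₗ[ℚ] ℚ) = 0 := LinearMap.ext fun y => by
      rw [← zero_smul ℚ (0 : LCh (Sx a.1) →ₗ[ℚ] ℚ), cap_smul, zero_smul]; rfl
    rw [h0]; simp) hx

theorem apply_cp_dd {k k' : ℕ} {Φ u : Ch X →ₗ[ℚ] ℚ} (hΦ : Coc (k + 2) Φ) (hu : Coc (k' + 2) u)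
    (x : Ch X) : Φ (cp u (dd x)) = 0 := by
  have h := dd_cp (hu.hom.nl (by omega)) x
  have h0 : u ∘ₗ dd = 0 := LinearMap.ext hu.apply_dd
  rw [h0, cp_zero, map_zero, add_zero] at h
  have h1 : cp u (dd x) = dd (cp u x) - u x • nl := by rw [h]; abel
  rw [h1, map_sub, hΦ.apply_dd, map_smul, hΦ.hom.nl (by omega)]; simp

theorem coc_comp_cp {k k' : ℕ} {Φ u : Ch X →ₗ[ℚ] ℚ} (hΦ : Coc (k + 2) Φ) (hu : Coc (k' + 2) u) :
    Coc (k + k' + 1 + 2) (Φ ∘ₗ cp u) :=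
  ⟨fun a ha => hΦ.hom.apply (by omega) (cp_mem_deg hu.hom (bas_mem_deg a)),
    fun x => apply_cp_dd hΦ hu x⟩

/-- Products of cocycles vanishing on two open sets vanish on the union. -/
theorem van_union {k k' : ℕ} {Φ u : Ch X →ₗ[ℚ] ℚ} (hΦ : Coc (k + 2) Φ) (hu : Coc (k' + 2) u)
    {A W : Set X} (hA : IsOpen A) (hW : IsOpen W) (hVu : Van u A) (hVΦ : Van Φ W) :
    Van (Φ ∘ₗ cp u) (A ∪ W) := by
  intro z hz hdz
  obtain ⟨j, hj⟩ := exists_sub_mem hA hW hz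
  have hz' : dd ((sub ^ j) z) = 0 := by rw [dd_sub_pow, hdz, map_zero]
  have h1 : Φ (cp u z) = Φ (cp u ((sub ^ j) z)) := by
    have := dd_subTk j z
    rw [hdz, map_zero, sub_zero] at this
    rw [← sub_eq_zero, ← map_sub, ← map_sub, ← this, apply_cp_dd hΦ hu]
  rw [LinearMap.comp_apply, h1]
  generalize (sub ^ j) z = y at hj hz'
  obtain ⟨a, ha, w, hw, rfl⟩ := Submodule.mem_sup.1 hj
  obtain ⟨f, hf, hfW⟩ := exists_primitive hΦ.hom hVΦ
  obtain ⟨g, hg, hgA⟩ := exists_primitive hu.hom hVu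
  have hg0 := hg.nl (by omega)
  have h2 : Φ (cp (g ∘ₗ dd) (a + w)) = 0 := by
    have h := dd_cp hg0 (a + w)
    rw [hz', map_zero, zero_add] at h
    have h3 : cp (g ∘ₗ dd) (a + w) = sgn (dd (cp g (a + w)) - g (a + w) • nl) := by
      rw [h, add_sub_cancel_left, sgn_sgn]
    rw [h3, hΦ.hom.sgn, map_sub, hΦ.apply_dd, map_smul, hΦ.hom.nl (by omega)]; simp
  have hu0 : u nl = 0 := hu.hom.nl (by omega)
  set u' := u - g ∘ₗ dd with hu'
  have h4 : cp u (a + w) = cp u' (a + w) + cp (g ∘ₗ dd) (a + w) := by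
    rw [hu', cp_sub]; abel
  have h5 : ∀ x ∈ chIn A, u' x = 0 := fun x hx => by
    rw [hu', LinearMap.sub_apply, LinearMap.comp_apply, hgA x hx, sub_self]
  rw [h4, map_add, h2, add_zero, map_add, cp_eq_zero h5 ha, zero_add, hfW _ (cp_mem_chIn _ hw)]
  have h6 : u' nl = 0 := by rw [hu']; simp [hu0]
  have h7 : u' ∘ₗ dd = 0 := LinearMap.ext fun x => by rw [hu']; simp [hu.apply_dd]
  have h8 : dd w = - dd a := by rw [map_add] at hz'; exact (neg_eq_of_add_eq_zero_right hz').symm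
  rw [dd_cp h6, h7, cp_zero, map_zero, add_zero, h8, map_neg, cp_eq_zero h5 (dd_mem_chIn ha),
    neg_zero, zero_add, map_smul, hf.nl (by omega), smul_zero]

theorem van_of_homotopic {P : Set X} {f g : C(P, Y)} (h : f.Homotopic g) {k : ℕ}
    {u : Ch Y →ₗ[ℚ] ℚ} (hu : Coc k u) {c : Ch P} (hc : dd c = 0) : u (push f c) = u (push g c) := by
  obtain ⟨H⟩ := h
  let H' : C(P × I, Y) := ⟨fun x => H (x.2, x.1), by fun_prop⟩
  have h1 := hu.apply_dd (hmt H' c)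
  have e1 : atT H' 1 = g := by ext x; simp [H']
  have e0 : atT H' 0 = f := by ext x; simp [H']
  rw [dd_hmt, hc, map_zero, sub_zero, e1, e0, map_sub] at h1
  linarith

/-! #### Compactness of supports -/

theorem mem_chIn_of_directed {ι : Type} [Nonempty ι] {P : ι → Set X} (hP : ∀ i, IsOpen (P i))
    (hd : Directed (· ⊆ ·) P) {x : Ch X} (hx : x ∈ chIn (⋃ i, P i)) : ∃ i, x ∈ chIn (P i) := by
  rw [chIn, Finsupp.supported_eq_span_single] at hx
  induction hx using Submodule.span_induction with
  | mem x h =>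
    obtain ⟨a, ha, rfl⟩ := h
    obtain ⟨m, s⟩ := a
    have : CompactSpace (Sx m) := isCompact_iff_compactSpace.1 (isCompact_stdSimplex ℝ (Fin m))
    obtain ⟨i, hi⟩ := (isCompact_range s.continuous).elim_directed_cover P hP
      (by rintro _ ⟨z, rfl⟩; exact ha z) hd
    exact ⟨i, bas_mem_chIn fun z => hi ⟨z, rfl⟩⟩
  | zero => exact ⟨Classical.arbitrary ι, Submodule.zero_mem _⟩
  | add x y _ _ hx hy =>
    obtain ⟨i, hi⟩ := hx
    obtain ⟨j, hj⟩ := hy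
    obtain ⟨k, hik, hjk⟩ := hd i j
    exact ⟨k, Submodule.add_mem _ (chIn_mono hik hi) (chIn_mono hjk hj)⟩
  | smul r x _ hx => obtain ⟨i, hi⟩ := hx; exact ⟨i, Submodule.smul_mem _ _ hi⟩

theorem mem_chIn_empty {x : Ch X} (hx : x ∈ chIn (∅ : Set X)) : x = nlc x • nl := by
  refine eq_on_supported (f := LinearMap.id)
    (g := LinearMap.toSpanSingleton ℚ _ nl ∘ₗ nlc) (fun a ha => ?_) hx
  have h0 : a.1 = 0 := by
    by_contra h
    obtain ⟨m, hm⟩ := Nat.exists_eq_succ_of_ne_zero h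
    have z : Sx a.1 := stdSimplex.vertex ⟨0, by omega⟩
    exact ha z
  simp [nlc_bas, h0, bas_eq_nl a h0]

/-- Distributivity of supports. -/
theorem mem_chIn_distrib {A B P : Set X} {x : Ch X} (hx : x ∈ chIn A) (h : x ∈ chIn B ⊔ chIn P) :
    ∃ y ∈ chIn (A ∩ B), ∃ p ∈ chIn (A ∩ P), x = y + p := by
  have key : x ∈ Finsupp.supported ℚ ℚ ({a : Simp X | ∀ z, a.2 z ∈ A ∩ B} ∪
      {a : Simp X | ∀ z, a.2 z ∈ A ∩ P}) := by
    rw [chIn, chIn, ← Finsupp.supported_union] at h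
    intro a ha
    rcases h ha with h' | h'
    · exact Or.inl fun z => ⟨hx ha z, h' z⟩
    · exact Or.inr fun z => ⟨hx ha z, h' z⟩
  rw [Finsupp.supported_union] at key
  obtain ⟨y, hy, p, hp, rfl⟩ := Submodule.mem_sup.1 key
  exact ⟨y, hy, p, hp, rfl⟩

/-! #### Relative cycles and boundaries -/

/-- Cycles of `Q` relative to `P`. -/
def relZ (Q P : Set X) : Submodule ℚ (Ch X) := chIn Q ⊓ (chIn P).comap dd

/-- Boundaries of `Q` relative to `P`. -/
def relB (Q P : Set X) : Submodule ℚ (Ch X) := (chIn Q).map dd ⊔ chIn (Q ∩ P)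

theorem mem_relB {Q P : Set X} {z : Ch X} :
    z ∈ relB Q P ↔ ∃ y ∈ chIn Q, ∃ e ∈ chIn (Q ∩ P), z = dd y + e := by
  rw [relB, Submodule.mem_sup]
  constructor
  · rintro ⟨_, ⟨y, hy, rfl⟩, e, he, rfl⟩; exact ⟨y, hy, e, he, rfl⟩
  · rintro ⟨y, hy, e, he, rfl⟩; exact ⟨_, ⟨y, hy, rfl⟩, e, he, rfl⟩

theorem dd_mem_relB {Q P : Set X} {y : Ch X} (hy : y ∈ chIn Q) : dd y ∈ relB Q P :=
  mem_relB.2 ⟨y, hy, 0, Submodule.zero_mem _, by simp⟩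

theorem chIn_le_relB {Q P : Set X} {e : Ch X} (hQ : e ∈ chIn Q) (hP : e ∈ chIn P) :
    e ∈ relB Q P := mem_relB.2 ⟨0, Submodule.zero_mem _, e, mem_chIn_inter hQ hP, by simp⟩

theorem relB_le_relZ {Q P : Set X} : relB Q P ≤ relZ Q P := by
  intro z hz
  obtain ⟨y, hy, e, he, rfl⟩ := mem_relB.1 hz
  refine ⟨Submodule.add_mem _ (dd_mem_chIn hy) (chIn_mono Set.inter_subset_left he), ?_⟩
  change dd _ ∈ chIn P
  rw [map_add, dd_dd, zero_add]
  exact dd_mem_chIn (chIn_mono Set.inter_subset_right he)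

theorem mem_chIn_univ (x : Ch X) : x ∈ chIn (Set.univ : Set X) := by rw [chIn_univ]; trivial

theorem relB_mono {Q Q' P P' : Set X} (hQ : Q ⊆ Q') (hP : P ⊆ P') : relB Q P ≤ relB Q' P' := by
  intro z hz
  obtain ⟨y, hy, e, he, rfl⟩ := mem_relB.1 hz
  exact mem_relB.2 ⟨y, chIn_mono hQ hy, e, chIn_mono (Set.inter_subset_inter hQ hP) he, rfl⟩

theorem relZ_mono {Q Q' P P' : Set X} (hQ : Q ⊆ Q') (hP : P ⊆ P') : relZ Q P ≤ relZ Q' P' :=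
  fun _ hz => ⟨chIn_mono hQ hz.1, chIn_mono hP hz.2⟩

theorem push_mem_relZ {Q P : Set X} {Q' P' : Set Y} (f : C(X, Y)) (hQ : ∀ x ∈ Q, f x ∈ Q')
    (hP : ∀ x ∈ Q, x ∈ P → f x ∈ P') {z : Ch X} (hz : z ∈ relZ Q P) : push f z ∈ relZ Q' P' := by
  refine ⟨push_mem_chIn f hQ hz.1, ?_⟩
  change dd _ ∈ chIn P'
  rw [← push_dd]
  exact push_mem_chIn (P := Q ∩ P) f (fun x hx => hP x hx.1 hx.2)
    (mem_chIn_inter (dd_mem_chIn hz.1) hz.2)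

theorem push_mem_relB {Q P : Set X} {Q' P' : Set Y} (f : C(X, Y)) (hQ : ∀ x ∈ Q, f x ∈ Q')
    (hP : ∀ x ∈ Q, x ∈ P → f x ∈ P') {z : Ch X} (hz : z ∈ relB Q P) : push f z ∈ relB Q' P' := by
  obtain ⟨y, hy, e, he, rfl⟩ := mem_relB.1 hz
  refine mem_relB.2 ⟨push f y, push_mem_chIn f hQ hy, push f e,
    push_mem_chIn (P := Q ∩ P) (Q := Q' ∩ P') f
      (fun x hx => Set.mem_inter (hQ x hx.1) (hP x hx.1 hx.2)) he, ?_⟩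
  rw [map_add, push_dd]

theorem dd_proj_zero (x : Ch X) : dd (proj 0 x) = 0 := by
  have h := mem_chIn_empty (x := proj 0 x) (by
    refine supported_le_comap (S := Set.univ) (f := proj 0) (fun a _ => ?_) x (by simp)
    rw [proj_bas]
    split_ifs with h
    · rw [bas_eq_nl a h]; exact nl_mem_chIn _
    · exact Submodule.zero_mem _)
  rw [h, map_smul, dd_nl, smul_zero]

theorem proj_mem_relZ (m : ℕ) {Q P : Set X} {z : Ch X} (hz : z ∈ relZ Q P) : proj m z ∈ relZ Q P := by
  refine ⟨proj_mem_chIn _ hz.1, ?_⟩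
  change dd _ ∈ chIn P
  cases m with
  | zero => rw [dd_proj_zero]; exact Submodule.zero_mem _
  | succ m => rw [← proj_dd]; exact proj_mem_chIn _ hz.2

theorem proj_mem_relB (m : ℕ) {Q P : Set X} {z : Ch X} (hz : z ∈ relB Q P) : proj m z ∈ relB Q P := by
  obtain ⟨y, hy, e, he, rfl⟩ := mem_relB.1 hz
  exact mem_relB.2 ⟨proj (m + 1) y, proj_mem_chIn _ hy, proj m e, proj_mem_chIn _ he, by
    rw [map_add, proj_dd]⟩

theorem excise_relZ {Q Q' P : Set X} (hQ : IsOpen Q) (hP : IsOpen P) (h1 : Q ⊆ Q')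
    (h2 : Q' ⊆ Q ∪ P) {z : Ch X} (hz : z ∈ relZ Q' P) : ∃ z₁ ∈ relZ Q P, z - z₁ ∈ relB Q' P := by
  obtain ⟨k, hk⟩ := exists_sub_mem hQ hP (chIn_mono h2 hz.1)
  obtain ⟨a, ha, b, hb, hab⟩ := Submodule.mem_sup.1 hk
  have hb' : b ∈ chIn Q' := by
    have : b = (sub ^ k) z - a := by rw [← hab]; abel
    rw [this]
    exact Submodule.sub_mem _ (sub_pow_mem_chIn _ hz.1) (chIn_mono h1 ha)
  refine ⟨a, ⟨ha, ?_⟩, ?_⟩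
  · change dd a ∈ chIn P
    have : a = (sub ^ k) z - b := by rw [← hab]; abel
    rw [this, map_sub, dd_sub_pow]
    exact Submodule.sub_mem _ (sub_pow_mem_chIn _ hz.2) (dd_mem_chIn hb)
  · refine mem_relB.2 ⟨subTk k z, subTk_mem_chIn _ hz.1, subTk k (dd z) + b,
      Submodule.add_mem _ (mem_chIn_inter (subTk_mem_chIn _ (dd_mem_chIn hz.1))
        (subTk_mem_chIn _ hz.2)) (mem_chIn_inter hb' hb), ?_⟩
    rw [dd_subTk, ← hab]; abel

theorem excise_relB {Q Q' P : Set X} (hQ : IsOpen Q) (hP : IsOpen P)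
    (h2 : Q' ⊆ Q ∪ P) {z : Ch X} (hzQ : z ∈ chIn Q) (hz : z ∈ relB Q' P) : z ∈ relB Q P := by
  obtain ⟨y, hy, e, he, rfl⟩ := mem_relB.1 hz
  obtain ⟨k, hk⟩ := exists_sub_mem hQ hP (chIn_mono h2 hy)
  obtain ⟨a, ha, b, hb, hab⟩ := Submodule.mem_sup.1 hk
  have heP : e ∈ chIn P := chIn_mono Set.inter_subset_right he
  set z := dd y + e with hzdef
  have hdz : dd z = dd e := by rw [hzdef, map_add, dd_dd, zero_add]
  have h3 : (sub ^ k) z = dd a + (dd b + (sub ^ k) e) := by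
    rw [hzdef, map_add, ← dd_sub_pow, ← hab, map_add]; abel
  have h4 : dd b + (sub ^ k) e ∈ chIn Q := by
    have : dd b + (sub ^ k) e = (sub ^ k) z - dd a := by rw [h3]; abel
    rw [this]
    exact Submodule.sub_mem _ (sub_pow_mem_chIn _ hzQ) (dd_mem_chIn ha)
  refine mem_relB.2 ⟨a + subTk k z, Submodule.add_mem _ ha (subTk_mem_chIn _ hzQ),
    (dd b + (sub ^ k) e) + subTk k (dd z), Submodule.add_mem _
      (mem_chIn_inter h4 (Submodule.add_mem _ (dd_mem_chIn hb) (sub_pow_mem_chIn _ heP)))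
      (mem_chIn_inter (subTk_mem_chIn _ (dd_mem_chIn hzQ))
        (subTk_mem_chIn _ (by rw [hdz]; exact dd_mem_chIn heP))), ?_⟩
  rw [map_add, dd_subTk, h3]; abel

/-! #### Lifting along embeddings -/

theorem push_injective {f : C(X, Y)} (hf : Function.Injective f) : Function.Injective (push f) := by
  have h : (push f : Ch X → Ch Y) = Finsupp.mapDomain fun a => ⟨a.1, f.comp a.2⟩ := by
    funext x
    have : push f = Finsupp.lmapDomain ℚ ℚ fun a : Simp X => (⟨a.1, f.comp a.2⟩ : Simp Y) :=
      lin_ext fun a => by rw [push_bas]; simp [bas]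
    rw [this]; rfl
  rw [h]
  refine Finsupp.mapDomain_injective fun a b hab => ?_
  obtain ⟨m, s⟩ := a
  obtain ⟨m', s'⟩ := b
  simp only [Sigma.mk.injEq] at hab
  obtain ⟨rfl, hab⟩ := hab
  congr 1
  ext x
  exact hf (congrArg (fun g : C(Sx m, Y) => g x) (eq_of_heq hab))

theorem exists_lift_emb {f : C(X, Y)} (hf : IsEmbedding f) {Q : Set X} {c : Ch Y}
    (hc : c ∈ chIn (f '' Q)) : ∃ c' ∈ chIn Q, push f c' = c := by
  have h : chIn (f '' Q) ≤ (chIn Q).map (push f) := by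
    intro x hx
    refine supported_le_comap (f := LinearMap.id) (Q := (chIn Q).map (push f))
      (fun a ha => ?_) x hx
    choose g hg using ha
    have hgc : Continuous g := by
      rw [hf.continuous_iff]
      have : f ∘ g = a.2 := funext fun z => (hg z).2
      rw [this]; exact a.2.continuous
    refine ⟨bas ⟨a.1, ⟨g, hgc⟩⟩, bas_mem_chIn fun z => (hg z).1, ?_⟩
    rw [push_bas]
    change bas _ = bas a
    congr 1
    exact simp_ext rfl fun z => (hg z).2
  obtain ⟨c', h1, h2⟩ := h hc
  exact ⟨c', h1, h2⟩

theorem mem_chIn_of_push {f : C(X, Y)} (hf : IsEmbedding f) {P : Set Y} {c : Ch X}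
    (hc : push f c ∈ chIn P) : c ∈ chIn (f ⁻¹' P) := by
  have h1 : push f c ∈ chIn (Set.range f) :=
    push_mem_chIn f (fun x _ => Set.mem_range_self x) (mem_chIn_univ c)
  have h2 := mem_chIn_inter hc h1
  rw [← Set.image_preimage_eq_inter_range] at h2
  obtain ⟨c', h3, h4⟩ := exists_lift_emb hf h2
  rwa [← push_injective hf.injective h4]

theorem lift_relZ {f : C(X, Y)} (hf : IsEmbedding f) {Q : Set X} {P : Set Y} {z : Ch Y}
    (hz : z ∈ relZ (f '' Q) P) : ∃ z' ∈ relZ Q (f ⁻¹' P), push f z' = z := by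
  obtain ⟨z', h1, rfl⟩ := exists_lift_emb hf hz.1
  refine ⟨z', ⟨h1, ?_⟩, rfl⟩
  refine mem_chIn_of_push hf ?_
  rw [push_dd]; exact hz.2

theorem lift_relB {f : C(X, Y)} (hf : IsEmbedding f) {Q : Set X} {P : Set Y} {z : Ch X}
    (hz : push f z ∈ relB (f '' Q) P) : z ∈ relB Q (f ⁻¹' P) := by
  obtain ⟨y, hy, e, he, h⟩ := mem_relB.1 hz
  obtain ⟨y', hy', rfl⟩ := exists_lift_emb hf hy
  obtain ⟨e', he', rfl⟩ := exists_lift_emb hf (chIn_mono Set.inter_subset_left he)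
  refine mem_relB.2 ⟨y', hy', e', mem_chIn_inter he'
    (mem_chIn_of_push hf (chIn_mono Set.inter_subset_right he)), ?_⟩
  refine push_injective hf.injective ?_
  rw [h, map_add, push_dd]

/-! #### Contractions -/

/-- The cone on a constant chain. -/
def cone (p : Y) : Ch X →ₗ[ℚ] Ch Y := lin fun a => bas ⟨a.1 + 1, ContinuousMap.const _ p⟩

theorem cone_rz (p : Y) {K : Type} [TopologicalSpace K] [Cvx K] (s : C(K, X)) (x : LCh K) :
    cone p (rz s x) = rz (ContinuousMap.const (Sx 1) p)
      (cons (stdSimplex.vertex 0) (lmap (fun _ => stdSimplex.vertex 0) x)) := by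
  have : cone p ∘ₗ rz s = rz (ContinuousMap.const (Sx 1) p) ∘ₗ cons (stdSimplex.vertex 0) ∘ₗ
      lmap (fun _ : K => (stdSimplex.vertex 0 : Sx 1)) := lin_ext fun l => by
    simp only [LinearMap.comp_apply, rz_bas, lmap_bas, cons_bas, cone, lin_bas]
    congr 1
    refine simp_ext (by simp [simp]) fun x => rfl
  exact LinearMap.congr_fun this x

theorem dd_cone (p : Y) (c : Ch X) : dd (cone p c) = push (ContinuousMap.const X p) c - cone p (dd c) := by
  have : dd ∘ₗ cone p = push (ContinuousMap.const X p) - cone p ∘ₗ dd := op_ext fun m s => by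
    simp only [LinearMap.comp_apply, LinearMap.sub_apply, dd_rz]
    rw [cone_rz, cone_rz, dd_rz, bd_cons, map_sub, lmap_bd, push_rz]
    congr 1
    exact (rz_comp (ContinuousMap.const (Sx 1) p) (ContinuousMap.const (Sx m) (stdSimplex.vertex 0))
      (fun k t x => Subsingleton.elim _ _) _).symm
  exact LinearMap.congr_fun this c

theorem cone_mem_chIn {p : Y} {P : Set Y} (hp : p ∈ P) (c : Ch X) : cone p c ∈ chIn P :=
  supported_le_comap (S := Set.univ) (f := cone p) (fun a _ => by
    rw [cone, lin_bas]; exact bas_mem_chIn fun _ => hp) c (by simp)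

theorem cone_mem_deg (p : Y) {m : ℕ} {c : Ch X} (hc : c ∈ deg X m) : cone p c ∈ deg Y (m + 1) :=
  supported_le_comap (f := cone p) (fun a ha => by
    rw [cone, lin_bas, ← show a.1 = m from ha]
    exact bas_mem_deg (⟨a.1 + 1, ContinuousMap.const _ p⟩ : Simp Y)) c hc

end Relative
end SingChain

namespace SingChain
open Cvx

/-! ### Local homology of Euclidean spaces -/

section Local

variable {X Y : Type} [TopologicalSpace X] [TopologicalSpace Y]

theorem sub_sub_pow_mem_relB (k : ℕ) {Q P : Set X} {z : Ch X} (hz : z ∈ relZ Q P) :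
    z - (sub ^ k) z ∈ relB Q P :=
  mem_relB.2 ⟨subTk k z, subTk_mem_chIn _ hz.1, subTk k (dd z),
    mem_chIn_inter (subTk_mem_chIn _ (dd_mem_chIn hz.1)) (subTk_mem_chIn _ hz.2), by
      rw [dd_subTk]; abel⟩

theorem mem_relB_of_sub_pow (k : ℕ) {Q P : Set X} {z : Ch X} (hz : z ∈ relZ Q P)
    (h : (sub ^ k) z ∈ relB Q P) : z ∈ relB Q P := by
  rw [← sub_add_cancel z ((sub ^ k) z)]
  exact Submodule.add_mem _ (sub_sub_pow_mem_relB k hz) h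

theorem hmt_sub_mem_relB {Q P : Set X} {Q' P' : Set Y} (h : C(X × I, Y))
    (hQ : ∀ x ∈ Q, ∀ t, h (x, t) ∈ Q') (hP : ∀ x ∈ Q, x ∈ P → ∀ t, h (x, t) ∈ P') {z : Ch X}
    (hz : z ∈ relZ Q P) : push (atT h 1) z - push (atT h 0) z ∈ relB Q' P' :=
  mem_relB.2 ⟨hmt h z, hmt_mem_chIn h hQ hz.1, hmt h (dd z),
    hmt_mem_chIn (P := Q ∩ P) (Q := Q' ∩ P') h
      (fun x hx t => Set.mem_inter (hQ x hx.1 t) (hP x hx.1 hx.2 t))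
      (mem_chIn_inter (dd_mem_chIn hz.1) hz.2), by rw [dd_hmt]; abel⟩

/-- The local homology at a point is spanned by one class, of degree `n`. -/
def LocAt (n : ℕ) (x : X) : Prop :=
  ∃ o ∈ relZ Set.univ {x}ᶜ, o ∈ deg X (n + 1) ∧
    ∀ z ∈ relZ Set.univ {x}ᶜ, ∃ c : ℚ, z - c • o ∈ relB Set.univ {x}ᶜ

theorem LocAt.map {n : ℕ} {x : X} (h : LocAt n x) {f : C(X, Y)} (hf : IsOpenEmbedding f)
    [T1Space Y] : LocAt n (f x) := by
  obtain ⟨o, ho, hd, hsp⟩ := h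
  have hP : ∀ p ∈ Set.univ, p ∈ ({x}ᶜ : Set X) → f p ∈ ({f x}ᶜ : Set Y) :=
    fun p _ hp hp' => hp (hf.injective hp')
  have hpre : f ⁻¹' {f x}ᶜ = {x}ᶜ := by
    ext p; simp [hf.injective.eq_iff]
  refine ⟨push f o, push_mem_relZ f (fun _ _ => Set.mem_univ _) hP ho, push_mem_deg f hd, fun z hz => ?_⟩
  obtain ⟨z₁, hz₁, hzz⟩ := excise_relZ (Q := Set.range f) hf.isOpen_range isOpen_compl_singleton
    (Set.subset_univ _) (fun y _ => by
      by_cases hy : y = f x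
      · exact Or.inl (hy ▸ Set.mem_range_self x)
      · exact Or.inr hy) hz
  rw [← Set.image_univ] at hz₁
  obtain ⟨z', hz', rfl⟩ := lift_relZ hf.isEmbedding hz₁
  rw [hpre] at hz'
  obtain ⟨c, hc⟩ := hsp z' hz'
  refine ⟨c, ?_⟩
  have := Submodule.add_mem _ hzz (push_mem_relB f (fun _ _ => Set.mem_univ _) hP hc)
  rwa [map_sub, map_smul, sub_add_sub_cancel] at this

section Contraction

variable {E : Type} [AddCommGroup E] [Module ℝ E] [TopologicalSpace E] [ContinuousAdd E]
  [ContinuousSMul ℝ E]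

/-- The straight line contraction to `p`. -/
def slh (p : E) : C(E × I, E) :=
  ⟨fun x => (1 - (x.2 : ℝ)) • x.1 + (x.2 : ℝ) • p, by fun_prop⟩

theorem slh_apply (p x : E) (t : I) : slh p (x, t) = (1 - (t : ℝ)) • x + (t : ℝ) • p := rfl

/-- The contracting chain homotopy with centre `p`. -/
def ctr (p : E) : Ch E →ₗ[ℚ] Ch E := cone p - hmt (slh p)

theorem dd_ctr (p : E) (c : Ch E) : dd (ctr p c) = c - ctr p (dd c) := by
  have h0 : atT (slh p) 0 = ContinuousMap.id E := by ext x; simp [slh_apply]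
  have h1 : atT (slh p) 1 = ContinuousMap.const E p := by ext x; simp [slh_apply]
  simp only [ctr, LinearMap.sub_apply, map_sub, dd_cone, dd_hmt, h0, h1, push_id]
  abel

theorem ctr_mem_deg (p : E) {m : ℕ} {c : Ch E} (hc : c ∈ deg E m) : ctr p c ∈ deg E (m + 1) :=
  Submodule.sub_mem _ (cone_mem_deg p hc) (hmt_mem_deg _ hc)

theorem ctr_mem_chIn {p : E} {A : Set E} (hp : p ∈ A)
    (hA : ∀ x ∈ A, ∀ t : I, (1 - (t : ℝ)) • x + (t : ℝ) • p ∈ A) {c : Ch E} (hc : c ∈ chIn A) :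
    ctr p c ∈ chIn A :=
  Submodule.sub_mem _ (cone_mem_chIn hp c) (hmt_mem_chIn _ hA hc)

theorem locAt_zero [Subsingleton E] : LocAt 0 (0 : E) := by
  have h0 : ({0}ᶜ : Set E) = ∅ := by ext x; simp [Subsingleton.elim x 0]
  rw [LocAt, h0]
  refine ⟨ctr 0 nl, ⟨mem_chIn_univ _, ?_⟩, ctr_mem_deg 0 nl_mem_deg, fun z hz => ⟨nlc (dd z), ?_⟩⟩
  · change dd _ ∈ chIn _
    rw [dd_ctr, dd_nl, map_zero, sub_zero]
    exact nl_mem_chIn _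
  · have h1 := dd_ctr 0 z
    rw [mem_chIn_empty hz.2, map_smul] at h1
    rw [← h1]
    exact dd_mem_relB (mem_chIn_univ _)

/-- The upper (`ε = 1`) and lower (`ε = -1`) parts of the punctured space. -/
def halfP (E : Type) [AddCommGroup E] (ε : ℝ) : Set (ℝ × E) := {p | 0 < ε * p.1 ∨ p.2 ≠ 0}

theorem isOpen_halfP [T1Space E] (ε : ℝ) : IsOpen (halfP E ε) :=
  have h : Continuous fun p : ℝ × E => ε * p.1 := by fun_prop
  (isOpen_lt continuous_const h).union (isOpen_compl_singleton.preimage continuous_snd)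

theorem ctr_mem_halfP {ε : ℝ} (hε : 0 < ε * ε) {c : Ch (ℝ × E)} (hc : c ∈ chIn (halfP E ε)) :
    ctr (ε, 0) c ∈ chIn (halfP E ε) := by
  refine ctr_mem_chIn (A := halfP E ε) (Or.inl hε) (fun x hx t => ?_) hc
  rcases eq_or_ne t 1 with rfl | ht
  · left; simpa using hε
  have ht1 : 0 < 1 - (t : ℝ) := by
    have := lt_of_le_of_ne t.2.2 (fun h => ht (Subtype.ext h))
    simpa using this
  rcases hx with hx | hx
  · left
    simp only [Prod.fst_add, Prod.smul_fst, smul_eq_mul]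
    nlinarith [mul_pos ht1 hx, mul_nonneg t.2.1 hε.le]
  · right
    simpa using ⟨ht1.ne', hx⟩

theorem locAt_succ [T1Space E] {n : ℕ} (h : LocAt n (0 : E)) : LocAt (n + 1) (0 : ℝ × E) := by
  obtain ⟨o, ho, hod, hsp⟩ := h
  have hA := isOpen_halfP (E := E) 1
  have hB := isOpen_halfP (E := E) (-1)
  have hu : ({0}ᶜ : Set (ℝ × E)) = halfP E 1 ∪ halfP E (-1) := by
    ext ⟨t, x⟩
    simp only [halfP, Set.mem_compl_iff, Set.mem_singleton_iff, Prod.mk_eq_zero, Set.mem_union,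
      Set.mem_ofPred_eq]
    by_cases hx : x = 0
    · rcases lt_trichotomy t 0 with ht | ht | ht
      · simp [ht, ht.ne]
      · simp [ht, hx]
      · simp [ht, ht.ne']
    · simp [hx]
  have hi : halfP E 1 ∩ halfP E (-1) = {p | p.2 ≠ 0} := by
    ext ⟨t, x⟩
    simp only [halfP, Set.mem_inter_iff, Set.mem_ofPred_eq]
    by_cases hx : x = 0
    · simp only [hx, ne_eq, not_true_eq_false, or_false, iff_false]; intro h; linarith [h.1, h.2]
    · simp [hx]
  have hctr : ∀ ε : ℝ, 0 < ε * ε → ∃ C : Ch (ℝ × E) →ₗ[ℚ] Ch (ℝ × E),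
      (∀ c, dd (C c) = c - C (dd c)) ∧ (∀ c ∈ chIn (halfP E ε), C c ∈ chIn (halfP E ε)) ∧
      ∀ m, ∀ c ∈ deg (ℝ × E) m, C c ∈ deg (ℝ × E) (m + 1) := fun ε hε =>
    ⟨ctr (ε, 0), dd_ctr _, fun c hc => ctr_mem_halfP hε hc, fun m c hc => ctr_mem_deg _ hc⟩
  obtain ⟨CA, dA, mA, cA⟩ := hctr 1 (by norm_num)
  obtain ⟨CB, dB, mB, cB⟩ := hctr (-1) (by norm_num)
  have lA : chIn (halfP E 1) ≤ chIn ({0}ᶜ : Set (ℝ × E)) :=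
    chIn_mono (hu ▸ Set.subset_union_left)
  have lB : chIn (halfP E (-1)) ≤ chIn ({0}ᶜ : Set (ℝ × E)) :=
    chIn_mono (hu ▸ Set.subset_union_right)
  have relBofCh : ∀ e ∈ chIn ({0}ᶜ : Set (ℝ × E)), e ∈ relB Set.univ ({0}ᶜ : Set (ℝ × E)) :=
    fun e he => chIn_le_relB (mem_chIn_univ _) he
  have iA : chIn {p : ℝ × E | p.2 ≠ 0} ≤ chIn (halfP E 1) :=
    chIn_mono (hi ▸ Set.inter_subset_left)
  have iB : chIn {p : ℝ × E | p.2 ≠ 0} ≤ chIn (halfP E (-1)) :=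
    chIn_mono (hi ▸ Set.inter_subset_right)
  let G : Ch (ℝ × E) →ₗ[ℚ] Ch (ℝ × E) := CA ∘ₗ (CA - CB)
  have hGdd : ∀ e ∈ chIn {p : ℝ × E | p.2 ≠ 0}, G (dd e) ∈ relB Set.univ ({0}ᶜ : Set (ℝ × E)) := by
    intro e he
    have h1 : (CA - CB) (dd e) = - dd ((CA - CB) e) := by
      simp only [LinearMap.sub_apply, map_sub, dA, dB]; abel
    have h2 : G (dd e) = dd (CA ((CA - CB) e)) - (CA - CB) e := by
      rw [dA, show G (dd e) = CA ((CA - CB) (dd e)) from rfl, h1, map_neg]; abel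
    rw [h2]
    exact Submodule.sub_mem _ (dd_mem_relB (mem_chIn_univ _)) (relBofCh _
      (Submodule.sub_mem _ (lA (mA _ (iA he))) (lB (mB _ (iB he)))))
  let i : C(E, ℝ × E) := ⟨fun x => (0, x), by fun_prop⟩
  have hiP : ∀ c ∈ chIn ({0}ᶜ : Set E), push i c ∈ chIn {p : ℝ × E | p.2 ≠ 0} :=
    fun c hc => push_mem_chIn i (fun x hx => hx) hc
  have hdG : ∀ c, dd c = 0 → dd (G c) = (CA - CB) c := by
    intro c hc
    have h1 : dd ((CA - CB) c) = 0 := by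
      simp only [LinearMap.sub_apply, map_sub, dA, dB, hc, map_zero, sub_zero, sub_self]
    rw [show G c = CA ((CA - CB) c) from rfl, dA, h1, map_zero, sub_zero]
  refine ⟨G (push i (dd o)), ⟨mem_chIn_univ _, ?_⟩, ?_, fun z hz => ?_⟩
  · change dd _ ∈ chIn _
    rw [hdG _ (by rw [push_dd, dd_dd])]
    have := hiP _ ho.2
    exact Submodule.sub_mem _ (lA (mA _ (iA this))) (lB (mB _ (iB this)))
  · have h1 : push i (dd o) ∈ deg (ℝ × E) n := push_mem_deg i (dd_mem_deg hod)
    exact cA _ _ (Submodule.sub_mem _ (cA _ _ h1) (cB _ _ h1))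
  · obtain ⟨k, hk⟩ := exists_sub_mem hA hB (hu ▸ hz.2)
    obtain ⟨a, ha, b, hb, hab⟩ := Submodule.mem_sup.1 hk
    have hzk := sub_sub_pow_mem_relB k hz
    set z' := (sub ^ k) z with hz'
    have hdz' : dd z' = a + b := by rw [hz', dd_sub_pow, hab]
    have hdb : dd b = - dd a := by
      have := dd_dd z'
      rw [hdz', map_add] at this
      exact eq_neg_of_add_eq_zero_right this
    have hcI : dd a ∈ chIn {p : ℝ × E | p.2 ≠ 0} := by
      rw [← hi]
      refine mem_chIn_inter (dd_mem_chIn ha) ?_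
      rw [← neg_neg (dd a), ← hdb]
      exact Submodule.neg_mem _ (dd_mem_chIn hb)
    have h1 : z' - G (dd a) ∈ relB Set.univ ({0}ᶜ : Set (ℝ × E)) := by
      set w := z' - CA a - CB b with hw
      have hdw : dd w = (CA - CB) (dd a) := by
        simp only [hw, map_sub, dA, dB, hdz', hdb, map_neg, LinearMap.sub_apply]; abel
      have h2 : w = dd (CA w) + G (dd a) := by
        rw [dA, hdw]; change w = w - CA ((CA - CB) (dd a)) + CA ((CA - CB) (dd a)); abel
      have h3 : z' - G (dd a) = dd (CA w) + (CA a + CB b) := by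
        rw [← sub_eq_iff_eq_add.2 h2, hw]; abel
      rw [h3]
      exact Submodule.add_mem _ (dd_mem_relB (mem_chIn_univ _))
        (relBofCh _ (Submodule.add_mem _ (lA (mA _ ha)) (lB (mB _ hb))))
    let k' : C((ℝ × E) × I, ℝ × E) := ⟨fun p => ((1 - (p.2 : ℝ)) * p.1.1, p.1.2), by fun_prop⟩
    set cb : Ch E := push ContinuousMap.snd (dd a) with hcb
    have hcbd : dd cb = 0 := by rw [hcb, push_dd, dd_dd]
    have hcbI : cb ∈ chIn ({0}ᶜ : Set E) := push_mem_chIn _ (fun x hx => hx) hcI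
    have hk' : push i cb - dd a = dd (hmt k' (dd a)) := by
      have e0 : atT k' 0 = ContinuousMap.id _ := by ext x <;> simp [k']
      have e1 : atT k' 1 = i.comp ContinuousMap.snd := by ext x <;> simp [k', i]
      rw [dd_hmt, dd_dd, map_zero, e0, e1, push_id, push_comp, sub_zero]
    have h4 : G (push i cb) - G (dd a) ∈ relB Set.univ ({0}ᶜ : Set (ℝ × E)) := by
      rw [← map_sub, hk']
      exact hGdd _ (hmt_mem_chIn k' (fun x hx t => hx) hcI)
    have hd0 : dd (ctr (0 : E) cb) = cb := by rw [dd_ctr, hcbd, map_zero, sub_zero]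
    obtain ⟨r, hr⟩ := hsp (ctr (0 : E) cb) ⟨mem_chIn_univ _, by
      change dd _ ∈ chIn _; rw [hd0]; exact hcbI⟩
    obtain ⟨y, -, e, he, hye⟩ := mem_relB.1 hr
    have h5 : cb - r • dd o = dd e := by
      have := congrArg dd hye
      rwa [map_sub, map_smul, hd0, map_add, dd_dd, zero_add] at this
    have h6 : G (push i cb) - r • G (push i (dd o)) ∈ relB Set.univ ({0}ᶜ : Set (ℝ × E)) := by
      rw [← map_smul, ← map_sub, ← map_smul, ← map_sub, h5, push_dd]
      exact hGdd _ (hiP _ (chIn_mono Set.inter_subset_right he))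
    refine ⟨r, ?_⟩
    have := Submodule.add_mem _ (Submodule.add_mem _ hzk h1)
      (Submodule.add_mem _ (Submodule.neg_mem _ h4) h6)
    convert this using 1
    abel

end Contraction

theorem locAt_pi : ∀ n : ℕ, LocAt n (0 : Fin n → ℝ)
  | 0 => locAt_zero
  | n + 1 => by
    let e := (Fin.consEquivL ℝ fun _ : Fin (n + 1) => ℝ).toHomeomorph
    have := (locAt_succ (locAt_pi n)).map (f := ⟨e, e.continuous⟩) e.isOpenEmbedding
    convert this
    ext i
    refine Fin.cases ?_ (fun j => ?_) i <;> simp [e]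

theorem locAt_euclidean (n : ℕ) (x : EuclideanSpace ℝ (Fin n)) : LocAt n x := by
  let e := (EuclideanSpace.equiv (Fin n) ℝ).symm.toHomeomorph.trans (Homeomorph.addRight x)
  have := (locAt_pi n).map (f := ⟨e, e.continuous⟩) e.isOpenEmbedding
  convert this
  simp [e]

end Local
end SingChain

namespace SingChain
open Cvx

/-! ### Classes detected by their local restrictions, fundamental classes -/

section Fundamental

variable {X Y : Type} [TopologicalSpace X] [TopologicalSpace Y]

theorem mem_chIn_iff {P : Set X} {c : Ch X} : c ∈ chIn P ↔ ∀ a ∈ c.support, ∀ z, a.2 z ∈ P :=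
  Iff.rfl

theorem exists_carrier (c : Ch X) : ∃ K : Set X, IsCompact K ∧ c ∈ chIn K ∧
    ∀ P, c ∈ chIn P → K ⊆ P := by
  refine ⟨⋃ a ∈ c.support, Set.range a.2, c.support.isCompact_biUnion fun a _ => ?_,
    fun a ha z => Set.mem_biUnion ha (Set.mem_range_self z), fun P hP => ?_⟩
  · have : CompactSpace (Sx a.1) := isCompact_iff_compactSpace.1 (isCompact_stdSimplex ℝ (Fin a.1))
    exact isCompact_range a.2.continuous
  · refine Set.iUnion₂_subset fun a ha => ?_
    rintro _ ⟨z, rfl⟩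
    exact hP ha z

theorem exists_nhds_relB [T2Space X] {x : X} {z : Ch X} (hz : z ∈ relB Set.univ {x}ᶜ) :
    ∃ N, IsOpen N ∧ x ∈ N ∧ ∀ S ⊆ N, z ∈ relB Set.univ Sᶜ := by
  obtain ⟨y, hy, e, he, rfl⟩ := mem_relB.1 hz
  obtain ⟨K, hK, heK, hmin⟩ := exists_carrier e
  refine ⟨Kᶜ, hK.isClosed.isOpen_compl, fun hx => (hmin _ he hx).2 rfl, fun S hS => ?_⟩
  refine mem_relB.2 ⟨y, hy, e, chIn_mono (fun p hp => ?_) heK, rfl⟩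
  exact Set.mem_inter (Set.mem_univ p) fun hpS => hS hpS hp

theorem mem_relB_deg {Q P : Set X} {m : ℕ} {z : Ch X} (hz : z ∈ relB Q P) (hd : z ∈ deg X m) :
    ∃ y ∈ chIn Q, y ∈ deg X (m + 1) ∧ ∃ e ∈ chIn (Q ∩ P), e ∈ deg X m ∧ z = dd y + e := by
  obtain ⟨y, hy, e, he, h⟩ := mem_relB.1 hz
  refine ⟨proj (m + 1) y, proj_mem_chIn _ hy, proj_mem_deg _ _, proj m e, proj_mem_chIn _ he,
    proj_mem_deg _ _, ?_⟩
  rw [← proj_dd, ← map_add, ← h, proj_of_mem_deg hd]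

theorem LocAt.mem_relB {n m : ℕ} {x : X} (h : LocAt n x) (hm : m ≠ n + 1) {z : Ch X}
    (hz : z ∈ relZ Set.univ {x}ᶜ) (hd : z ∈ deg X m) : z ∈ relB Set.univ {x}ᶜ := by
  obtain ⟨o, ho, hod, hsp⟩ := h
  obtain ⟨c, hc⟩ := hsp z hz
  have := proj_mem_relB m hc
  rwa [map_sub, map_smul, proj_of_mem_deg hd, proj_of_mem_deg_ne (by omega) hod, smul_zero,
    sub_zero] at this

/-- Relative classes along `K` of degree at least `n` are detected pointwise. -/
def Det (n : ℕ) (K : Set X) : Prop :=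
  ∀ m > n, ∀ z ∈ relZ Set.univ Kᶜ, z ∈ deg X m → (∀ x ∈ K, z ∈ relB Set.univ {x}ᶜ) →
    z ∈ relB Set.univ Kᶜ

theorem relB_compl_mono {K L : Set X} (h : L ⊆ K) : relB Set.univ Kᶜ ≤ relB Set.univ Lᶜ :=
  relB_mono subset_rfl (Set.compl_subset_compl.2 h)

theorem det_union {n : ℕ} (hl : ∀ x : X, LocAt n x) {A B : Set X} (hA : IsClosed A)
    (hB : IsClosed B) (dA : Det n A) (dB : Det n B) (dAB : Det n (A ∩ B)) : Det n (A ∪ B) := by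
  intro m hm z hz hd hx
  obtain ⟨yA, -, hyA, eA, heA, -, hzA⟩ := mem_relB_deg (dA m hm z
    (relZ_mono subset_rfl (Set.compl_subset_compl.2 Set.subset_union_left) hz) hd
    fun x h => hx x (Or.inl h)) hd
  obtain ⟨yB, -, hyB, eB, heB, -, hzB⟩ := mem_relB_deg (dB m hm z
    (relZ_mono subset_rfl (Set.compl_subset_compl.2 Set.subset_union_right) hz) hd
    fun x h => hx x (Or.inr h)) hd
  replace heA := chIn_mono Set.inter_subset_right heA
  replace heB := chIn_mono Set.inter_subset_right heB
  have hdy : dd (yA - yB) = eB - eA := by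
    rw [map_sub, sub_eq_sub_iff_add_eq_add, ← hzA, add_comm, ← hzB]
  have hy : yA - yB ∈ relZ Set.univ (A ∩ B)ᶜ := ⟨mem_chIn_univ _, by
    change dd _ ∈ chIn _
    rw [hdy]
    exact Submodule.sub_mem _ (chIn_mono (Set.compl_subset_compl.2 Set.inter_subset_right) heB)
      (chIn_mono (Set.compl_subset_compl.2 Set.inter_subset_left) heA)⟩
  have hyd := Submodule.sub_mem _ hyA hyB
  obtain ⟨q, -, g, hg, hqg⟩ := mem_relB.1 (dAB (m + 1) (by omega) _ hy hyd fun x h =>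
    (hl x).mem_relB (by omega) (relZ_mono subset_rfl
      (Set.compl_subset_compl.2 (Set.singleton_subset_iff.2 h)) hy) hyd)
  replace hg := chIn_mono Set.inter_subset_right hg
  rw [Set.compl_inter] at hg
  obtain ⟨k, hk⟩ := exists_sub_mem hA.isOpen_compl hB.isOpen_compl hg
  obtain ⟨gA, hgA, gB, hgB, hgab⟩ := Submodule.mem_sup.1 hk
  refine mem_relB_of_sub_pow k hz (mem_relB.2 ⟨(sub ^ k) yA - gA, mem_chIn_univ _,
    (sub ^ k) eA + dd gA, mem_chIn_inter (mem_chIn_univ _) ?_, ?_⟩)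
  · rw [Set.compl_union]
    refine mem_chIn_inter (Submodule.add_mem _ (sub_pow_mem_chIn _ heA) (dd_mem_chIn hgA)) ?_
    have : (sub ^ k) eA + dd gA = (sub ^ k) eB - dd gB := by
      have h1 := congrArg (fun c => dd ((sub ^ k) c)) hqg
      simp only [map_add, dd_sub_pow, hdy, dd_dd, map_zero, zero_add] at h1
      rw [← dd_sub_pow, ← hgab, map_sub, map_add] at h1
      rw [eq_sub_iff_add_eq, add_assoc, ← h1]; abel
    rw [this]
    exact Submodule.sub_mem _ (sub_pow_mem_chIn _ heB) (dd_mem_chIn hgB)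
  · rw [map_sub, dd_sub_pow, hzA, map_add]; abel

theorem det_empty {n : ℕ} : Det n (∅ : Set X) := fun _ _ z _ _ _ =>
  chIn_le_relB (mem_chIn_univ _) (by rw [Set.compl_empty]; exact mem_chIn_univ _)

theorem det_biUnion {n : ℕ} (hl : ∀ x : X, LocAt n x) (F : Set X → Prop)
    (hF : ∀ A B, F A → F B → F (A ∩ B)) (hc : ∀ A, F A → IsClosed A) (hd : ∀ A, F A → Det n A)
    {ι : Type} (s : Finset ι) : ∀ C : ι → Set X, (∀ i ∈ s, F (C i)) → Det n (⋃ i ∈ s, C i) := by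
  classical
  induction s using Finset.induction_on with
  | empty => intro C _; simpa using det_empty
  | insert i s hi ih =>
    intro C hC
    have hC' : ∀ j ∈ s, F (C j) := fun j hj => hC j (Finset.mem_insert_of_mem hj)
    have hCi := hC i (Finset.mem_insert_self i s)
    rw [Finset.set_biUnion_insert]
    refine det_union hl (hc _ hCi) (s.finite_toSet.isClosed_biUnion fun j hj => hc _ (hC' j hj))
      (hd _ hCi) (ih C hC') ?_
    rw [Set.inter_iUnion₂]
    exact ih _ fun j hj => hF _ _ hCi (hC' j hj)

variable {E : Type} [NormedAddCommGroup E] [NormedSpace ℝ E]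

theorem relB_convex_of_point [T2Space X] {φ : C(E, X)} (hφ : IsOpenEmbedding φ) {C : Set E}
    (hC : IsCompact C) (hcv : Convex ℝ C) {x : E} (hx : x ∈ C) {z : Ch X}
    (hz : z ∈ relZ Set.univ (φ '' C)ᶜ) (hzx : z ∈ relB Set.univ {φ x}ᶜ) :
    z ∈ relB Set.univ (φ '' C)ᶜ := by
  have hopen : IsOpen (φ '' C)ᶜ := (hC.image φ.continuous).isClosed.isOpen_compl
  obtain ⟨z₁, hz₁, hzz⟩ := excise_relZ (Q := Set.range φ) hφ.isOpen_range hopen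
    (Set.subset_univ _) (fun y _ => by
      by_cases hy : y ∈ φ '' C
      · exact Or.inl (Set.image_subset_range _ _ hy)
      · exact Or.inr hy) hz
  rw [← Set.image_univ] at hz₁
  obtain ⟨z', hz', rfl⟩ := lift_relZ hφ.isEmbedding hz₁
  rw [Set.preimage_compl, Set.preimage_image_eq _ hφ.injective] at hz'
  have h1 : push φ z' ∈ relB Set.univ {φ x}ᶜ := by
    have := Submodule.sub_mem _ hzx (relB_compl_mono
      (Set.singleton_subset_iff.2 (Set.mem_image_of_mem φ hx)) hzz)
    rwa [sub_sub_cancel] at this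
  have h2 : push φ z' ∈ relB (φ '' Set.univ) {φ x}ᶜ :=
    excise_relB (hφ.isOpenMap _ isOpen_univ) isOpen_compl_singleton (fun y _ => by
      by_cases hy : y = φ x
      · exact Or.inl (hy ▸ Set.mem_image_of_mem φ trivial)
      · exact Or.inr hy) hz₁.1 h1
  have h3 := lift_relB hφ.isEmbedding h2
  rw [Set.preimage_compl, ← Set.image_singleton, Set.preimage_image_eq _ hφ.injective] at h3
  obtain ⟨y, -, e, he, hye⟩ := mem_relB.1 h3
  obtain ⟨K, hK, heK, hmin⟩ := exists_carrier e
  have hxK : x ∈ Kᶜ := fun h => (hmin _ he h).2 rfl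
  obtain ⟨δ, hδ, hball⟩ := Metric.isOpen_iff.1 hK.isClosed.isOpen_compl x hxK
  obtain ⟨R, hR⟩ := hC.isBounded.subset_closedBall x
  have hR0 : 0 ≤ R := by simpa using hR hx
  let d : C(E × I, E) := ⟨fun p => x + (1 + (p.2 : ℝ) * (R / δ)) • (p.1 - x), by fun_prop⟩
  have hdC : ∀ p ∈ Set.univ, p ∈ Cᶜ → ∀ t, d (p, t) ∈ Cᶜ := by
    intro p _ hp t ht
    apply hp
    have hl : 1 ≤ 1 + (t : ℝ) * (R / δ) := by
      have := mul_nonneg t.2.1 (div_nonneg hR0 hδ.le); linarith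
    set l := 1 + (t : ℝ) * (R / δ)
    have hl0 : l ≠ 0 := by linarith
    have := hcv hx ht (a := 1 - l⁻¹) (b := l⁻¹) (by
      have := inv_le_one_of_one_le₀ hl; linarith) (by positivity) (by ring)
    convert this using 1
    change p = (1 - l⁻¹) • x + l⁻¹ • (x + l • (p - x))
    rw [smul_add, smul_smul, inv_mul_cancel₀ hl0, sub_smul, one_smul, one_smul]
    abel
  have hdK : ∀ p ∈ K, atT d 1 p ∈ Cᶜ := by
    intro p hp hpC
    have hpδ : δ ≤ ‖p - x‖ := by
      by_contra h
      exact hball (by rw [Metric.mem_ball, dist_eq_norm]; linarith) hp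
    have := hR hpC
    rw [atT_apply, Metric.mem_closedBall, dist_eq_norm] at this
    simp only [d, ContinuousMap.coe_mk, Set.Icc.coe_one, one_mul, add_sub_cancel_left,
      norm_smul, Real.norm_eq_abs] at this
    rw [abs_of_nonneg (by positivity)] at this
    have h5 : (1 + R / δ) * δ ≤ (1 + R / δ) * ‖p - x‖ := by gcongr
    have h6 : (1 + R / δ) * δ = δ + R := by field_simp
    linarith
  have h4 := hmt_sub_mem_relB d (Q := Set.univ) (P := Cᶜ) (Q' := Set.univ) (P' := Cᶜ)
    (fun _ _ _ => Set.mem_univ _) hdC hz'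
  have e0 : atT d 0 = ContinuousMap.id E := by ext1 p; simp [d]
  rw [e0, push_id] at h4
  have h5 : push (atT d 1) z' ∈ relB Set.univ Cᶜ := by
    rw [hye, map_add, push_dd]
    exact Submodule.add_mem _ (dd_mem_relB (mem_chIn_univ _))
      (chIn_le_relB (mem_chIn_univ _) (push_mem_chIn _ hdK heK))
  have h6 : z' ∈ relB Set.univ Cᶜ := by
    have := Submodule.sub_mem _ h5 h4
    rwa [sub_sub_cancel] at this
  have h7 : push φ z' ∈ relB Set.univ (φ '' C)ᶜ :=
    push_mem_relB (P := Cᶜ) (P' := (φ '' C)ᶜ) φ (fun _ _ => Set.mem_univ _) (fun p _ hp hp' => hp (by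
      obtain ⟨q, hq, hqp⟩ := hp'
      rwa [← hφ.injective hqp])) h6
  rw [← sub_add_cancel z (push φ z')]
  exact Submodule.add_mem _ hzz h7

theorem det_of_convex [T2Space X] {φ : C(E, X)} (hφ : IsOpenEmbedding φ) {C : Set E}
    (hC : IsCompact C) (hcv : Convex ℝ C) (n : ℕ) : Det n (φ '' C) := by
  intro m hm z hz hd hx
  rcases C.eq_empty_or_nonempty with rfl | ⟨x, hxC⟩
  · rw [Set.image_empty]
    exact det_empty m hm z (by rwa [Set.image_empty] at hz) hd (by simp)
  · exact relB_convex_of_point hφ hC hcv hxC hz (hx _ (Set.mem_image_of_mem φ hxC))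

theorem det_of_chart [T2Space X] [ProperSpace E] {n : ℕ} (hl : ∀ x : X, LocAt n x) {φ : C(E, X)}
    (hφ : IsOpenEmbedding φ) {K : Set X} (hK : IsCompact K) (hKφ : K ⊆ Set.range φ) : Det n K := by
  intro m hm z hz hd hx
  have key : ∀ x ∈ K, ∃ B : Set E, IsCompact B ∧ Convex ℝ B ∧ φ '' B ∈ 𝓝 x ∧
      z ∈ relB Set.univ (φ '' B)ᶜ ∧ ∀ y ∈ φ '' B, z ∈ relB Set.univ {y}ᶜ := by
    intro x hxK
    obtain ⟨N, hN, hxN, hS⟩ := exists_nhds_relB (hx x hxK)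
    obtain ⟨p, rfl⟩ := hKφ hxK
    obtain ⟨ε, hε, hb⟩ := Metric.nhds_basis_closedBall.mem_iff.1
      ((hN.preimage φ.continuous).mem_nhds (show p ∈ φ ⁻¹' N from hxN))
    have hBN : φ '' Metric.closedBall p ε ⊆ N := Set.image_subset_iff.2 hb
    exact ⟨_, isCompact_closedBall p ε, convex_closedBall p ε,
      hφ.isOpenMap.image_mem_nhds (Metric.closedBall_mem_nhds p hε), hS _ hBN,
      fun y hy => hS _ (Set.singleton_subset_iff.2 (hBN hy))⟩
  choose! B hBc hBv hBn hBz hBx using key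
  obtain ⟨t, htK, hcov⟩ := hK.elim_nhds_subcover (fun x => φ '' B x) hBn
  have hdet : Det n (⋃ x ∈ t, φ '' B x) := by
    refine det_biUnion hl (fun A => ∃ C : Set E, IsCompact C ∧ Convex ℝ C ∧ A = φ '' C) ?_ ?_ ?_ t
      (fun x => φ '' B x) fun x hx' => ⟨B x, hBc x (htK x hx'), hBv x (htK x hx'), rfl⟩
    · rintro _ _ ⟨C, hC, hCv, rfl⟩ ⟨D, hD, hDv, rfl⟩
      exact ⟨C ∩ D, hC.inter hD, hCv.inter hDv, (Set.image_inter hφ.injective).symm⟩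
    · rintro _ ⟨C, hC, -, rfl⟩; exact (hC.image φ.continuous).isClosed
    · rintro _ ⟨C, hC, hCv, rfl⟩; exact det_of_convex hφ hC hCv n
  refine relB_compl_mono hcov (hdet m hm z ⟨mem_chIn_univ _, ?_⟩ hd ?_)
  · change dd z ∈ chIn _
    rw [mem_chIn_iff]
    intro a ha p
    simp only [Set.mem_compl_iff, Set.mem_iUnion, not_exists]
    intro x hxt
    exact mem_chIn_iff.1 (relB_le_relZ (hBz x (htK x hxt))).2 a ha p
  · intro y hy
    simp only [Set.mem_iUnion] at hy
    obtain ⟨x, hxt, hy⟩ := hy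
    exact hBx x (htK x hxt) y hy

/-- Every point lies in the image of an open embedding of Euclidean space. -/
def HasCharts (n : ℕ) (X : Type) [TopologicalSpace X] : Prop :=
  ∀ x : X, ∃ φ : C(EuclideanSpace ℝ (Fin n), X), IsOpenEmbedding φ ∧ x ∈ Set.range φ

theorem HasCharts.locAt [T1Space X] {n : ℕ} (h : HasCharts n X) (x : X) : LocAt n x := by
  obtain ⟨φ, hφ, p, rfl⟩ := h x
  exact (locAt_euclidean n p).map hφ

theorem det_univ [T2Space X] [CompactSpace X] {n : ℕ} (h : HasCharts n X) :
    Det n (Set.univ : Set X) := by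
  have key : ∀ x : X, ∃ K ∈ 𝓝 x, IsCompact K ∧
      ∃ φ : C(EuclideanSpace ℝ (Fin n), X), IsOpenEmbedding φ ∧ K ⊆ Set.range φ := by
    intro x
    obtain ⟨φ, hφ, p, rfl⟩ := h x
    exact ⟨φ '' Metric.closedBall p 1,
      hφ.isOpenMap.image_mem_nhds (Metric.closedBall_mem_nhds p one_pos),
      (isCompact_closedBall p 1).image φ.continuous, φ, hφ, Set.image_subset_range _ _⟩
  choose K hK hKc hKφ using key
  obtain ⟨t, -, ht⟩ := isCompact_univ.elim_nhds_subcover K fun x _ => hK x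
  rw [← Set.univ_subset_iff.1 ht]
  refine det_biUnion h.locAt (fun A => IsCompact A ∧
    ∃ φ : C(EuclideanSpace ℝ (Fin n), X), IsOpenEmbedding φ ∧ A ⊆ Set.range φ) ?_ ?_ ?_ t K
    fun x _ => ⟨hKc x, hKφ x⟩
  · rintro A B ⟨hA, φ, hφ, hAφ⟩ ⟨hB, -⟩
    exact ⟨hA.inter hB, φ, hφ, Set.inter_subset_left.trans hAφ⟩
  · exact fun A hA => hA.1.isClosed
  · rintro A ⟨hA, φ, hφ, hAφ⟩; exact det_of_chart h.locAt hφ hA hAφ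

/-- A homologically nontrivial top-dimensional cycle is nontrivial at every point. -/
theorem not_mem_relB_of_not_boundary [T2Space X] [CompactSpace X] [ConnectedSpace X] {n : ℕ}
    (h : HasCharts n X) {α : Ch X} (hd : α ∈ deg X (n + 1)) (hα : dd α = 0)
    (hne : ∀ y, dd y ≠ α) (x : X) : α ∉ relB Set.univ {x}ᶜ := by
  have hZ : ∀ P : Set X, α ∈ relZ Set.univ P := fun P =>
    ⟨mem_chIn_univ _, by change dd α ∈ chIn P; rw [hα]; exact Submodule.zero_mem _⟩
  have h1 : ∃ x, α ∉ relB Set.univ ({x}ᶜ : Set X) := by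
    by_contra hcon
    push Not at hcon
    obtain ⟨y, -, -, e, he, hed, hye⟩ := mem_relB_deg
      (det_univ h (n + 1) (by omega) α (hZ _) hd fun x _ => hcon x) hd
    rw [Set.compl_univ, Set.inter_empty] at he
    have : e = 0 := by
      rw [mem_chIn_empty he, nlc_of_mem_deg (by omega) hed, zero_smul]
    rw [this, add_zero] at hye
    exact hne y hye.symm
  have hloc : ∀ x : X, ∃ N ∈ 𝓝 x, ∀ y ∈ N, ∀ y' ∈ N, α ∈ relB Set.univ ({y}ᶜ : Set X) →
      α ∈ relB Set.univ ({y'}ᶜ : Set X) := by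
    intro x
    obtain ⟨φ, hφ, p, rfl⟩ := h x
    refine ⟨φ '' Metric.closedBall p 1,
      hφ.isOpenMap.image_mem_nhds (Metric.closedBall_mem_nhds p one_pos), ?_⟩
    rintro _ ⟨q, hq, rfl⟩ y' hy' hα'
    exact relB_compl_mono (Set.singleton_subset_iff.2 hy') (relB_convex_of_point hφ
      (isCompact_closedBall p 1) (convex_closedBall p 1) hq (hZ _) hα')
  have hclopen : IsClopen {y : X | α ∈ relB Set.univ ({y}ᶜ : Set X)} := by
    refine ⟨⟨isOpen_iff_mem_nhds.2 fun y hy => ?_⟩, isOpen_iff_mem_nhds.2 fun y hy => ?_⟩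
    · obtain ⟨N, hN, hNy⟩ := hloc y
      filter_upwards [hN] with y' hy' hα'
      exact hy (hNy _ hy' _ (mem_of_mem_nhds hN) hα')
    · obtain ⟨N, hN, hNy⟩ := hloc y
      filter_upwards [hN] with y' hy'
      exact hNy _ (mem_of_mem_nhds hN) _ hy' hy
  obtain ⟨x₀, hx₀⟩ := h1
  rcases isClopen_iff.1 hclopen with h0 | h0
  · exact fun hx => (h0 ▸ hx : x ∈ (∅ : Set X))
  · exact (hx₀ (Set.eq_univ_iff_forall.1 h0 x₀)).elim

theorem LocAt.generated_by {n : ℕ} {x : X} (h : LocAt n x) {α : Ch X}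
    (hα : α ∈ relZ Set.univ {x}ᶜ) (hα' : α ∉ relB Set.univ {x}ᶜ) {z : Ch X}
    (hz : z ∈ relZ Set.univ {x}ᶜ) : ∃ c : ℚ, z - c • α ∈ relB Set.univ {x}ᶜ := by
  obtain ⟨o, -, -, hsp⟩ := h
  obtain ⟨a, ha⟩ := hsp α hα
  obtain ⟨b, hb⟩ := hsp z hz
  have ha0 : a ≠ 0 := by rintro rfl; exact hα' (by simpa using ha)
  refine ⟨b / a, ?_⟩
  have := Submodule.sub_mem _ hb (Submodule.smul_mem _ (b / a) ha)
  rwa [smul_sub, smul_smul, div_mul_cancel₀ _ ha0, sub_sub_sub_cancel_right] at this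

end Fundamental
end SingChain

namespace SingChain
open Cvx

/-! ### The Thom class of the diagonal -/

section Thom

variable {X : Type} [TopologicalSpace X]

theorem mv_biUnion (P : Set X → Prop) (h0 : P ∅)
    (hMV : ∀ A B, IsOpen A → IsOpen B → P A → P B → P (A ∩ B) → P (A ∪ B)) (F : Set X → Prop)
    (hF : ∀ A B, F A → F B → F (A ∩ B)) (hc : ∀ A, F A → IsOpen A) (hd : ∀ A, F A → P A)
    {ι : Type} (s : Finset ι) : ∀ C : ι → Set X, (∀ i ∈ s, F (C i)) → P (⋃ i ∈ s, C i) := by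
  classical
  induction s using Finset.induction_on with
  | empty => intro C _; simpa using h0
  | insert i s hi ih =>
    intro C hC
    have hC' : ∀ j ∈ s, F (C j) := fun j hj => hC j (Finset.mem_insert_of_mem hj)
    have hCi := hC i (Finset.mem_insert_self i s)
    rw [Finset.set_biUnion_insert]
    refine hMV _ _ (hc _ hCi) (isOpen_biUnion fun j hj => hc _ (hC' j hj))
      (hd _ hCi) (ih C hC') ?_
    rw [Set.inter_iUnion₂]
    exact ih _ fun j hj => hF _ _ hCi (hC' j hj)

/-- Mayer-Vietoris induction over the open sets of a compact manifold. -/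
theorem mv_induction [CompactSpace X] {n : ℕ} (h : HasCharts n X) (P : Set X → Prop) (h0 : P ∅)
    (hconv : ∀ φ : C(EuclideanSpace ℝ (Fin n), X), IsOpenEmbedding φ → ∀ V, IsOpen V →
      Convex ℝ V → P (φ '' V))
    (hMV : ∀ A B, IsOpen A → IsOpen B → P A → P B → P (A ∩ B) → P (A ∪ B))
    (hdir : ∀ (ι : Type) [Nonempty ι] (A : ι → Set X), (∀ i, IsOpen (A i)) →
      Directed (· ⊆ ·) A → (∀ i, P (A i)) → P (⋃ i, A i)) : P Set.univ := by
  have hchart : ∀ φ : C(EuclideanSpace ℝ (Fin n), X), IsOpenEmbedding φ → ∀ W, IsOpen W →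
      W ⊆ Set.range φ → P W := by
    intro φ hφ W hW hWφ
    let B : EuclideanSpace ℝ (Fin n) × ℝ → Set X := fun p => φ '' Metric.ball p.1 p.2
    let T := {p : EuclideanSpace ℝ (Fin n) × ℝ // B p ⊆ W}
    have hU : W = ⋃ s : Finset T, ⋃ p ∈ s, B p.1 := by
      refine Set.Subset.antisymm (fun x hx => ?_) (Set.iUnion_subset fun s =>
        Set.iUnion₂_subset fun p _ => p.2)
      obtain ⟨q, rfl⟩ := hWφ hx
      obtain ⟨ε, hε, hb⟩ := Metric.isOpen_iff.1 (hW.preimage φ.continuous) q hx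
      refine Set.mem_iUnion.2 ⟨{⟨(q, ε), Set.image_subset_iff.2 hb⟩}, ?_⟩
      simp only [Finset.mem_singleton, Set.iUnion_iUnion_eq_left]
      exact Set.mem_image_of_mem φ (Metric.mem_ball_self hε)
    have hB : ∀ p, IsOpen (B p) := fun p => hφ.isOpenMap _ Metric.isOpen_ball
    rw [hU]
    refine hdir _ _ (fun s => isOpen_biUnion fun p _ => hB _) ?_ fun s => ?_
    · classical
      refine directed_of_isDirected_le fun s t hst => ?_
      exact Set.biUnion_subset_biUnion_left hst
    · refine mv_biUnion P h0 hMV (fun A => ∃ C : Set (EuclideanSpace ℝ (Fin n)),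
        IsOpen C ∧ Convex ℝ C ∧ A = φ '' C) ?_ ?_ ?_ s (fun p => B p.1)
        fun p _ => ⟨_, Metric.isOpen_ball, convex_ball _ _, rfl⟩
      · rintro _ _ ⟨C, hC, hCv, rfl⟩ ⟨D, hD, hDv, rfl⟩
        exact ⟨C ∩ D, hC.inter hD, hCv.inter hDv, (Set.image_inter hφ.injective).symm⟩
      · rintro _ ⟨C, hC, -, rfl⟩; exact hφ.isOpenMap _ hC
      · rintro _ ⟨C, hC, hCv, rfl⟩; exact hconv φ hφ C hC hCv
  choose φ hφ hx using h
  obtain ⟨t, -, ht⟩ := isCompact_univ.elim_nhds_subcover (fun x => Set.range (φ x))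
    fun x _ => (hφ x).isOpen_range.mem_nhds (hx x)
  rw [← Set.univ_subset_iff.1 ht]
  refine mv_biUnion P h0 hMV (fun A => IsOpen A ∧
    ∃ φ : C(EuclideanSpace ℝ (Fin n), X), IsOpenEmbedding φ ∧ A ⊆ Set.range φ) ?_ ?_ ?_ t _
    fun x _ => ⟨(hφ x).isOpen_range, φ x, hφ x, subset_rfl⟩
  · rintro A B ⟨hA, φ, hφ, hAφ⟩ ⟨hB, -⟩
    exact ⟨hA.inter hB, φ, hφ, Set.inter_subset_left.trans hAφ⟩
  · exact fun A hA => hA.1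
  · rintro A ⟨hA, φ, hφ, hAφ⟩; exact hchart φ hφ A hA hAφ

/-- The inclusion of the slice over `x`. -/
def slice (x : X) : C(X, X × X) := (ContinuousMap.const X x).prodMk (ContinuousMap.id X)

@[simp] theorem slice_apply (x y : X) : slice x y = (x, y) := rfl

/-- Combinations of copies of `α` in the slices. -/
def slices (α : Ch X) : (X →₀ ℚ) →ₗ[ℚ] Ch (X × X) := lin fun x => push (slice x) α

/-- The sum of coefficients. -/
def coeffSum (X : Type) : (X →₀ ℚ) →ₗ[ℚ] ℚ := lin fun _ => 1

/-- Off-diagonal pairs. -/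
def offD (X : Type) : Set (X × X) := {p | p.1 ≠ p.2}

theorem isOpen_offD [T2Space X] : IsOpen (offD X) := isOpen_ne_fun continuous_fst continuous_snd

theorem slices_mem_deg {n : ℕ} {α : Ch X} (hd : α ∈ deg X n) (g : X →₀ ℚ) :
    slices α g ∈ deg (X × X) n :=
  supported_le_comap (f := slices α) (S := Set.univ)
    (fun a _ => by rw [slices, lin_bas]; exact push_mem_deg _ hd) g (by simp)

theorem dd_slices {α : Ch X} (hα : dd α = 0) (g : X →₀ ℚ) : dd (slices α g) = 0 := by
  have : dd ∘ₗ slices α = 0 := lin_ext fun x => by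
    simp only [LinearMap.comp_apply, slices, lin_bas, LinearMap.zero_apply]
    rw [← push_dd, hα, map_zero]
  exact LinearMap.congr_fun this g

theorem slices_mem_chIn (α : Ch X) {A : Set X} {g : X →₀ ℚ} (hg : g ∈ Finsupp.supported ℚ ℚ A) :
    slices α g ∈ chIn (A ×ˢ (Set.univ : Set X)) :=
  supported_le_comap (f := slices α) (fun a ha => by
    rw [slices, lin_bas]
    exact push_mem_chIn _ (fun x _ => Set.mk_mem_prod ha (Set.mem_univ x)) (mem_chIn_univ α)) g hg

theorem slices_mem_relZ {α : Ch X} (hα : dd α = 0) {A : Set X} {g : X →₀ ℚ}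
    (hg : g ∈ Finsupp.supported ℚ ℚ A) (P : Set (X × X)) :
    slices α g ∈ relZ (A ×ˢ (Set.univ : Set X)) P :=
  ⟨slices_mem_chIn α hg, by change dd _ ∈ chIn _; rw [dd_slices hα]; exact Submodule.zero_mem _⟩

/-- The Thom isomorphism over `A` in degrees up to `n`. -/
structure Thom (n : ℕ) (α : Ch X) (A : Set X) : Prop where
  low : ∀ m ≤ n, ∀ z ∈ relZ (A ×ˢ Set.univ) (offD X), z ∈ deg (X × X) m →
    z ∈ relB (A ×ˢ Set.univ) (offD X)
  gen : ∀ z ∈ relZ (A ×ˢ Set.univ) (offD X), z ∈ deg (X × X) (n + 1) →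
    ∃ g ∈ Finsupp.supported ℚ ℚ A, z - slices α g ∈ relB (A ×ˢ Set.univ) (offD X)
  inj : ∀ g ∈ Finsupp.supported ℚ ℚ A, slices α g ∈ relB (A ×ˢ Set.univ) (offD X) →
    coeffSum X g = 0

theorem thom_empty (n : ℕ) (α : Ch X) : Thom n α (∅ : Set X) := by
  have h : ∀ z ∈ relZ ((∅ : Set X) ×ˢ (Set.univ : Set X)) (offD X),
      z ∈ relB ((∅ : Set X) ×ˢ (Set.univ : Set X)) (offD X) := fun z hz =>
    chIn_le_relB hz.1 (chIn_mono (by simp) hz.1)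
  refine ⟨fun m _ z hz _ => h z hz, fun z hz _ => ⟨0, Submodule.zero_mem _, ?_⟩, fun g hg _ => ?_⟩
  · rw [map_zero, sub_zero]; exact h z hz
  · rw [Finsupp.supported_empty, Submodule.mem_bot] at hg
    rw [hg, map_zero]

theorem thom_split {n m : ℕ} {A B : Set X} {P : Set (X × X)} (hA : IsOpen A) (hB : IsOpen B)
    (hAB : ∀ z ∈ relZ ((A ∩ B) ×ˢ Set.univ) P, z ∈ deg (X × X) (m - 1) →
      z ∈ relB ((A ∩ B) ×ˢ Set.univ) P)
    {z : Ch (X × X)} (hz : z ∈ relZ ((A ∪ B) ×ˢ Set.univ) P) (hd : z ∈ deg (X × X) m) :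
    ∃ a ∈ relZ (A ×ˢ Set.univ) P, a ∈ deg (X × X) m ∧ ∃ b ∈ relZ (B ×ˢ Set.univ) P,
      b ∈ deg (X × X) m ∧ z - (a + b) ∈ relB ((A ∪ B) ×ˢ Set.univ) P := by
  have hz1 := hz.1
  rw [Set.union_prod] at hz1
  obtain ⟨k, hk⟩ := exists_sub_mem (hA.prod isOpen_univ) (hB.prod isOpen_univ) hz1
  obtain ⟨a, ha, b, hb, hab⟩ := Submodule.mem_sup.1 hk
  have hd' := sub_pow_mem_deg k m hd
  have hab' : proj m a + proj m b = (sub ^ k) z := by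
    rw [← map_add, hab, proj_of_mem_deg hd']
  replace ha := proj_mem_chIn m ha
  replace hb := proj_mem_chIn m hb
  have had := proj_mem_deg m a
  have hbd := proj_mem_deg m b
  generalize proj m a = a at *
  generalize proj m b = b at *
  have hdz : dd ((sub ^ k) z) ∈ chIn P := by rw [dd_sub_pow]; exact sub_pow_mem_chIn _ hz.2
  have hdb : dd b = dd ((sub ^ k) z) - dd a := by rw [← hab', map_add]; abel
  obtain ⟨c, hc, p, hp, hcp⟩ := mem_chIn_distrib (x := dd a) (dd_mem_chIn ha)
    (B := B ×ˢ Set.univ) (P := P) (Submodule.mem_sup.2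
      ⟨- dd b, Submodule.neg_mem _ (dd_mem_chIn hb), _, hdz, by rw [hdb]; abel⟩)
  have hcp' : dd a = proj (m - 1) c + proj (m - 1) p := by
    rw [← map_add, ← hcp, proj_of_mem_deg (dd_mem_deg had)]
  replace hc := proj_mem_chIn (m - 1) hc
  replace hp := proj_mem_chIn (m - 1) hp
  have hcd := proj_mem_deg (m - 1) c
  generalize proj (m - 1) c = c at *
  generalize proj (m - 1) p = p at *
  replace hp := chIn_mono Set.inter_subset_right hp
  rw [← Set.inter_prod] at hc
  have hdc : dd c = - dd p := by
    have := dd_dd a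
    rw [hcp', map_add] at this
    exact eq_neg_of_add_eq_zero_left this
  obtain ⟨e, he, q, hq, hceq⟩ := mem_relB.1 (hAB c ⟨hc, by
    change dd c ∈ chIn P; rw [hdc]; exact Submodule.neg_mem _ (dd_mem_chIn hp)⟩ hcd)
  replace hq := chIn_mono Set.inter_subset_right hq
  have heA : e ∈ chIn (A ×ˢ (Set.univ : Set X)) :=
    chIn_mono (Set.prod_mono Set.inter_subset_left subset_rfl) he
  have heB : e ∈ chIn (B ×ˢ (Set.univ : Set X)) :=
    chIn_mono (Set.prod_mono Set.inter_subset_right subset_rfl) he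
  have hae : a - e ∈ relZ (A ×ˢ Set.univ) P := ⟨Submodule.sub_mem _ ha heA, by
    change dd _ ∈ chIn P
    have : dd (a - e) = q + p := by rw [map_sub, hcp', hceq]; abel
    rw [this]
    exact Submodule.add_mem _ hq hp⟩
  have hbe : b + e ∈ relZ (B ×ˢ Set.univ) P := ⟨Submodule.add_mem _ hb heB, by
    change dd _ ∈ chIn P
    have : dd (b + e) = dd ((sub ^ k) z) - (q + p) := by rw [map_add, hdb, hcp', hceq]; abel
    rw [this]
    exact Submodule.sub_mem _ hdz (Submodule.add_mem _ hq hp)⟩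
  refine ⟨_, proj_mem_relZ m hae, proj_mem_deg _ _, _, proj_mem_relZ m hbe, proj_mem_deg _ _, ?_⟩
  have : proj m (a - e) + proj m (b + e) = (sub ^ k) z := by
    rw [← map_add, sub_add_add_cancel, hab', proj_of_mem_deg hd']
  rw [this]
  exact sub_sub_pow_mem_relB k hz

theorem thom_union {n : ℕ} {α : Ch X} (hd : α ∈ deg X (n + 1)) (hα : dd α = 0) {A B : Set X}
    (hA : IsOpen A) (hB : IsOpen B) (tA : Thom n α A) (tB : Thom n α B) (tAB : Thom n α (A ∩ B)) :
    Thom n α (A ∪ B) := by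
  have mA : relB (A ×ˢ (Set.univ : Set X)) (offD X) ≤ relB ((A ∪ B) ×ˢ Set.univ) (offD X) :=
    relB_mono (Set.prod_mono Set.subset_union_left subset_rfl) subset_rfl
  have mB : relB (B ×ˢ (Set.univ : Set X)) (offD X) ≤ relB ((A ∪ B) ×ˢ Set.univ) (offD X) :=
    relB_mono (Set.prod_mono Set.subset_union_right subset_rfl) subset_rfl
  have iA : relB ((A ∩ B) ×ˢ (Set.univ : Set X)) (offD X) ≤ relB (A ×ˢ Set.univ) (offD X) :=
    relB_mono (Set.prod_mono Set.inter_subset_left subset_rfl) subset_rfl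
  have iB : relB ((A ∩ B) ×ˢ (Set.univ : Set X)) (offD X) ≤ relB (B ×ˢ Set.univ) (offD X) :=
    relB_mono (Set.prod_mono Set.inter_subset_right subset_rfl) subset_rfl
  refine ⟨fun m hm z hz hzd => ?_, fun z hz hzd => ?_, fun g hg hgB => ?_⟩
  · obtain ⟨a, ha, had, b, hb, hbd, hab⟩ := thom_split (n := n) hA hB
      (fun z hz hzd => tAB.low _ (by omega) z hz hzd) hz hzd
    rw [← sub_add_cancel z (a + b)]
    exact Submodule.add_mem _ hab (Submodule.add_mem _ (mA (tA.low m hm a ha had))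
      (mB (tB.low m hm b hb hbd)))
  · obtain ⟨a, ha, had, b, hb, hbd, hab⟩ := thom_split (n := n) hA hB
      (fun z hz hzd => tAB.low _ (by omega) z hz hzd) hz hzd
    obtain ⟨g, hg, hag⟩ := tA.gen a ha had
    obtain ⟨g', hg', hbg⟩ := tB.gen b hb hbd
    refine ⟨g + g', Submodule.add_mem _ (Finsupp.supported_mono Set.subset_union_left hg)
      (Finsupp.supported_mono Set.subset_union_right hg'), ?_⟩
    have := Submodule.add_mem _ hab (Submodule.add_mem _ (mA hag) (mB hbg))
    convert this using 1
    rw [map_add]; abel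
  · rw [Finsupp.supported_union] at hg
    obtain ⟨gA, hgA, gB, hgB', rfl⟩ := Submodule.mem_sup.1 hg
    obtain ⟨y, hy, e, he, hye⟩ := mem_relB.1 hgB
    replace he := chIn_mono Set.inter_subset_right he
    rw [Set.union_prod] at hy
    obtain ⟨k, hk⟩ := exists_sub_mem (hA.prod isOpen_univ) (hB.prod isOpen_univ) hy
    obtain ⟨yA, hyA, yB, hyB, hyab⟩ := Submodule.mem_sup.1 hk
    have hsum : (sub ^ k) (slices α gA) - dd yA =
        - ((sub ^ k) (slices α gB) - dd yB) + (sub ^ k) e := by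
      have h1 := congrArg (sub ^ k) hye
      rw [map_add, map_add, map_add, ← dd_sub_pow, ← hyab, map_add] at h1
      rw [sub_eq_iff_eq_add, ← sub_eq_zero]
      rw [← sub_eq_zero] at h1
      rw [← h1]; abel
    have hwB : (sub ^ k) (slices α gB) - dd yB ∈ chIn (B ×ˢ (Set.univ : Set X)) :=
      Submodule.sub_mem _ (sub_pow_mem_chIn _ (slices_mem_chIn α hgB')) (dd_mem_chIn hyB)
    obtain ⟨c, hc, p, hp, hcp⟩ := mem_chIn_distrib (x := (sub ^ k) (slices α gA) - dd yA)
      (A := A ×ˢ Set.univ) (B := B ×ˢ Set.univ) (P := offD X)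
      (Submodule.sub_mem _ (sub_pow_mem_chIn _ (slices_mem_chIn α hgA)) (dd_mem_chIn hyA))
      (Submodule.mem_sup.2 ⟨_, Submodule.neg_mem _ hwB, _, sub_pow_mem_chIn _ he, hsum.symm⟩)
    rw [← Set.inter_prod] at hc
    have hdc : dd c = - dd p := by
      have := congrArg dd hcp
      rw [map_sub, dd_sub_pow, dd_slices hα, dd_dd, map_zero, sub_zero, map_add] at this
      exact eq_neg_of_add_eq_zero_left this.symm
    have hcZ : c ∈ relZ ((A ∩ B) ×ˢ Set.univ) (offD X) := ⟨hc, by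
      change dd c ∈ chIn _
      rw [hdc]
      exact Submodule.neg_mem _ (dd_mem_chIn (chIn_mono Set.inter_subset_right hp))⟩
    obtain ⟨h, hh, hch⟩ := tAB.gen _ (proj_mem_relZ (n + 1) hcZ) (proj_mem_deg _ _)
    have hhA := Finsupp.supported_mono (R := ℚ) (M := ℚ) (Set.inter_subset_left (t := B)) hh
    have hhB := Finsupp.supported_mono (R := ℚ) (M := ℚ) (Set.inter_subset_right (s := A)) hh
    have hproj : ∀ g, proj (n + 1) (slices α g) = slices α g := fun g =>
      proj_of_mem_deg (slices_mem_deg hd g)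
    have e1 : coeffSum X (gA - h) = 0 := by
      refine tA.inj _ (Submodule.sub_mem _ hgA hhA) ?_
      have h1 : slices α gA - c ∈ relB (A ×ˢ Set.univ) (offD X) := by
        have h2 := sub_sub_pow_mem_relB k (slices_mem_relZ hα hgA (offD X))
        have h3 : (sub ^ k) (slices α gA) - c = dd yA + p := by
          rw [sub_eq_iff_eq_add] at hcp ⊢; rw [hcp]; abel
        have := Submodule.add_mem _ h2 (mem_relB.2 ⟨yA, hyA, p, hp, h3⟩)
        rwa [sub_add_sub_cancel] at this
      have := Submodule.add_mem _ (proj_mem_relB (n + 1) h1) (iA hch)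
      rwa [map_sub, hproj, sub_add_sub_cancel, ← map_sub] at this
    have e2 : coeffSum X (gB + h) = 0 := by
      refine tB.inj _ (Submodule.add_mem _ hgB' hhB) ?_
      have h1 : slices α gB + c ∈ relB (B ×ˢ Set.univ) (offD X) := by
        have h2 := sub_sub_pow_mem_relB k (slices_mem_relZ hα hgB' (offD X))
        have h3 : (sub ^ k) (slices α gB) + c = dd yB + ((sub ^ k) e - p) := by
          rw [hcp] at hsum
          rw [← eq_sub_iff_add_eq] at hsum
          rw [hsum]; abel
        have hq : (sub ^ k) e - p ∈ chIn (B ×ˢ (Set.univ : Set X)) := by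
          have : (sub ^ k) e - p = ((sub ^ k) (slices α gB) - dd yB) + c := by
            rw [← eq_sub_iff_add_eq'] at h3; rw [h3]; abel
          rw [this]
          exact Submodule.add_mem _ hwB
            (chIn_mono (Set.prod_mono Set.inter_subset_right subset_rfl) hc)
        have := Submodule.add_mem _ h2 (mem_relB.2 ⟨yB, hyB, _, mem_chIn_inter hq
          (Submodule.sub_mem _ (sub_pow_mem_chIn _ he) (chIn_mono Set.inter_subset_right hp)), h3⟩)
        convert this using 1
        abel
      have := Submodule.sub_mem _ (proj_mem_relB (n + 1) h1) (iB hch)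
      rw [map_add, hproj] at this
      convert this using 1
      rw [map_add]; abel
    rw [map_sub] at e1
    rw [map_add] at e2 ⊢
    linarith

theorem thom_iUnion {n : ℕ} {α : Ch X} {ι : Type} [Nonempty ι] {A : ι → Set X}
    (hA : ∀ i, IsOpen (A i)) (hdir : Directed (· ⊆ ·) A) (hT : ∀ i, Thom n α (A i)) :
    Thom n α (⋃ i, A i) := by
  have hU : (⋃ i, A i) ×ˢ (Set.univ : Set X) = ⋃ i, A i ×ˢ (Set.univ : Set X) := Set.iUnion_prod_const
  have hU' : Directed (· ⊆ ·) fun i => A i ×ˢ (Set.univ : Set X) :=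
    fun i j => (hdir i j).imp fun _ h =>
      ⟨Set.prod_mono h.1 subset_rfl, Set.prod_mono h.2 subset_rfl⟩
  have key : ∀ z ∈ chIn ((⋃ i, A i) ×ˢ (Set.univ : Set X)), ∃ i, z ∈ chIn (A i ×ˢ Set.univ) :=
    fun z hz => mem_chIn_of_directed (fun i => (hA i).prod isOpen_univ) hU' (hU ▸ hz)
  have mono : ∀ i, relB (A i ×ˢ (Set.univ : Set X)) (offD X) ≤
      relB ((⋃ i, A i) ×ˢ Set.univ) (offD X) := fun i =>
    relB_mono (Set.prod_mono (Set.subset_iUnion A i) subset_rfl) subset_rfl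
  refine ⟨fun m hm z hz hzd => ?_, fun z hz hzd => ?_, fun g hg hgB => ?_⟩
  · obtain ⟨i, hi⟩ := key z hz.1
    exact mono i ((hT i).low m hm z ⟨hi, hz.2⟩ hzd)
  · obtain ⟨i, hi⟩ := key z hz.1
    obtain ⟨g, hg, h⟩ := (hT i).gen z ⟨hi, hz.2⟩ hzd
    exact ⟨g, Finsupp.supported_mono (Set.subset_iUnion A i) hg, mono i h⟩
  · obtain ⟨y, hy, e, he, hye⟩ := mem_relB.1 hgB
    obtain ⟨i, hi⟩ := key y hy
    obtain ⟨j, hj⟩ := key e (chIn_mono Set.inter_subset_left he)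
    obtain ⟨k, hk⟩ := hdir.exists_mem_subset_of_finset_subset_biUnion (s := g.support) hg
    obtain ⟨l, hil, hjl⟩ := hdir i j
    obtain ⟨l', hll, hkl⟩ := hdir l k
    refine (hT l').inj g (hk.trans hkl) (mem_relB.2 ⟨y,
      chIn_mono (Set.prod_mono (hil.trans hll) subset_rfl) hi, e, mem_chIn_inter
        (chIn_mono (Set.prod_mono (hjl.trans hll) subset_rfl) hj)
        (chIn_mono Set.inter_subset_right he), hye⟩)

end Thom
end SingChain

namespace SingChain
open Cvx

section ThomClass

variable {X : Type} [TopologicalSpace X]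

theorem thom_convex [T2Space X] {E : Type} [NormedAddCommGroup E] [NormedSpace ℝ E] {n : ℕ}
    {α : Ch X} (hd : α ∈ deg X (n + 1)) (hα : dd α = 0)
    (hne : ∀ x : X, α ∉ relB Set.univ {x}ᶜ)
    (hgen : ∀ x : X, ∀ z ∈ relZ Set.univ {x}ᶜ, ∃ c : ℚ, z - c • α ∈ relB Set.univ {x}ᶜ)
    {φ : C(E, X)} (hφ : IsOpenEmbedding φ) {V : Set E} (hV : IsOpen V) (hcv : Convex ℝ V) :
    Thom n α (φ '' V) := by
  rcases V.eq_empty_or_nonempty with rfl | ⟨e₀, he₀⟩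
  · rw [Set.image_empty]; exact thom_empty n α
  set Q : Set (X × X) := (φ '' V) ×ˢ Set.univ with hQ
  set Q₁ : Set (X × X) := (φ.prodMap φ) '' (V ×ˢ Set.univ) with hQ₁
  have hφφ : IsOpenEmbedding (φ.prodMap φ) := hφ.prodMap hφ
  have hQ₁o : IsOpen Q₁ := hφφ.isOpenMap _ (hV.prod isOpen_univ)
  have hQ₁Q : Q₁ ⊆ Q := by
    rintro _ ⟨p, hp, rfl⟩
    exact Set.mk_mem_prod (Set.mem_image_of_mem φ hp.1) (Set.mem_univ _)
  have hcov : Q ⊆ Q₁ ∪ offD X := by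
    rintro ⟨x, y⟩ ⟨⟨p, hp, hpx⟩, -⟩
    by_cases h : x = y
    · refine Or.inl ⟨(p, p), Set.mk_mem_prod hp (Set.mem_univ _), ?_⟩
      rw [← h, ← show φ p = x from hpx]; rfl
    · exact Or.inr h
  have hpre : (φ.prodMap φ) ⁻¹' offD X = offD E := by
    ext p
    exact not_congr hφ.injective.eq_iff
  let ψ : C(E × E, E) := ⟨fun p => p.2 - p.1 + e₀, by fun_prop⟩
  let j : C(E, E × E) := (ContinuousMap.const E e₀).prodMk (ContinuousMap.id E)
  have hψP : ∀ p ∈ V ×ˢ (Set.univ : Set E), p ∈ offD E → ψ p ∈ ({e₀}ᶜ : Set E) := by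
    intro p _ hp h
    have h' : p.2 - p.1 + e₀ = e₀ := h
    rw [add_eq_right, sub_eq_zero] at h'
    exact hp h'.symm
  have hφP : ∀ p ∈ (Set.univ : Set E), p ∈ ({e₀}ᶜ : Set E) → φ p ∈ ({φ e₀}ᶜ : Set X) :=
    fun p _ hp hp' => hp (hφ.injective hp')
  have hx₀ : φ e₀ ∈ φ '' V := Set.mem_image_of_mem φ he₀
  have hsl : ∀ w ∈ relB Set.univ ({φ e₀}ᶜ : Set X), push (slice (φ e₀)) w ∈ relB Q (offD X) :=
    fun w hw => push_mem_relB (P := {φ e₀}ᶜ) (P' := offD X) (Q' := Q) _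
      (fun y _ => Set.mk_mem_prod hx₀ (Set.mem_univ _))
      (fun y _ hy h => hy (show y = φ e₀ from h.symm)) hw
  have hjφ : (φ.prodMap φ).comp j = (slice (φ e₀)).comp φ := rfl
  have main : ∀ z ∈ relZ Q (offD X), ∃ c : ℚ, z - c • push (slice (φ e₀)) α ∈ relB Q (offD X) := by
    intro z hz
    obtain ⟨z₁, hz₁, hzz⟩ := excise_relZ hQ₁o isOpen_offD hQ₁Q hcov hz
    obtain ⟨z', hz', rfl⟩ := lift_relZ hφφ.isEmbedding hz₁
    rw [hpre] at hz'
    let H : C((E × E) × I, E × E) := ⟨fun p => ((1 - (p.2 : ℝ)) • p.1.1 + (p.2 : ℝ) • e₀,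
      p.1.2 + (p.2 : ℝ) • (e₀ - p.1.1)), by fun_prop⟩
    have hH := hmt_sub_mem_relB H (Q := V ×ˢ Set.univ) (P := offD E) (Q' := V ×ˢ Set.univ)
      (P' := offD E) (fun p hp t => Set.mk_mem_prod
        (hcv hp.1 he₀ (sub_nonneg.2 t.2.2) t.2.1 (by ring)) (Set.mem_univ _))
      (fun p _ hp t h => hp (by
        have h' : (1 - (t : ℝ)) • p.1 + (t : ℝ) • e₀ = p.2 + (t : ℝ) • (e₀ - p.1) := h
        rw [sub_smul, one_smul, smul_sub] at h'
        have : p.1 = p.2 + ((t : ℝ) • e₀ - (t : ℝ) • p.1) + (t : ℝ) • p.1 - (t : ℝ) • e₀ := by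
          rw [← h']; abel
        rw [this]; abel)) hz'
    have e0 : atT H 0 = ContinuousMap.id _ := by
      ext1 p; simp [H]
    have e1 : atT H 1 = j.comp ψ := by
      ext1 p
      refine Prod.ext ?_ ?_
      · change (1 - (1 : ℝ)) • p.1 + (1 : ℝ) • e₀ = e₀
        simp
      · change p.2 + (1 : ℝ) • (e₀ - p.1) = p.2 - p.1 + e₀
        rw [one_smul]; abel
    rw [e0, e1, push_id, push_comp] at hH
    have hw : push ψ z' ∈ relZ Set.univ ({e₀}ᶜ : Set E) :=
      push_mem_relZ ψ (fun _ _ => Set.mem_univ _) hψP hz'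
    obtain ⟨c, hc⟩ := hgen (φ e₀) (push φ (push ψ z'))
      (push_mem_relZ φ (fun _ _ => Set.mem_univ _) hφP hw)
    refine ⟨c, ?_⟩
    have h1 := push_mem_relB (Q' := Q) (P' := offD X) (φ.prodMap φ)
      (fun p hp => hQ₁Q (Set.mem_image_of_mem _ hp))
      (fun p _ hp => by rw [← hpre] at hp; exact hp) hH
    rw [map_sub, ← push_comp, hjφ, push_comp] at h1
    have h2 := hsl _ hc
    rw [map_sub, map_smul] at h2
    have := Submodule.add_mem _ (Submodule.sub_mem _ hzz h1) h2
    convert this using 1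
    abel
  have hdα : push (slice (φ e₀)) α ∈ deg (X × X) (n + 1) := push_mem_deg _ hd
  refine ⟨fun m hm z hz hzd => ?_, fun z hz hzd => ?_, fun g hg hgB => ?_⟩
  · obtain ⟨c, hc⟩ := main z hz
    have := proj_mem_relB m hc
    rwa [map_sub, map_smul, proj_of_mem_deg hzd, proj_of_mem_deg_ne (by omega) hdα, smul_zero,
      sub_zero] at this
  · obtain ⟨c, hc⟩ := main z hz
    refine ⟨c • bas (φ e₀), Submodule.smul_mem _ _ (Finsupp.single_mem_supported ℚ 1 hx₀), ?_⟩
    rwa [map_smul, slices, lin_bas]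
  · by_contra hne0
    have hred : slices α g - coeffSum X g • push (slice (φ e₀)) α ∈ relB Q (offD X) := by
      refine supported_le_comap (f := slices α -
        (LinearMap.toSpanSingleton ℚ _ (push (slice (φ e₀)) α)) ∘ₗ coeffSum X) ?_ g hg
      rintro _ ⟨p, hp, rfl⟩
      simp only [LinearMap.sub_apply, LinearMap.comp_apply, slices, coeffSum, lin_bas,
        LinearMap.toSpanSingleton_apply, one_smul]
      let h : C(X × I, X × X) := ⟨fun y => (φ ((1 - (y.2 : ℝ)) • p + (y.2 : ℝ) • e₀), y.1), by
        fun_prop⟩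
      have h0 : atT h 0 = slice (φ p) := by ext1 y; simp [h]
      have h1 : atT h 1 = slice (φ e₀) := by ext1 y; simp [h]
      have := hmt_sub_mem_relB h (Q := Set.univ) (P := ∅) (Q' := Q) (P' := offD X)
        (fun y _ t => Set.mk_mem_prod (Set.mem_image_of_mem φ
          (hcv hp he₀ (sub_nonneg.2 t.2.2) t.2.1 (by ring))) (Set.mem_univ _))
        (fun y _ hy => hy.elim) (z := α)
        ⟨mem_chIn_univ _, by change dd α ∈ chIn _; rw [hα]; exact Submodule.zero_mem _⟩
      rw [h0, h1] at this
      rw [← neg_sub]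
      exact Submodule.neg_mem _ this
    have hα0 : push (slice (φ e₀)) α ∈ relB Q (offD X) := by
      have := Submodule.sub_mem _ hgB hred
      rw [sub_sub_cancel] at this
      exact (Submodule.smul_mem_iff _ hne0).1 this
    apply hne (φ e₀)
    obtain ⟨w₁, hw₁, hww⟩ := excise_relZ (Q := φ '' Set.univ) (Q' := Set.univ) (P := {φ e₀}ᶜ)
      (z := α) (hφ.isOpenMap _ isOpen_univ) isOpen_compl_singleton (Set.subset_univ _) (fun y _ => by
        by_cases hy : y = φ e₀
        · exact Or.inl (hy ▸ Set.mem_image_of_mem φ (Set.mem_univ _))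
        · exact Or.inr hy)
      ⟨mem_chIn_univ _, by change dd α ∈ chIn _; rw [hα]; exact Submodule.zero_mem _⟩
    obtain ⟨w, hw, rfl⟩ := lift_relZ hφ.isEmbedding hw₁
    have h1 : push (φ.prodMap φ) (push j w) ∈ relB Q (offD X) := by
      rw [← push_comp, hjφ, push_comp]
      have := Submodule.sub_mem _ hα0 (hsl _ hww)
      rwa [map_sub, sub_sub_cancel] at this
    have hjw : push j w ∈ chIn (V ×ˢ (Set.univ : Set E)) :=
      push_mem_chIn j (fun p _ => Set.mk_mem_prod he₀ (Set.mem_univ _)) (mem_chIn_univ w)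
    have h2 := excise_relB hQ₁o isOpen_offD hcov
      (push_mem_chIn _ (fun p hp => Set.mem_image_of_mem _ hp) hjw) h1
    have h3 := lift_relB hφφ.isEmbedding h2
    rw [hpre] at h3
    have h4 := push_mem_relB (Q' := Set.univ) (P' := {e₀}ᶜ) ψ (fun _ _ => Set.mem_univ _) hψP h3
    have h5 : ψ.comp j = ContinuousMap.id E := by ext1 y; simp [ψ, j]
    rw [← push_comp, h5, push_id] at h4
    have h6 := push_mem_relB (Q' := Set.univ) (P' := {φ e₀}ᶜ) φ (fun _ _ => Set.mem_univ _) hφP h4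
    have := Submodule.add_mem _ hww h6
    rwa [sub_add_cancel] at this

/-- The Thom class of the diagonal of a closed oriented manifold. -/
theorem exists_thom_class [T2Space X] [CompactSpace X] [ConnectedSpace X] {n : ℕ}
    (h : HasCharts n X) {α : Ch X} (hd : α ∈ deg X (n + 1)) (hα : dd α = 0)
    (hne : ∀ y, dd y ≠ α) : ∃ U : Ch (X × X) →ₗ[ℚ] ℚ, Coc (n + 1) U ∧
      (∀ c ∈ chIn (offD X), U c = 0) ∧ ∀ x, U (push (slice x) α) = 1 := by
  have hne' := not_mem_relB_of_not_boundary h hd hα hne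
  have hgen : ∀ x : X, ∀ z ∈ relZ Set.univ {x}ᶜ, ∃ c : ℚ, z - c • α ∈ relB Set.univ {x}ᶜ :=
    fun x z hz => (h.locAt x).generated_by
      ⟨mem_chIn_univ _, by change dd α ∈ chIn _; rw [hα]; exact Submodule.zero_mem _⟩ (hne' x) hz
  have T : Thom n α (Set.univ : Set X) := mv_induction h (Thom n α) (thom_empty n α)
    (fun φ hφ V hV hcv => thom_convex hd hα hne' hgen hφ hV hcv)
    (fun A B hA hB tA tB tAB => thom_union hd hα hA hB tA tB tAB)
    (fun ι _ A hA hdir hT => thom_iUnion hA hdir hT)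
  let R : Submodule ℚ (Ch (X × X)) := relB ((Set.univ : Set X) ×ˢ (Set.univ : Set X)) (offD X)
  obtain ⟨f, hf⟩ := exists_factor ⊤ (R.mkQ ∘ₗ slices α) (coeffSum X) (fun g _ hg =>
    T.inj g (by simp) ((Submodule.Quotient.mk_eq_zero R).1 hg))
  have hR : ∀ z ∈ R, (f ∘ₗ R.mkQ) z = 0 := fun z hz => by
    rw [LinearMap.comp_apply, Submodule.mkQ_apply, (Submodule.Quotient.mk_eq_zero R).2 hz, map_zero]
  refine ⟨(f ∘ₗ R.mkQ) ∘ₗ proj (n + 1), ⟨HomF.comp_proj _, fun x => ?_⟩, fun c hc => ?_, fun x => ?_⟩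
  · rw [LinearMap.comp_apply, proj_dd]
    exact hR _ (dd_mem_relB (by rw [Set.univ_prod_univ]; exact mem_chIn_univ _))
  · rw [LinearMap.comp_apply]
    exact hR _ (proj_mem_relB _ (chIn_le_relB (by rw [Set.univ_prod_univ]; exact mem_chIn_univ _) hc))
  · rw [LinearMap.comp_apply, proj_of_mem_deg (push_mem_deg _ hd)]
    have := hf (bas x) trivial
    simp only [coeffSum, slices, LinearMap.comp_apply, lin_bas] at this
    exact this.symm

end ThomClass
end SingChain

namespace SingChain
open Cvx

section DiagonalNeighborhood

variable {X : Type} [TopologicalSpace X]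

/-- There is a neighbourhood of the diagonal with a map to the space that is homotopic to the first
projection, is the identity on the diagonal, and is the second projection over `K`. -/
def DiagDeform (K : Set X) : Prop :=
  ∃ N : Set (X × X), IsOpen N ∧ (∀ x, (x, x) ∈ N) ∧ ∃ r : C(N, X),
    r.Homotopic (ContinuousMap.fst.comp (incl N)) ∧
    (∀ p : N, p.1.1 = p.1.2 → r p = p.1.2) ∧ ∀ p : N, p.1.2 ∈ K → r p = p.1.2

theorem DiagDeform.mono {K L : Set X} (h : DiagDeform L) (hKL : K ⊆ L) : DiagDeform K := by
  obtain ⟨N, hN, hd, r, hr, hr1, hr2⟩ := h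
  exact ⟨N, hN, hd, r, hr, hr1, fun p hp => hr2 p (hKL hp)⟩

theorem diagDeform_empty : DiagDeform (∅ : Set X) :=
  ⟨Set.univ, isOpen_univ, fun _ => Set.mem_univ _, ContinuousMap.fst.comp (incl _),
    ContinuousMap.Homotopic.refl _, fun _ h => h, fun _ h => h.elim⟩

theorem DiagDeform.step [T2Space X] [CompactSpace X] {n : ℕ} {K : Set X} (h : DiagDeform K)
    {φ : C(EuclideanSpace ℝ (Fin n), X)} (hφ : IsOpenEmbedding φ) (q : EuclideanSpace ℝ (Fin n)) :
    DiagDeform (K ∪ φ '' Metric.closedBall q 1) := by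
  classical
  obtain ⟨N, hN, hd, r, hr, hr1, hr2⟩ := h
  set D : Set X := φ '' Metric.closedBall q 2 with hD
  have hDc : IsClosed D := ((isCompact_closedBall q 2).image φ.continuous).isClosed
  set R : Set X := Set.range φ with hR
  have hRo : IsOpen R := hφ.isOpen_range
  have hDR : D ⊆ R := Set.image_subset_range _ _
  obtain ⟨lam, hl0, hl1, hl⟩ := exists_continuous_zero_one_of_isClosed
    (s := (φ '' Metric.ball q 2)ᶜ) (t := φ '' Metric.closedBall q 1)
    (hφ.isOpenMap _ Metric.isOpen_ball).isClosed_compl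
    ((isCompact_closedBall q 1).image φ.continuous).isClosed (by
      rw [Set.disjoint_compl_left_iff_subset]
      exact Set.image_mono (Metric.closedBall_subset_ball (by norm_num)))
  have hlD : ∀ y ∉ D, lam y = 0 := fun y hy => hl0 fun hy' =>
    hy (Set.image_mono Metric.ball_subset_closedBall hy')
  set inv := hφ.isEmbedding.toHomeomorph.symm
  let mv : (X × X) × ℝ → X := fun p => if hp : p.1.1 ∈ R ∧ p.1.2 ∈ R then
    φ ((1 - p.2 * lam p.1.2) • inv ⟨p.1.1, hp.1⟩ + (p.2 * lam p.1.2) • inv ⟨p.1.2, hp.2⟩) else p.1.1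
  have hinv : ∀ y : R, φ (inv y) = y := fun y =>
    congrArg Subtype.val (hφ.isEmbedding.toHomeomorph.apply_symm_apply y)
  have mv_lam : ∀ p : (X × X) × ℝ, p.2 * lam p.1.2 = 0 → mv p = p.1.1 := by
    intro p hp
    by_cases hp' : p.1.1 ∈ R ∧ p.1.2 ∈ R
    · simp only [mv, dif_pos hp', hp, sub_zero, one_smul, zero_smul, add_zero, hinv]
    · simp only [mv, dif_neg hp']
  have mv_self : ∀ (y : X) (t : ℝ), mv ((y, y), t) = y := by
    intro y t
    by_cases hp' : y ∈ R ∧ y ∈ R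
    · simp only [mv, dif_pos hp', ← add_smul, sub_add_cancel, one_smul, hinv]
    · simp only [mv, dif_neg hp']
  have mv_one : ∀ p : X × X, p.1 ∈ R → p.2 ∈ φ '' Metric.closedBall q 1 → mv (p, 1) = p.2 := by
    intro p h1 h2
    have hp' : p.1 ∈ R ∧ p.2 ∈ R := ⟨h1, Set.image_subset_range _ _ h2⟩
    have hlam : lam p.2 = 1 := hl1 h2
    simp only [mv, dif_pos hp', hlam, mul_one, sub_self, zero_smul, one_smul, zero_add, hinv]
  set W : Set (X × X) := (Set.univ ×ˢ Dᶜ) ∪ (R ×ˢ R) with hW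
  have hWo : IsOpen W := (isOpen_univ.prod hDc.isOpen_compl).union (hRo.prod hRo)
  have mv_cont : ContinuousOn mv (W ×ˢ Set.univ) := by
    rw [hW, Set.union_prod]
    refine ContinuousOn.union_of_isOpen ?_ ?_
      ((isOpen_univ.prod hDc.isOpen_compl).prod isOpen_univ) ((hRo.prod hRo).prod isOpen_univ)
    · refine ContinuousOn.congr (f := fun p => p.1.1) (by fun_prop) fun p hp => ?_
      exact mv_lam p (by rw [hlD _ hp.1.2, mul_zero])
    · rw [continuousOn_iff_continuous_domRestrict]
      let g : ((R ×ˢ R) ×ˢ Set.univ : Set ((X × X) × ℝ)) → X := fun p =>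
        φ ((1 - p.1.2 * lam p.1.1.2) • inv ⟨p.1.1.1, p.2.1.1⟩ +
          (p.1.2 * lam p.1.1.2) • inv ⟨p.1.1.2, p.2.1.2⟩)
      have hg : Continuous g := by
        have := inv.continuous
        fun_prop
      convert hg using 1
      funext p
      exact dif_pos p.2.1
  let N₀ : Set N := (fun p : N => ((r p, p.1.2) : X × X)) ⁻¹' W
  have hN₀ : IsOpen N₀ := hWo.preimage (by fun_prop)
  let N' : Set (X × X) := Subtype.val '' N₀
  have hN' : IsOpen N' := hN.isOpenMap_subtype_val _ hN₀
  have hsub : N' ⊆ N := by rintro _ ⟨p, -, rfl⟩; exact p.2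
  let ι : C(N', N) := ⟨Set.inclusion hsub, continuous_inclusion hsub⟩
  have hι : ∀ p : N', (r (ι p), p.1.2) ∈ W := by
    rintro ⟨_, p, hp, rfl⟩; exact hp
  let G : C(N' × I, X) := ⟨fun p => mv ((r (ι p.1), p.1.1.2), (p.2 : ℝ)),
    mv_cont.comp_continuous (by fun_prop) fun p => Set.mk_mem_prod (hι p.1) (Set.mem_univ _)⟩
  have hG : (r.comp ι).Homotopic (atT G 1) := ⟨⟨⟨fun p => G (p.2, p.1), by fun_prop⟩,
    fun p => mv_lam _ (by simp), fun p => rfl⟩⟩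
  refine ⟨N', hN', fun x => ?_, atT G 1, ?_, fun p hp => ?_, fun p hp => ?_⟩
  · refine ⟨⟨(x, x), hd x⟩, ?_, rfl⟩
    change (r ⟨(x, x), hd x⟩, x) ∈ W
    rw [hr1 _ rfl]
    by_cases hx : x ∈ D
    · exact Or.inr (Set.mk_mem_prod (hDR hx) (hDR hx))
    · exact Or.inl (Set.mk_mem_prod (Set.mem_univ _) hx)
  · exact hG.symm.trans (hr.comp (ContinuousMap.Homotopic.refl ι))
  · change mv ((r (ι p), p.1.2), _) = _
    rw [hr1 (ι p) hp]; exact mv_self _ _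
  · rcases hp with hp | hp
    · change mv ((r (ι p), p.1.2), _) = _
      rw [hr2 (ι p) hp]; exact mv_self _ _
    · refine mv_one (r (ι p), p.1.2) ?_ hp
      rcases hι p with h' | h'
      · exact absurd (Set.image_mono (Metric.closedBall_subset_closedBall (by norm_num)) hp) h'.2
      · exact h'.1

theorem exists_diag_nhd [T2Space X] [CompactSpace X] {n : ℕ} (h : HasCharts n X) :
    ∃ N : Set (X × X), IsOpen N ∧ (∀ x, (x, x) ∈ N) ∧
      (ContinuousMap.fst.comp (incl N)).Homotopic (ContinuousMap.snd.comp (incl N)) := by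
  have key : ∀ K : Set X, DiagDeform K → DiagDeform (K ∪ Set.univ) := by
    refine isCompact_univ.induction_on (p := fun s => ∀ K : Set X, DiagDeform K → DiagDeform (K ∪ s))
      ?_ ?_ ?_ ?_
    · intro K hK; rwa [Set.union_empty]
    · intro s t hst ht K hK
      exact (ht K hK).mono (Set.union_subset_union_right _ hst)
    · intro s t hs ht K hK
      rw [← Set.union_assoc]; exact ht _ (hs _ hK)
    · intro x _
      obtain ⟨φ, hφ, q, rfl⟩ := h x
      refine ⟨φ '' Metric.closedBall q 1, mem_nhdsWithin_of_mem_nhds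
        (hφ.isOpenMap.image_mem_nhds (Metric.closedBall_mem_nhds q one_pos)), fun K hK => hK.step hφ q⟩
  obtain ⟨N, hN, hd, r, hr, -, hr2⟩ := key ∅ diagDeform_empty
  refine ⟨N, hN, hd, ?_⟩
  have : r = ContinuousMap.snd.comp (incl N) := ContinuousMap.ext fun p => hr2 p (Or.inr trivial)
  rw [← this]; exact hr.symm

/-- The zero-divisor associated with a cocycle. -/
def zdiv (u : Ch X →ₗ[ℚ] ℚ) : Ch (X × X) →ₗ[ℚ] ℚ :=
  u ∘ₗ push ContinuousMap.fst - u ∘ₗ push ContinuousMap.snd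

theorem Coc.zdiv {k : ℕ} {u : Ch X →ₗ[ℚ] ℚ} (h : Coc k u) : Coc k (zdiv u) :=
  (h.push _).sub (h.push _)

theorem van_zdiv_of_homotopic {k : ℕ} {u : Ch X →ₗ[ℚ] ℚ} (hu : Coc k u) {N : Set (X × X)}
    (hN : (ContinuousMap.fst.comp (incl N)).Homotopic (ContinuousMap.snd.comp (incl N))) :
    Van (zdiv u) N := by
  intro c hc hdc
  obtain ⟨c', rfl⟩ := exists_lift hc
  have h0 : dd c' = 0 := push_incl_injective N (by rw [push_dd, hdc, map_zero])
  have := van_of_homotopic hN hu h0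
  rw [push_comp, push_comp] at this
  rw [zdiv, LinearMap.sub_apply, LinearMap.comp_apply, LinearMap.comp_apply, this, sub_self]

/-- Cap products with the two pullbacks of a class agree after pairing with a class supported on the
diagonal. -/
theorem thom_cp_zdiv [T2Space X] [CompactSpace X] {n k m : ℕ} (h : HasCharts n X)
    {U : Ch (X × X) →ₗ[ℚ] ℚ} (hU : Coc (m + 2) U) (hU0 : ∀ c ∈ chIn (offD X), U c = 0)
    {u : Ch X →ₗ[ℚ] ℚ} (hu : Coc (k + 2) u) {z : Ch (X × X)} (hz : dd z = 0) :
    U (cp (zdiv u) z) = 0 := by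
  obtain ⟨N, hN, hd, hh⟩ := exists_diag_nhd h
  refine van_union hU hu.zdiv hN isOpen_offD (van_zdiv_of_homotopic hu hh) (fun c hc _ => hU0 c hc)
    z ?_ hz
  have : N ∪ offD X = Set.univ := by
    rw [Set.eq_univ_iff_forall]
    rintro ⟨x, y⟩
    by_cases hxy : x = y
    · subst hxy; exact Or.inl (hd x)
    · exact Or.inr hxy
  rw [this]; exact mem_chIn_univ z

end DiagonalNeighborhood
end SingChain

namespace SingChain
open Cvx

section Duality

variable {X : Type} [TopologicalSpace X]

theorem exists_pt_of_deg_one (a : Simp X) (ha : a.1 = 1) : ∃ x, bas a = pt x := by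
  obtain ⟨m, s⟩ := a
  obtain rfl : m = 1 := ha
  refine ⟨s (stdSimplex.vertex 0), ?_⟩
  rw [pt]
  congr 1
  refine simp_ext rfl fun x => ?_
  have : x = stdSimplex.vertex (0 : Fin 1) := by
    have h := x.2.2
    refine stdSimplex.ext (funext fun i => ?_)
    fin_cases i
    simp
  rw [this]
  rfl

theorem thom_pt_chain {n : ℕ} {α : Ch X} (hd : α ∈ deg X (n + 1)) {U : Ch (X × X) →ₗ[ℚ] ℚ}
    (hU : ∀ x, U (push (slice x) α) = 1) {c : Ch X} (hc : c ∈ deg X 1) :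
    U (xr c α) = nlc (dd c) :=
  eq_on_supported (f := U ∘ₗ xr.flip α) (g := nlc ∘ₗ dd) (fun a ha => by
    obtain ⟨x, hx⟩ := exists_pt_of_deg_one a ha
    rw [hx, LinearMap.comp_apply, LinearMap.comp_apply, LinearMap.flip_apply, pt_xr,
      nlc_of_mem_deg (by omega) hd, zero_smul, sub_zero, dd_pt, nlc_nl]
    exact hU x) hc

theorem dd_xr_of_cycle {Y : Type} [TopologicalSpace Y] {a : Ch X} {b : Ch Y} (ha : dd a = 0)
    (hb : dd b = 0) : dd (xr a b) = 0 := by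
  rw [dd_xr, ha, hb]; simp

theorem exists_dual_class [T2Space X] [CompactSpace X] [ConnectedSpace X] {k : ℕ}
    (h : HasCharts (k + 3) X) {α : Ch X} (hd : α ∈ deg X (k + 4)) (hα : dd α = 0)
    (hne : ∀ y, dd y ≠ α) {u : Ch X →ₗ[ℚ] ℚ} (hu : Coc 3 u) (hun : Nrm u) {y : Ch X}
    (hyd : y ∈ deg X 3) (hy : dd y = 0) (huy : u y ≠ 0) :
    ∃ v : Ch X →ₗ[ℚ] ℚ, Coc (k + 2) v ∧ Nrm v ∧ v (cp u α) ≠ 0 := by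
  obtain ⟨U, hU, hU0, hU1⟩ := exists_thom_class h hd hα hne
  have hsgn : sgn y = - y := by rw [sgn_of_mem_deg hyd]; norm_num
  have hv : Coc (k + 2) ((U ∘ₗ xr y) ∘ₗ proj (k + 2)) := by
    refine ⟨HomF.comp_proj _, fun x => ?_⟩
    rw [LinearMap.comp_apply, proj_dd, LinearMap.comp_apply]
    have := dd_xr y (proj (k + 2 + 1) x)
    rw [hy, hsgn, map_zero, map_zero, zero_mul, zero_smul, add_zero, LinearMap.zero_apply, map_neg,
      LinearMap.neg_apply, zero_sub, neg_neg] at this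
    rw [← this, hU.apply_dd]
  have hcα : dd (cp u α) = 0 := by
    rw [dd_cp (hu.hom.nl (by norm_num)), hα, map_zero, hu.hom.apply (by omega) hd,
      show u ∘ₗ dd = 0 from LinearMap.ext hu.apply_dd]
    simp
  refine ⟨_, hv.comp_sub, nrm_comp_sub _, ?_⟩
  rw [LinearMap.comp_apply, hv.apply_sub hcα, LinearMap.comp_apply,
    proj_of_mem_deg (show cp u α ∈ deg X (k + 2) from cp_mem_deg hu.hom hd), LinearMap.comp_apply,
    ← cp_snd hun (hu.hom.nl (by norm_num))]
  have h1 := thom_cp_zdiv h (m := k + 2) (k := 1) hU hU0 hu (dd_xr_of_cycle hy hα)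
  rw [zdiv, cp_sub, map_sub, sub_eq_zero, cp_fst hun (fun x => by rw [hu.hom.sgn]; ring),
    thom_pt_chain hd hU1 (cp_mem_deg hu.hom hyd), dd_cp (hu.hom.nl (by norm_num)), hy, map_zero,
    show u ∘ₗ dd = 0 from LinearMap.ext hu.apply_dd] at h1
  rw [← h1]
  simpa using huy

end Duality
end SingChain

namespace SingChain
open Cvx

section Circle

/-- The unit circle. -/
abbrev Circ : Type := ↥(Metric.sphere (0 : EuclideanSpace ℝ (Fin (1 + 1))) 1)

theorem mem_circ_iff (a b : ℝ) :
    !₂[a, b] ∈ Metric.sphere (0 : EuclideanSpace ℝ (Fin (1 + 1))) 1 ↔ a ^ 2 + b ^ 2 = 1 := by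
  rw [mem_sphere_zero_iff_norm, EuclideanSpace.norm_eq, Real.sqrt_eq_one, Fin.sum_univ_two]
  simp

theorem circ_sq (s : Circ) : s.1 0 ^ 2 + s.1 1 ^ 2 = 1 := by
  have := s.2
  rw [mem_sphere_zero_iff_norm, EuclideanSpace.norm_eq, Real.sqrt_eq_one, Fin.sum_univ_two] at this
  simpa using this

/-- The arc of the unit circle from `1` to `-1` on the side given by `e`. -/
def arc (e : ℝ) (he : e ^ 2 = 1) : C(I, Circ) :=
  ⟨fun t => ⟨!₂[1 - 2 * (t : ℝ), e * (2 * √((t : ℝ) * (1 - t)))], by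
    rw [mem_circ_iff, mul_pow, he, mul_pow, Real.sq_sqrt (mul_nonneg t.2.1 (sub_nonneg.2 t.2.2))]
    ring⟩, by
    refine Continuous.subtype_mk ?_ _
    refine (PiLp.continuous_toLp 2 _).comp (continuous_pi fun i => ?_)
    fin_cases i
    · change Continuous fun t : I => 1 - 2 * (t : ℝ)
      fun_prop
    · change Continuous fun t : I => e * (2 * √((t : ℝ) * (1 - t)))
      fun_prop⟩

/-- The parameter of a point on its arc. -/
def arcParam : C(Circ, I) :=
  ⟨fun s => Set.projIcc 0 1 zero_le_one ((1 - s.1 0) / 2), by fun_prop⟩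

theorem arcParam_arc (e : ℝ) (he : e ^ 2 = 1) (t : I) : arcParam (arc e he t) = t := by
  change Set.projIcc 0 1 zero_le_one ((1 - (1 - 2 * (t : ℝ))) / 2) = t
  rw [show (1 - (1 - 2 * (t : ℝ))) / 2 = t by ring, Set.projIcc_val]

variable {Z Y : Type} [TopologicalSpace Z] [TopologicalSpace Y]

theorem exists_glue (g g' : C(Z × I, Y)) (h0 : ∀ z, g (z, 0) = g' (z, 0))
    (h1 : ∀ z, g (z, 1) = g' (z, 1)) : ∃ G : C(Z × Circ, Y),
      (∀ z t, G (z, arc 1 (by norm_num) t) = g (z, t)) ∧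
      ∀ z t, G (z, arc (-1) (by norm_num) t) = g' (z, t) := by
  refine ⟨⟨fun p => if 0 ≤ p.2.1 1 then g (p.1, arcParam p.2) else g' (p.1, arcParam p.2), ?_⟩,
    fun z t => ?_, fun z t => ?_⟩
  · refine Continuous.if_le (by fun_prop) (by fun_prop) continuous_const (by fun_prop) ?_
    intro p hp
    have := circ_sq p.2
    rw [← hp] at this
    have h2 : (p.2.1 0 - 1) * (p.2.1 0 + 1) = 0 := by linear_combination this
    rcases mul_eq_zero.1 h2 with h | h
    · have : arcParam p.2 = 0 := by
        change Set.projIcc 0 1 zero_le_one ((1 - p.2.1 0) / 2) = 0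
        rw [show (1 - p.2.1 0) / 2 = 0 by linarith]; exact Set.projIcc_left _
      rw [this]; exact h0 _
    · have : arcParam p.2 = 1 := by
        change Set.projIcc 0 1 zero_le_one ((1 - p.2.1 0) / 2) = 1
        rw [show (1 - p.2.1 0) / 2 = 1 by linarith]; exact Set.projIcc_right _
      rw [this]; exact h1 _
  · change (if 0 ≤ (1 : ℝ) * (2 * √((t : ℝ) * (1 - t))) then _ else _) = _
    rw [if_pos (by positivity), arcParam_arc]
  · change (if 0 ≤ (-1 : ℝ) * (2 * √((t : ℝ) * (1 - t))) then _ else _) = _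
    rw [arcParam_arc]
    split_ifs with h
    · have h3 : √((t : ℝ) * (1 - t)) = 0 := le_antisymm (by linarith) (Real.sqrt_nonneg _)
      rw [Real.sqrt_eq_zero (mul_nonneg t.2.1 (sub_nonneg.2 t.2.2))] at h3
      rcases mul_eq_zero.1 h3 with h | h
      · obtain rfl : t = 0 := Subtype.ext h
        exact h0 z
      · obtain rfl : t = 1 := Subtype.ext (by rw [sub_eq_zero] at h; exact h.symm)
        exact h1 z
    · rfl

/-- The fundamental cycle of the circle. -/
def circCyc : Ch Circ :=
  push (arc 1 (by norm_num)) edge - push (arc (-1) (by norm_num)) edge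

theorem dd_circCyc : dd circCyc = 0 := by
  rw [circCyc, map_sub, ← push_dd, ← push_dd, dd_edge, map_sub, map_sub, push_pt, push_pt, push_pt,
    push_pt]
  have h0 : arc 1 (by norm_num) 0 = arc (-1) (by norm_num) 0 := by simp [arc]
  have h1 : arc 1 (by norm_num) 1 = arc (-1) (by norm_num) 1 := by simp [arc]
  rw [h0, h1, sub_self]

end Circle

section Paths

variable {W : Type} [TopologicalSpace W]

/-- The chain of a path. -/
def pathCh {x y : W} (γ : Path x y) : Ch W := push (γ : C(I, W)) edge

theorem dd_pathCh {x y : W} (γ : Path x y) : dd (pathCh γ) = pt y - pt x := by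
  rw [pathCh, ← push_dd, dd_edge, map_sub, push_pt, push_pt]
  simp

theorem aff_pair (a b : ℝ) (x : Sx 2) : aff [a, b].get x = (1 - x 1) * a + x 1 * b := by
  have h := x.2.2
  rw [Fin.sum_univ_two] at h
  have h' : x 0 + x 1 = 1 := h
  refine (Fin.sum_univ_two (fun i : Fin 2 => x i • [a, b].get i)).trans ?_
  change x 0 * a + x 1 * b = _
  rw [← h']
  ring

theorem rz_pair (P : C(ℝ, W)) (a b : ℝ) {x y : W} (γ : Path x y)
    (h : ∀ t : I, P ((1 - (t : ℝ)) * a + t * b) = γ t) : rz P (bas [a, b]) = pathCh γ := by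
  rw [rz_bas, pathCh, edge, push_bas]
  congr 1
  refine simp_ext rfl fun x => ?_
  change P (aff [a, b].get x) = γ (pathS x)
  rw [aff_pair, ← h]
  rfl

theorem exists_dd_trans {x y z : W} (γ : Path x y) (γ' : Path y z) :
    ∃ w, dd w = pathCh γ' - pathCh (γ.trans γ') + pathCh γ := by
  let P : C(ℝ, W) := ⟨(γ.trans γ').extend, (γ.trans γ').continuous_extend⟩
  refine ⟨rz P (bas [0, 1 / 2, 1]), ?_⟩
  rw [dd_rz, bd_cons_bas, bd_cons_bas, bd_point, cons_bas, map_sub, map_sub, cons_bas, cons_bas, map_sub,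
    rz_pair P 0 1 (γ.trans γ'), rz_pair P (1/2) 1 γ', rz_pair P 0 (1/2) γ]
  · abel
  · intro t
    have ht := t.2.2
    have ht0 := t.2.1
    change (γ.trans γ').extend _ = _
    have hm : (1 - (t : ℝ)) * 0 + t * (1 / 2) ∈ Set.Icc (0 : ℝ) 1 := ⟨by linarith, by linarith⟩
    rw [Path.extend_apply _ hm, Path.trans_apply, dif_pos (by linarith)]
    congr 1
    exact Subtype.ext (by ring)
  · intro t
    have ht := t.2.2
    have ht0 := t.2.1
    change (γ.trans γ').extend _ = _
    have hm : (1 - (t : ℝ)) * (1 / 2) + t * 1 ∈ Set.Icc (0 : ℝ) 1 := ⟨by linarith, by linarith⟩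
    rw [Path.extend_apply _ hm, Path.trans_apply]
    split_ifs with h
    · have h1 : (t : ℝ) = 0 := by linarith
      obtain rfl : t = 0 := Subtype.ext h1
      rw [Path.source]
      convert γ.target using 2
      exact Subtype.ext (by simp)
    · congr 1
      exact Subtype.ext (by ring)
  · intro t
    change (γ.trans γ').extend _ = _
    rw [show (1 - (t : ℝ)) * 0 + t * 1 = t by ring, Path.extend_extends']

/-- A one-simplex as a path. -/
def simpPath (s : C(Sx 2, W)) : Path (s (stdSimplexHomeomorphUnitInterval.symm 0))
    (s (stdSimplexHomeomorphUnitInterval.symm 1)) where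
  toFun t := s (stdSimplexHomeomorphUnitInterval.symm t)
  continuous_toFun := by fun_prop
  source' := rfl
  target' := rfl

theorem pathCh_simpPath (s : C(Sx 2, W)) : pathCh (simpPath s) = bas ⟨2, s⟩ := by
  rw [pathCh, edge, push_bas]
  congr 1
  refine simp_ext rfl fun x => ?_
  exact congrArg s (stdSimplexHomeomorphUnitInterval.symm_apply_apply x)

/-- A one-dimensional cocycle vanishing on loops vanishes on cycles. -/
theorem van_of_loops {D : Ch W →ₗ[ℚ] ℚ} (hD : Coc 2 D)
    (h : ∀ (x y : W) (γ γ' : Path x y), D (pathCh γ - pathCh γ') = 0) {c : Ch W} (hc : dd c = 0) :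
    D c = 0 := by
  let b : W → W := fun x => (Quotient.mk (pathSetoid W) x).out
  have hb : ∀ x : W, Joined (b x) x := fun x =>
    Quotient.exact (Quotient.out_eq (Quotient.mk (pathSetoid W) x))
  have hbb : ∀ x y : W, Joined x y → b x = b y := fun x y hxy =>
    congrArg Quotient.out (Quotient.sound (s := pathSetoid W) hxy)
  let γ : ∀ x, Path (b x) x := fun x => (hb x).somePath
  have htr : ∀ {x y z : W} (p : Path x y) (q : Path x z) (r : Path y z),
      D (pathCh r) = D (pathCh q) - D (pathCh p) := by
    intro x y z p q r
    obtain ⟨w, hw⟩ := exists_dd_trans p r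
    have h1 := hD.apply_dd w
    have h2 := h _ _ (p.trans r) q
    rw [hw, map_add, map_sub] at h1
    rw [map_sub] at h2
    linarith
  let F : Ch W →ₗ[ℚ] ℚ := lin fun a =>
    if ha : 0 < a.1 then D (pathCh (γ (a.2 (stdSimplex.vertex ⟨0, ha⟩)))) else 0
  have hF : ∀ x, F (pt x) = D (pathCh (γ x)) := fun x => lin_bas _ _
  have key : ∀ x ∈ deg W 2, D x = (F ∘ₗ dd) x := fun x hx => eq_on_supported (fun a ha => by
    obtain ⟨m, s⟩ := a
    obtain rfl : m = 2 := ha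
    rw [LinearMap.comp_apply, ← pathCh_simpPath, dd_pathCh, map_sub, hF, hF]
    have hj := hbb _ _ ⟨simpPath s⟩
    exact htr (γ _) ((γ _).cast hj rfl) (simpPath s)) hx
  have hD2 : D c = D (proj 2 c) := by
    have : D = D ∘ₗ proj 2 := lin_ext fun a => by
      rw [LinearMap.comp_apply, proj_bas]
      split_ifs with ha
      · rfl
      · rw [hD.hom a ha, map_zero]
    exact LinearMap.congr_fun this c
  rw [hD2, key _ (proj_mem_deg 2 c), LinearMap.comp_apply, ← proj_dd, hc, map_zero, map_zero]

end Paths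

section Weight

variable {X W : Type} [TopologicalSpace X] [TopologicalSpace W]

/-- The difference of two prism operators with common ends kills cycles under a class vanishing on
all tori. -/
theorem hmt_sub_of_atoroidal {u : Ch X →ₗ[ℚ] ℚ} (hu : Coc 3 u)
    (ht : ∀ (f : C(Circ × Circ, X)) (z : Ch (Circ × Circ)), dd z = 0 → u (push f z) = 0)
    {g g' : C(W × I, X)} (h0 : ∀ w, g (w, 0) = g' (w, 0)) (h1 : ∀ w, g (w, 1) = g' (w, 1))
    {c : Ch W} (hc : dd c = 0) : u (hmt g c) = u (hmt g' c) := by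
  have e0 : atT g 0 = atT g' 0 := ContinuousMap.ext h0
  have e1 : atT g 1 = atT g' 1 := ContinuousMap.ext h1
  have hD : Coc 2 (u ∘ₗ hmt g - u ∘ₗ hmt g') := by
    refine ⟨fun a ha => ?_, fun x => ?_⟩
    · rw [LinearMap.sub_apply, LinearMap.comp_apply, LinearMap.comp_apply,
        hu.hom.apply (m := a.1 + 1) (by omega) (hmt_mem_deg g (bas_mem_deg a)),
        hu.hom.apply (m := a.1 + 1) (by omega) (hmt_mem_deg g' (bas_mem_deg a)), sub_zero]
    · have h2 := hu.apply_dd (hmt g x)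
      have h3 := hu.apply_dd (hmt g' x)
      rw [dd_hmt, map_sub, e0, e1] at h2
      rw [dd_hmt, map_sub] at h3
      rw [LinearMap.sub_apply, LinearMap.comp_apply, LinearMap.comp_apply]
      linarith
  have := van_of_loops hD (fun x y γ γ' => ?_) hc
  · rw [LinearMap.sub_apply, LinearMap.comp_apply, LinearMap.comp_apply] at this
    linarith
  obtain ⟨G, hG, hG'⟩ := exists_glue g g' h0 h1
  obtain ⟨L, hL, hL'⟩ := exists_glue
    ((γ : C(I, W)).comp (ContinuousMap.snd : C(Unit × I, I)))
    ((γ' : C(I, W)).comp (ContinuousMap.snd : C(Unit × I, I))) (by simp) (by simp)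
  let l : C(Circ, W) := L.comp ((ContinuousMap.const _ ()).prodMk (ContinuousMap.id _))
  set c' := pathCh γ - pathCh γ' with hc'
  have hl : push l circCyc = c' := by
    rw [circCyc, map_sub, ← push_comp, ← push_comp, hc', pathCh, pathCh]
    congr 3
    · ext t; exact hL () t
    · ext t; exact hL' () t
  have hcd : c' ∈ deg W 2 := Submodule.sub_mem _ (push_mem_deg _ edge_mem_deg)
    (push_mem_deg _ edge_mem_deg)
  have hs : sgn c' = c' := by rw [sgn_of_mem_deg hcd]; norm_num
  have hT := ht (G.comp (l.prodMap (ContinuousMap.id _))) (xr circCyc circCyc)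
    (dd_xr_of_cycle dd_circCyc dd_circCyc)
  have hGe : ∀ (e : C(I, Circ)) (g : C(W × I, X)), (∀ w t, G (w, e t) = g (w, t)) →
      push G (xr c' (push e edge)) = push g (xr c' edge) := by
    intro e g hg
    have : G.comp ((ContinuousMap.id W).prodMap e) = g := by ext p; exact hg p.1 p.2
    rw [← this, push_comp, push_xr, push_id]
  rw [push_comp, push_xr, push_id, hl, circCyc, map_sub, map_sub, hGe _ _ hG, hGe _ _ hG',
    map_sub] at hT
  rw [LinearMap.sub_apply, LinearMap.comp_apply, LinearMap.comp_apply, hmt_apply, hmt_apply, hs,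
    map_neg, map_neg]
  linarith

/-- A local section of the path fibration, as a homotopy. -/
def MotionPlan (A : Set (X × X)) : Prop :=
  ∃ h : C(A × I, X), ∀ p : A, h (p, 0) = p.1.1 ∧ h (p, 1) = p.1.2

theorem MotionPlan.homotopic {A : Set (X × X)} (hA : MotionPlan A) :
    (ContinuousMap.fst.comp (incl A)).Homotopic (ContinuousMap.snd.comp (incl A)) := by
  obtain ⟨h, hh⟩ := hA
  exact ⟨⟨⟨fun p => h (p.2, p.1), by fun_prop⟩, fun p => (hh p).1, fun p => (hh p).2⟩⟩

theorem zdiv_push_incl {u : Ch X →ₗ[ℚ] ℚ} (hu : Coc 3 u) {A : Set (X × X)} {h : C(A × I, X)}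
    (hh : ∀ p : A, h (p, 0) = p.1.1 ∧ h (p, 1) = p.1.2) (a : Ch A) :
    zdiv u (push (incl A) a) = - u (hmt h (dd a)) := by
  have e0 : atT h 0 = ContinuousMap.fst.comp (incl A) := ContinuousMap.ext fun p => (hh p).1
  have e1 : atT h 1 = ContinuousMap.snd.comp (incl A) := ContinuousMap.ext fun p => (hh p).2
  have := hu.apply_dd (hmt h a)
  rw [dd_hmt, e0, e1, map_sub, map_sub, push_comp, push_comp] at this
  rw [zdiv, LinearMap.sub_apply, LinearMap.comp_apply, LinearMap.comp_apply]
  linarith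

theorem hmt_push {Y : Type} [TopologicalSpace Y] (j : C(W, Y)) (h : C(Y × I, X)) (c : Ch W) :
    hmt h (push j c) = hmt (h.comp (j.prodMap (ContinuousMap.id I))) c := by
  rw [hmt_apply, hmt_apply, push_comp, push_xr, push_id, push_sgn]

/-- The zero-divisor of an atoroidal class vanishes on unions of two motion planning domains. -/
theorem van_zdiv_of_atoroidal {u : Ch X →ₗ[ℚ] ℚ} (hu : Coc 3 u)
    (ht : ∀ (f : C(Circ × Circ, X)) (z : Ch (Circ × Circ)), dd z = 0 → u (push f z) = 0)
    {A B : Set (X × X)} (hA : IsOpen A) (hB : IsOpen B) (hmA : MotionPlan A) (hmB : MotionPlan B) :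
    Van (zdiv u) (A ∪ B) := by
  intro z hz hdz
  obtain ⟨j, hj⟩ := exists_sub_mem hA hB hz
  obtain ⟨a, ha, b, hb, hab⟩ := Submodule.mem_sup.1 hj
  have h1 : zdiv u z = zdiv u (a + b) := by
    have h2 := dd_subTk j z
    rw [hdz, map_zero, sub_zero] at h2
    have h3 := hu.zdiv.apply_dd (subTk j z)
    rw [h2, map_sub, ← hab] at h3
    linarith
  have hd : dd a + dd b = 0 := by rw [← map_add, hab, dd_sub_pow, hdz, map_zero]
  have hcW : dd a ∈ chIn (A ∩ B) := by
    refine mem_chIn_inter (dd_mem_chIn ha) ?_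
    rw [eq_neg_of_add_eq_zero_left hd]
    exact Submodule.neg_mem _ (dd_mem_chIn hb)
  obtain ⟨c, hc⟩ := exists_lift hcW
  obtain ⟨a', rfl⟩ := exists_lift ha
  obtain ⟨b', rfl⟩ := exists_lift hb
  obtain ⟨g, hg⟩ := hmA
  obtain ⟨g', hg'⟩ := hmB
  let iA : C((A ∩ B : Set (X × X)), A) := ⟨fun x => ⟨x.1, x.2.1⟩, by fun_prop⟩
  let iB : C((A ∩ B : Set (X × X)), B) := ⟨fun x => ⟨x.1, x.2.2⟩, by fun_prop⟩
  have hcA : dd a' = push iA c := push_incl_injective A (by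
    rw [push_dd, ← hc, ← push_comp]; rfl)
  have hcB : dd b' = - push iB c := push_incl_injective B (by
    rw [push_dd, map_neg, ← push_comp, eq_neg_of_add_eq_zero_right hd, ← hc]; rfl)
  have hc0 : dd c = 0 := push_incl_injective _ (by rw [push_dd, hc, dd_dd, map_zero])
  rw [h1, map_add, zdiv_push_incl hu hg, zdiv_push_incl hu hg', hcA, hcB, map_neg, map_neg, hmt_push,
    hmt_push, hmt_sub_of_atoroidal hu ht (g := g.comp _) (g' := g'.comp _) _ _ hc0]
  · ring
  · intro w; exact (hg (iA w)).1.trans (hg' (iB w)).1.symm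
  · intro w; exact (hg (iA w)).2.trans (hg' (iB w)).2.symm

end Weight
end SingChain

namespace SingChain
open Cvx

section LowerBound

variable {X : Type} [TopologicalSpace X]

theorem nlc_dd_cp {k : ℕ} {u : Ch X →ₗ[ℚ] ℚ} (hu : Coc (k + 2) u) {x : Ch X} {r : ℚ}
    (hx : dd x = r • nl) : nlc (dd (cp u x)) = u x := by
  rw [dd_cp (hu.hom.nl (by omega)), hx, map_smul, cp_nl, show u ∘ₗ dd = 0 from LinearMap.ext hu.apply_dd]
  simp

theorem dd_cp_of_coc {k : ℕ} {u : Ch X →ₗ[ℚ] ℚ} (hu : Coc (k + 2) u) {x : Ch X}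
    (hx : dd x = 0) : dd (cp u x) = u x • nl := by
  rw [dd_cp (hu.hom.nl (by omega)), hx, show u ∘ₗ dd = 0 from LinearMap.ext hu.apply_dd]
  simp

theorem zdiv_xr {u : Ch X →ₗ[ℚ] ℚ} (hn : Nrm u) (h0 : u nl = 0) (a b : Ch X) :
    zdiv u (xr a b) = u a * nlc (dd b) - nlc (dd a) * u b := by
  rw [zdiv, LinearMap.sub_apply, LinearMap.comp_apply, LinearMap.comp_apply, ev_fst hn h0,
    ev_snd hn h0]

theorem cp_zdiv_xr {u : Ch X →ₗ[ℚ] ℚ} (hn : Nrm u) (h0 : u nl = 0) (hs : ∀ x, u (sgn x) = - u x)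
    (a b : Ch X) : cp (zdiv u) (xr a b) = xr (cp u a) b - xr a (cp u b) := by
  rw [zdiv, cp_sub, cp_fst hn hs, cp_snd hn h0]

theorem cp_cp_zdiv_xr {u : Ch X →ₗ[ℚ] ℚ} (hn : Nrm u) (h0 : u nl = 0)
    (hs : ∀ x, u (sgn x) = - u x) (a b : Ch X) :
    cp (zdiv u) (cp (zdiv u) (xr a b)) =
      xr (cp u (cp u a)) b - (2 : ℚ) • xr (cp u a) (cp u b) + xr a (cp u (cp u b)) := by
  rw [cp_zdiv_xr hn h0 hs, map_sub, cp_zdiv_xr hn h0 hs, cp_zdiv_xr hn h0 hs, two_smul]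
  abel

theorem zdiv_cp_zdiv_xr {k : ℕ} {v : Ch X →ₗ[ℚ] ℚ} (hv : Coc (k + 2) v) (hn : Nrm v)
    (hs : ∀ x, v (sgn x) = - v x) {a b : Ch X} {r t : ℚ} (ha : dd a = r • nl) (hb : dd b = t • nl) :
    zdiv v (cp (zdiv v) (xr a b)) = v (cp v a) * t - 2 * (v a * v b) + r * v (cp v b) := by
  rw [cp_zdiv_xr hn (hv.hom.nl (by omega)) hs, map_sub, zdiv_xr hn (hv.hom.nl (by omega)),
    zdiv_xr hn (hv.hom.nl (by omega)), nlc_dd_cp hv ha, nlc_dd_cp hv hb, ha, hb]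
  simp only [map_smul, nlc_nl, smul_eq_mul, mul_one]
  ring

theorem van_zdiv_pow_two {k : ℕ} {u Φ : Ch (X × X) →ₗ[ℚ] ℚ} (hu : Coc 3 u) (hΦ : Coc (k + 2) Φ)
    {A B C : Set (X × X)} (hA : IsOpen A) (hB : IsOpen B) (hC : IsOpen C) (huA : Van u A)
    (huB : Van u B) (hΦC : Van Φ C) (hcov : A ∪ (B ∪ C) = Set.univ) {z : Ch (X × X)}
    (hz : dd z = 0) : Φ (cp u (cp u z)) = 0 := by
  have h1 := van_union hΦ (k' := 1) hu hB hC huB hΦC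
  have h2 := van_union (coc_comp_cp hΦ (k' := 1) hu) (k' := 1) hu hA (hB.union hC) huA h1
  exact h2 z (by rw [hcov]; exact mem_chIn_univ z) hz

/-- A closed manifold of dimension different from four with an atoroidal class does not have a motion
planner with five domains. -/
theorem no_five_motion_plans [T2Space X] [CompactSpace X] [ConnectedSpace X] {k : ℕ} (hk : k ≠ 1)
    (h : HasCharts (k + 3) X) {α : Ch X} (hd : α ∈ deg X (k + 4)) (hα : dd α = 0)
    (hne : ∀ y, dd y ≠ α) {u : Ch X →ₗ[ℚ] ℚ} (hu : Coc 3 u) (hun : Nrm u) {y : Ch X}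
    (hyd : y ∈ deg X 3) (hy : dd y = 0) (huy : u y ≠ 0)
    (ht : ∀ (f : C(Circ × Circ, X)) (z : Ch (Circ × Circ)), dd z = 0 → u (push f z) = 0)
    {V : Fin 5 → Set (X × X)} (hV : ∀ i, IsOpen (V i)) (hm : ∀ i, MotionPlan (V i))
    (hcov : ⋃ i, V i = Set.univ) : False := by
  obtain ⟨v, hv, hvn, hvα⟩ := exists_dual_class h hd hα hne hu hun hyd hy huy
  have hu0 : u nl = 0 := hu.hom.nl (by norm_num)
  have hv0 : v nl = 0 := hv.hom.nl (by omega)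
  have hsu : ∀ x, u (sgn x) = - u x := fun x => by rw [hu.hom.sgn]; ring
  have key := van_zdiv_pow_two hu.zdiv hv.zdiv ((hV 0).union (hV 1)) ((hV 2).union (hV 3)) (hV 4)
    (van_zdiv_of_atoroidal hu ht (hV 0) (hV 1) (hm 0) (hm 1))
    (van_zdiv_of_atoroidal hu ht (hV 2) (hV 3) (hm 2) (hm 3))
    (van_zdiv_of_homotopic hv (hm 4).homotopic) (by
      rw [← hcov]
      ext p
      simp only [Set.mem_union, Set.mem_iUnion, Fin.exists_fin_succ, Fin.exists_fin_zero]
      tauto) (dd_xr_of_cycle hα hy)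
  have huα : u α = 0 := hu.hom.apply (by omega) hd
  have hdα : dd (cp u α) = 0 := by rw [dd_cp_of_coc (k := 1) hu hα, huα, zero_smul]
  have huuα : u (cp u α) = 0 := hu.hom.apply (by omega) (cp_mem_deg hu.hom hd)
  rw [cp_cp_zdiv_xr hun hu0 hsu, map_add, map_sub, map_smul, zdiv_xr hvn hv0, zdiv_xr hvn hv0,
    zdiv_xr hvn hv0, dd_cp_of_coc (k := 1) hu hdα, huuα, hdα, hα, dd_cp_of_coc (k := 1) hu hy, hy,
    hv.hom.apply (by omega) hd] at key
  simp only [map_zero, mul_zero, zero_smul, zero_mul, sub_self, sub_zero, map_smul, nlc_nl,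
    smul_eq_mul, mul_one, zero_sub, add_zero] at key
  simp [hvα, huy] at key

/-- A closed even-dimensional manifold with an atoroidal class does not have a motion planner with
six domains. -/
theorem no_six_motion_plans [T2Space X] [CompactSpace X] [ConnectedSpace X] {k : ℕ} (hk : Odd k)
    (h : HasCharts (k + 3) X) {α : Ch X} (hd : α ∈ deg X (k + 4)) (hα : dd α = 0)
    (hne : ∀ y, dd y ≠ α) {u : Ch X →ₗ[ℚ] ℚ} (hu : Coc 3 u) (hun : Nrm u) {y : Ch X}
    (hyd : y ∈ deg X 3) (hy : dd y = 0) (huy : u y ≠ 0)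
    (ht : ∀ (f : C(Circ × Circ, X)) (z : Ch (Circ × Circ)), dd z = 0 → u (push f z) = 0)
    {V : Fin 6 → Set (X × X)} (hV : ∀ i, IsOpen (V i)) (hm : ∀ i, MotionPlan (V i))
    (hcov : ⋃ i, V i = Set.univ) : False := by
  have hu0 : u nl = 0 := hu.hom.nl (by norm_num)
  have hsu : ∀ x, u (sgn x) = - u x := fun x => by rw [hu.hom.sgn]; ring
  have huα : u α = 0 := hu.hom.apply (by omega) hd
  have hdα : dd (cp u α) = 0 := by rw [dd_cp_of_coc (k := 1) hu hα, huα, zero_smul]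
  have main : ∀ v : Ch X →ₗ[ℚ] ℚ, Coc (k + 2) v → Nrm v →
      4 * (v (cp u α) * v (cp u α)) + 2 * (u (cp u α) * v (cp v α)) = 0 := by
    intro v hv hvn
    have hsv : ∀ x, v (sgn x) = - v x := fun x => by
      rw [hv.hom.sgn, (hk.add_even even_two).neg_one_pow]; ring
    have hV1 := van_union hv.zdiv hv.zdiv (hV 4) (hV 5)
      (van_zdiv_of_homotopic hv (hm 4).homotopic) (van_zdiv_of_homotopic hv (hm 5).homotopic)
    have key := van_zdiv_pow_two hu.zdiv (coc_comp_cp hv.zdiv hv.zdiv) ((hV 0).union (hV 1))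
      ((hV 2).union (hV 3)) ((hV 4).union (hV 5))
      (van_zdiv_of_atoroidal hu ht (hV 0) (hV 1) (hm 0) (hm 1))
      (van_zdiv_of_atoroidal hu ht (hV 2) (hV 3) (hm 2) (hm 3)) hV1 (by
        rw [← hcov]
        ext p
        simp only [Set.mem_union, Set.mem_iUnion, Fin.exists_fin_succ, Fin.exists_fin_zero]
        tauto) (dd_xr_of_cycle hα hα)
    have hα' : dd α = (0 : ℚ) • nl := by rw [hα, zero_smul]
    have hdα' : dd (cp u α) = (0 : ℚ) • nl := by rw [hdα, zero_smul]
    have h2 := dd_cp_of_coc (k := 1) hu hdα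
    rw [LinearMap.comp_apply, cp_cp_zdiv_xr hun hu0 hsu, map_add, map_sub, map_smul, map_add, map_sub,
      map_smul, zdiv_cp_zdiv_xr hv hvn hsv h2 hα', zdiv_cp_zdiv_xr hv hvn hsv hdα' hdα',
      zdiv_cp_zdiv_xr hv hvn hsv hα' h2, hv.hom.apply (by omega) hd] at key
    simp only [smul_eq_mul] at key
    linarith
  by_cases huu : u (cp u α) = 0
  · obtain ⟨v, hv, hvn, hvα⟩ := exists_dual_class h hd hα hne hu hun hyd hy huy
    have := main v hv hvn
    rw [huu] at this
    simp [hvα] at this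
  · have hk1 : k = 1 := by
      by_contra hk1
      exact huu (hu.hom.apply (by omega) (cp_mem_deg hu.hom hd))
    subst hk1
    have := main u hu hun
    have h3 : u (cp u α) * u (cp u α) = 0 := by linarith
    simp [huu] at h3

end LowerBound
end SingChain

namespace SingChain
open Cvx

/-! ### Comparison with the singular chain complex -/

section Bridge

variable {X Y : Type} [TopologicalSpace X] [TopologicalSpace Y]

theorem bd_ofFn {V : Type} : ∀ {m : ℕ} (v : Fin (m + 1) → V),
    bd (bas (List.ofFn v)) =
      ∑ i : Fin (m + 1), (-1 : ℚ) ^ (i : ℕ) • bas (List.ofFn fun j => v (i.succAbove j))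
  | 0, v => by simp [List.ofFn_succ, bd_cons_bas]
  | m + 1, v => by
    rw [List.ofFn_succ, bd_cons_bas, bd_ofFn fun i => v i.succ, map_sum,
      Fin.sum_univ_succ (n := m + 1), sub_eq_add_neg, ← Finset.sum_neg_distrib]
    congr 1
    · simp
    · refine Finset.sum_congr rfl fun i _ => ?_
      rw [map_smul, cons_bas, List.ofFn_succ (f := fun j => v (i.succ.succAbove j))]
      simp [pow_succ]

/-- The `n`-simplices of the singular simplicial set. -/
abbrev SSimp (X : Type) [TopologicalSpace X] (n : ℕ) : Type :=
  (TopCat.toSSet.obj (TopCat.of X)).obj (Opposite.op (SimplexCategory.mk n))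

/-- The chains of the singular chain complex. -/
abbrev SCh (X : Type) [TopologicalSpace X] (n : ℕ) : ModuleCat ℚ :=
  (singularChainComplex.obj (TopCat.of X)).X n

/-- A simplex of the singular simplicial set as a continuous map. -/
def toSimp (n : ℕ) : SSimp X n ≃ C(Sx (n + 1), X) :=
  TopCat.toSSetObjEquiv (TopCat.of X) (Opposite.op (SimplexCategory.mk n))

/-- The chains of the singular chain complex are freely generated by simplices. -/
def freeEquiv (X : Type) [TopologicalSpace X] (n : ℕ) : (SSimp X n →₀ ℚ) ≃ₗ[ℚ] SCh X n :=
  LinearEquiv.refl ℚ (SSimp X n →₀ ℚ)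

/-- The inclusion of the chains of the singular chain complex. -/
def toCh (n : ℕ) : SCh X n →ₗ[ℚ] Ch X :=
  (lin fun a : SSimp X n => bas (⟨n + 1, toSimp n a⟩ : Simp X)) ∘ₗ
    ((freeEquiv X n).symm : SCh X n →ₗ[ℚ] (SSimp X n →₀ ℚ))

theorem toCh_bas (n : ℕ) (a : SSimp X n) :
    toCh n (freeEquiv X n (bas a)) = bas (⟨n + 1, toSimp n a⟩ : Simp X) := by
  simp [toCh, lin_bas]

theorem free_ext {N : Type*} [AddCommGroup N] [Module ℚ N] {n : ℕ} {f g : SCh X n →ₗ[ℚ] N}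
    (h : ∀ a, f (freeEquiv X n (bas a)) = g (freeEquiv X n (bas a))) : f = g := by
  have := lin_ext (f := f ∘ₗ (freeEquiv X n : (SSimp X n →₀ ℚ) →ₗ[ℚ] SCh X n))
    (g := g ∘ₗ (freeEquiv X n : (SSimp X n →₀ ℚ) →ₗ[ℚ] SCh X n)) h
  ext x
  simpa using LinearMap.congr_fun this ((freeEquiv X n).symm x)

/-- The projection onto the chains of the singular chain complex. -/
def ofCh (n : ℕ) : Ch X →ₗ[ℚ] SCh X n :=
  lin fun a : Simp X => if h : a.1 = n + 1 then
    freeEquiv X n (bas ((toSimp n).symm (h ▸ a.2))) else 0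

theorem ofCh_toCh (n : ℕ) (x : SCh X n) : ofCh n (toCh n x) = x := by
  have : ofCh n ∘ₗ toCh n = (LinearMap.id : SCh X n →ₗ[ℚ] SCh X n) := free_ext fun a => by
    rw [LinearMap.comp_apply, toCh_bas, ofCh, lin_bas]
    simp
  exact LinearMap.congr_fun this x

theorem toCh_ofCh (n : ℕ) (x : Ch X) : toCh n (ofCh n x) = proj (n + 1) x := by
  have : toCh n ∘ₗ ofCh n = proj (X := X) (n + 1) := lin_ext fun a => by
    obtain ⟨m, s⟩ := a
    rw [LinearMap.comp_apply, proj_bas, ofCh, lin_bas]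
    split_ifs with h
    · obtain rfl : m = n + 1 := h
      rw [toCh_bas, Equiv.apply_symm_apply]
    · rw [map_zero]
  exact LinearMap.congr_fun this x

theorem toCh_mem_deg (n : ℕ) (x : SCh X n) : toCh n x ∈ deg X (n + 1) := by
  rw [← ofCh_toCh n x, toCh_ofCh]
  exact proj_mem_deg _ _

theorem toSimp_face (n : ℕ) (i : Fin (n + 2)) (a : SSimp X (n + 1)) (x : Sx (n + 1)) :
    toSimp n ((TopCat.toSSet.obj (TopCat.of X)).δ i a) x =
      toSimp (n + 1) a (stdSimplex.map i.succAbove x) := rfl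

theorem toSimp_map (n : ℕ) (f : C(X, Y)) (a : SSimp X n) :
    toSimp n ((TopCat.toSSet.map (TopCat.ofHom f)).app (Opposite.op (SimplexCategory.mk n)) a) =
      f.comp (toSimp n a) := rfl

theorem toCh_map (n : ℕ) (f : C(X, Y)) (x : SCh X n) :
    toCh n (((singularChainComplex.map (TopCat.ofHom f)).f n).hom x) = push f (toCh n x) := by
  have : toCh n ∘ₗ ((singularChainComplex.map (TopCat.ofHom f)).f n).hom = push f ∘ₗ toCh n :=
    free_ext fun a => by
      have e : ((singularChainComplex.map (TopCat.ofHom f)).f n).hom (freeEquiv X n (bas a)) =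
          freeEquiv Y n (bas ((TopCat.toSSet.map (TopCat.ofHom f)).app
            (Opposite.op (SimplexCategory.mk n)) a)) := Finsupp.mapDomain_single
      rw [LinearMap.comp_apply, LinearMap.comp_apply, e, toCh_bas, toCh_bas, push_bas, toSimp_map]
  exact LinearMap.congr_fun this x

/-- The face maps of the chains of the singular chain complex. -/
def face (X : Type) [TopologicalSpace X] (n : ℕ) (i : Fin (n + 2)) : SCh X (n + 1) ⟶ SCh X n :=
  (((SimplicialObject.whiskering _ _).obj (ModuleCat.free ℚ)).obj
    (TopCat.toSSet.obj (TopCat.of X))).δ i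

theorem face_bas (n : ℕ) (i : Fin (n + 2)) (a : SSimp X (n + 1)) :
    (face X n i).hom (freeEquiv X (n + 1) (bas a)) =
      freeEquiv X n (bas ((TopCat.toSSet.obj (TopCat.of X)).δ i a)) := Finsupp.mapDomain_single

theorem d_bas (n : ℕ) (a : SSimp X (n + 1)) :
    ((singularChainComplex.obj (TopCat.of X)).d (n + 1) n).hom (freeEquiv X (n + 1) (bas a)) =
      ∑ i : Fin (n + 2), (-1 : ℚ) ^ (i : ℕ) •
        freeEquiv X n (bas ((TopCat.toSSet.obj (TopCat.of X)).δ i a)) := by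
  have e : (singularChainComplex.obj (TopCat.of X)).d (n + 1) n =
      ∑ i : Fin (n + 2), (-1 : ℤ) ^ (i : ℕ) • face X n i :=
    AlgebraicTopology.alternatingFaceMapComplex_obj_d _ _
  rw [e, ModuleCat.hom_sum, LinearMap.sum_apply]
  refine Finset.sum_congr rfl fun i _ => ?_
  rw [ModuleCat.hom_zsmul, LinearMap.smul_apply, face_bas]
  rcases Nat.even_or_odd (i : ℕ) with h | h <;> simp [h.neg_one_pow]

theorem toCh_d (n : ℕ) (x : SCh X (n + 1)) :
    toCh n (((singularChainComplex.obj (TopCat.of X)).d (n + 1) n).hom x) = dd (toCh (n + 1) x) := by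
  have : toCh n ∘ₗ ((singularChainComplex.obj (TopCat.of X)).d (n + 1) n).hom =
      dd ∘ₗ toCh (X := X) (n + 1) :=
    free_ext fun a => by
      rw [LinearMap.comp_apply, LinearMap.comp_apply, d_bas, toCh_bas,
        ← rz_verts ⟨n + 1 + 1, _⟩, dd_rz, verts, bd_ofFn, map_sum, map_sum]
      refine Finset.sum_congr rfl fun i _ => ?_
      rw [map_smul, map_smul, rz_bas, toCh_bas, ← mk_aff_eq]
      congr 3
      ext x
      rw [toSimp_face, ContinuousMap.comp_apply]
      congr 1
      ext j
      rw [aff_apply_simplex]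
      simp [stdSimplex.map_coe, FunOnFinite.linearMap_apply_apply, Finset.sum_filter,
        Pi.single_apply, eq_comm]
  exact LinearMap.congr_fun this x

theorem ofCh_dd (n : ℕ) (x : Ch X) :
    ofCh n (dd x) = ((singularChainComplex.obj (TopCat.of X)).d (n + 1) n).hom (ofCh (n + 1) x) := by
  rw [← ofCh_toCh n (((singularChainComplex.obj (TopCat.of X)).d (n + 1) n).hom (ofCh (n + 1) x)),
    toCh_d, toCh_ofCh, ← proj_dd, ← toCh_ofCh, ofCh_toCh]

theorem ofCh_push (n : ℕ) (f : C(X, Y)) (x : Ch X) :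
    ofCh n (push f x) = ((singularChainComplex.map (TopCat.ofHom f)).f n).hom (ofCh n x) := by
  rw [← ofCh_toCh n (((singularChainComplex.map (TopCat.ofHom f)).f n).hom (ofCh n x)),
    toCh_map, toCh_ofCh, ← proj_push, ← toCh_ofCh, ofCh_toCh]

theorem exists_cycle (K : ChainComplex (ModuleCat.{0} ℚ) ℕ) (k : ℕ) (x : K.X (k + 1))
    (hx : (K.d (k + 1) k).hom x = 0) : ∃ c : K.cycles (k + 1), (K.iCycles (k + 1)).hom c = x := by
  let φ : ModuleCat.of ℚ ℚ ⟶ K.X (k + 1) := ModuleCat.ofHom (LinearMap.toSpanSingleton ℚ _ x)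
  have hφ : φ ≫ K.d (k + 1) k = 0 := by
    ext
    simp [φ, hx]
  refine ⟨(K.liftCycles φ k (by simp) hφ).hom (1 : ℚ), ?_⟩
  exact (congrArg (fun ψ => ψ.hom (1 : ℚ)) (K.liftCycles_i φ k (by simp) hφ)).trans (one_smul ℚ x)

theorem iCycles_injective (K : ChainComplex (ModuleCat.{0} ℚ) ℕ) (k : ℕ) :
    Function.Injective (K.iCycles k).hom :=
  (ModuleCat.mono_iff_injective _).1 inferInstance

theorem d_iCycles_apply (K : ChainComplex (ModuleCat.{0} ℚ) ℕ) (k j : ℕ) (c : K.cycles k) :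
    (K.d k j).hom ((K.iCycles k).hom c) = 0 :=
  congrArg (fun ψ => ψ.hom c) (K.iCycles_d k j)

theorem iCycles_toCycles_apply (K : ChainComplex (ModuleCat.{0} ℚ) ℕ) (i j : ℕ) (y : K.X i) :
    (K.iCycles j).hom ((K.toCycles i j).hom y) = (K.d i j).hom y :=
  congrArg (fun ψ => ψ.hom y) (K.toCycles_i i j)

/-- The homology class of a cycle. -/
def cls (k : ℕ) : (singularChainComplex.obj (TopCat.of X)).cycles k →ₗ[ℚ] H k X :=
  ((singularChainComplex.obj (TopCat.of X)).homologyπ k).hom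

theorem cls_surjective (k : ℕ) : Function.Surjective (cls (X := X) k) :=
  (ModuleCat.epi_iff_surjective
    ((singularChainComplex.obj (TopCat.of X)).homologyπ k)).1 inferInstance

theorem cls_toCycles (i k : ℕ) (y : SCh X i) :
    cls k (((singularChainComplex.obj (TopCat.of X)).toCycles i k).hom y) = 0 :=
  congrArg (fun ψ => ψ.hom y)
    ((singularChainComplex.obj (TopCat.of X)).toCycles_comp_homologyπ i k)

theorem cls_cyclesMap (k : ℕ) (f : C(X, Y)) (c) :
    cls k ((HomologicalComplex.cyclesMap (singularChainComplex.map (TopCat.ofHom f)) k).hom c) =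
      Hmap k f (cls k c) :=
  (congrArg (fun ψ => ψ.hom c) (HomologicalComplex.homologyπ_naturality
    (singularChainComplex.map (TopCat.ofHom f)) k)).symm

/-- Nonzero homology yields a cycle which is not a boundary. -/
theorem exists_cycle_not_boundary (k : ℕ) (h : Nontrivial (H (k + 1) X)) :
    ∃ α ∈ deg X (k + 2), dd α = 0 ∧ ∀ y, dd y ≠ α := by
  obtain ⟨a, ha⟩ := exists_ne (0 : H (k + 1) X)
  obtain ⟨c, rfl⟩ := cls_surjective (k + 1) a
  refine ⟨toCh (k + 1) (((singularChainComplex.obj (TopCat.of X)).iCycles (k + 1)).hom c),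
    toCh_mem_deg _ _, ?_, fun y hy => ha ?_⟩
  · rw [← toCh_d, d_iCycles_apply, map_zero]
  · have e := congrArg (ofCh (k + 1)) hy
    rw [ofCh_toCh, ofCh_dd, ← iCycles_toCycles_apply] at e
    rw [← iCycles_injective _ _ e, cls_toCycles]

/-- A cohomology class is represented by a normalized cocycle. -/
theorem exists_cocycle {k : ℕ} {u : Hco (k + 1) X} (hu : u ≠ 0) :
    ∃ v : Ch X →ₗ[ℚ] ℚ, Coc (k + 2) v ∧ Nrm v ∧ (∃ y ∈ deg X (k + 2), dd y = 0 ∧ v y ≠ 0) ∧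
      ∀ {Y : Type} [TopologicalSpace Y] (f : C(Y, X)), Hcomap (k + 1) f u = 0 →
        ∀ z, dd z = 0 → v (push f z) = 0 := by
  set K := singularChainComplex.obj (TopCat.of X) with hK
  obtain ⟨g, hg⟩ := LinearMap.exists_leftInverse_of_injective (K.iCycles (k + 1)).hom
    (LinearMap.ker_eq_bot.2 (iCycles_injective K (k + 1)))
  have hg' : ∀ c, g ((K.iCycles (k + 1)).hom c) = c := LinearMap.congr_fun hg
  let w : Ch X →ₗ[ℚ] ℚ := u ∘ₗ cls (k + 1) ∘ₗ g ∘ₗ ofCh (k + 1)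
  have hw : ∀ x c, ofCh (k + 1) x = (K.iCycles (k + 1)).hom c →
      w x = u (cls (k + 1) c) := fun x c hx => by
    simp only [w, LinearMap.comp_apply, hx, hg']
  have hc : Coc (k + 2) w := by
    refine ⟨fun a ha => ?_, fun x => ?_⟩
    · have : ofCh (k + 1) (bas a) = 0 := by
        rw [ofCh, lin_bas, dif_neg ha]
      simp only [w, LinearMap.comp_apply, this, map_zero]
    · rw [hw _ ((K.toCycles (k + 2) (k + 1)).hom (ofCh (k + 2) x)),
        cls_toCycles, map_zero]
      rw [iCycles_toCycles_apply]
      exact ofCh_dd _ _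
  refine ⟨w ∘ₗ sub, hc.comp_sub, nrm_comp_sub w, ?_, fun f hf z hz => ?_⟩
  · obtain ⟨a, ha⟩ : ∃ a, u a ≠ 0 := by
      by_contra! h
      exact hu (LinearMap.ext h)
    obtain ⟨c, rfl⟩ := cls_surjective (k + 1) a
    have hd : dd (toCh (k + 1) ((K.iCycles (k + 1)).hom c)) = 0 := by
      rw [← toCh_d, d_iCycles_apply, map_zero]
    refine ⟨toCh (k + 1) ((K.iCycles (k + 1)).hom c), toCh_mem_deg _ _, hd, ?_⟩
    rw [LinearMap.comp_apply, hc.apply_sub hd, hw _ c (ofCh_toCh _ _)]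
    exact ha
  · rw [LinearMap.comp_apply, hc.apply_sub (by rw [← push_dd, hz, map_zero])]
    obtain ⟨c, hcz⟩ := exists_cycle (singularChainComplex.obj (TopCat.of _)) k (ofCh (k + 1) z)
      (by rw [← ofCh_dd, hz, map_zero])
    rw [hw _ ((HomologicalComplex.cyclesMap (singularChainComplex.map (TopCat.ofHom f))
      (k + 1)).hom c)]
    · rw [cls_cyclesMap]
      exact LinearMap.congr_fun hf (cls (k + 1) c)
    · rw [ofCh_push, ← hcz]
      exact (congrArg (fun ψ => ψ.hom c) (HomologicalComplex.cyclesMap_i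
        (singularChainComplex.map (TopCat.ofHom f)) (k + 1))).symm

theorem hasCharts_of_isLocallyEuclidean {n : ℕ} (h : IsLocallyEuclidean n X) : HasCharts n X := by
  intro x
  obtain ⟨U, hx, hU, ⟨e⟩⟩ := h x
  refine ⟨⟨fun y => (e.symm y : X), by fun_prop⟩,
    hU.isOpenEmbedding_subtypeVal.comp e.symm.isOpenEmbedding, e ⟨x, hx⟩, ?_⟩
  simp

/-- A motion planning cover can be enlarged by empty sets. -/
theorem exists_motionPlan_cover {m q : ℕ} (h : TCCoverable X m) (hmq : m ≤ q) :
    ∃ V : Fin q → Set (X × X), (∀ i, IsOpen (V i)) ∧ (∀ i, MotionPlan (V i)) ∧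
      ⋃ i, V i = Set.univ := by
  obtain ⟨U, hU, hcov, hs⟩ := h
  refine ⟨fun i => if hi : (i : ℕ) < m then U ⟨i, hi⟩ else ∅, fun i => ?_, fun i => ?_, ?_⟩
  · dsimp only
    split_ifs with hi
    exacts [hU _, isOpen_empty]
  · dsimp only
    split_ifs with hi
    · obtain ⟨s, hs⟩ := hs ⟨i, hi⟩
      exact ⟨⟨fun p => s p.1 p.2, by fun_prop⟩, hs⟩
    · exact ⟨⟨fun p => p.1.2.elim, continuous_of_const fun p => p.1.2.elim⟩, fun p => p.2.elim⟩
  · refine Set.eq_univ_of_forall fun p => ?_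
    obtain ⟨i, hi⟩ := Set.mem_iUnion.1 (hcov ▸ Set.mem_univ p)
    refine Set.mem_iUnion.2 ⟨Fin.castLE hmq i, ?_⟩
    simpa using hi

theorem le_topologicalComplexity {q : ℕ}
    (h : ∀ V : Fin q → Set (X × X), (∀ i, IsOpen (V i)) → (∀ i, MotionPlan (V i)) →
      ⋃ i, V i = Set.univ → False) : ((q + 1 : ℕ) : ℕ∞) ≤ topologicalComplexity X := by
  refine le_sInf ?_
  rintro _ ⟨m, rfl, hm⟩
  rw [Nat.cast_le]
  by_contra hq
  obtain ⟨V, hV, hp, hcov⟩ := exists_motionPlan_cover hm (show m ≤ q by omega)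
  exact h V hV hp hcov

end Bridge
end SingChain

/-- **Theorem.**  Let `M` be a closed oriented `n`-manifold, `n ≥ 3`, such that
`H²(M; ℚ)` contains an atoroidal class.  Then `TC(M) ≥ 6` if `n` is odd, and
`TC(M) ≥ 7` if `n` is even. -/
theorem tc_lower_bound_of_atoroidal_class
    (n : ℕ) (hn : 3 ≤ n) (M : Type) [TopologicalSpace M]
    (hM : IsClosedOrientedManifold n M)
    (u : Hco 2 M) (hu : IsCoAtoroidal u) :
    (Odd n → 6 ≤ topologicalComplexity M) ∧ (Even n → 7 ≤ topologicalComplexity M) := by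
  obtain ⟨hcpt, hT2, -, hconn, hloc, hnt⟩ := hM
  obtain ⟨k, rfl⟩ : ∃ k, n = k + 3 := ⟨n - 3, by omega⟩
  have hch := SingChain.hasCharts_of_isLocallyEuclidean hloc
  obtain ⟨α, hαd, hα, hαb⟩ := SingChain.exists_cycle_not_boundary (k + 2) hnt
  obtain ⟨v, hv, hvn, ⟨y, hyd, hy, hvy⟩, ht⟩ := SingChain.exists_cocycle hu.1
  have ht' := fun f : C(Torus2, M) => ht f (hu.2 f)
  constructor
  · intro hodd
    refine SingChain.le_topologicalComplexity fun V hV hp hcov => ?_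
    refine SingChain.no_five_motion_plans (k := k) ?_ hch hαd hα hαb hv hvn hyd hy hvy ht' hV hp hcov
    rintro rfl
    exact absurd hodd (by decide)
  · intro heven
    refine SingChain.le_topologicalComplexity fun V hV hp hcov => ?_
    refine SingChain.no_six_motion_plans (k := k) ?_ hch hαd hα hαb hv hvn hyd hy hvy ht' hV hp hcov
    obtain ⟨j, hj⟩ := heven
    exact ⟨j - 2, by omega⟩

end
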